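/- For every ε > 0 there exists a constant C = C(ε, q) such that for every n ≥ 1, every F_q-linear form ℓ : F_q^n → F_q, and every additive character χ of F_q, one has |∑_{f ∈ F_q[t], deg f < n} μ(f) · χ(ℓ(x_0(f), …, x_{n−1}(f)))| ≤ C · q^{(3/4 + ε)n}. -/

import Mathlib

open Polynomial

/- The Möbius function on `F_q[t]`: `(-1)^k` if `f` is squarefree with `k` monic
irreducible factors, and `0` otherwise. -/
open scoped Classical in
noncomputable def polyMu {F : Type*} [Field F] (f : Polynomial F) : ℤ :=
  if Squarefree f then (-1) ^ (UniqueFactorizationMonoid.normalizedFactors f).card else 0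

/-- The polynomial of degree `< n` with coefficient vector `x ∈ F_q^n`. -/
noncomputable def lowPoly (F : Type*) [Field F] (n : ℕ) (x : Fin n → F) : Polynomial F :=
  ∑ i : Fin n, C (x i) * X ^ (i : ℕ)

section DegreeFiltration

variable {k S : Type*} [Field k] [CommRing S] [Algebra k S] [Algebra k[X] S]
  [IsScalarTower k k[X] S] {r : ℕ}

/-- The elements all of whose coordinates in a `k[X]`-basis have degree less than `A`. -/
noncomputable def degFilt (e : Module.Basis (Fin r) k[X] S) (A : ℕ) : Submodule k S where
  carrier := {s | ∀ i, e.repr s i ∈ degreeLT k A}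
  zero_mem' := fun i => by simp
  add_mem' := fun {a b} ha hb i => by
    simpa using Submodule.add_mem _ (ha i) (hb i)
  smul_mem' := fun c s hs i => by
    have : c • s = (C c : k[X]) • s := by
      rw [← algebraMap_smul k[X] c s]; rfl
    rw [this, map_smul, Finsupp.smul_apply, smul_eq_mul, ← smul_eq_C_mul]
    exact Submodule.smul_mem _ _ (hs i)


variable (e : Module.Basis (Fin r) k[X] S)

/-- Coordinates identify the degree filtration with tuples of polynomials of bounded degree. -/
noncomputable def degFiltEquiv (A : ℕ) : degFilt e A ≃ₗ[k] (Fin r → degreeLT k A) where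
  toFun s i := ⟨e.repr s i, s.2 i⟩
  invFun f := ⟨e.equivFun.symm fun i => (f i : k[X]), fun i => by
    rw [← Module.Basis.equivFun_apply, LinearEquiv.apply_symm_apply]; exact (f i).2⟩
  map_add' s t := by ext1 i; ext1; simp
  map_smul' c s := by
    ext1 i; ext1
    have : c • (s : S) = (C c : k[X]) • (s : S) := by
      rw [← algebraMap_smul k[X] c (s : S)]; rfl
    simp [this, smul_eq_C_mul]
  left_inv s := by
    ext1
    exact e.equivFun.symm_apply_apply (s : S)
  right_inv f := by
    ext1 i; ext1
    exact congrFun (e.equivFun.apply_symm_apply fun i => (f i : k[X])) i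

instance finite_degFilt (A : ℕ) : Module.Finite k (degFilt e A) :=
  have : Module.Finite k (degreeLT k A) := Module.Finite.equiv (degreeLTEquiv k A).symm
  Module.Finite.equiv (degFiltEquiv e A).symm

theorem finrank_degFilt (A : ℕ) : Module.finrank k (degFilt e A) = r * A := by
  have : Module.Finite k (degreeLT k A) := Module.Finite.equiv (degreeLTEquiv k A).symm
  rw [(degFiltEquiv e A).finrank_eq, Module.finrank_pi_fintype,
    Finset.sum_const, (degreeLTEquiv k A).finrank_eq]
  simp

theorem degFilt_mono {A B : ℕ} (h : A ≤ B) : degFilt e A ≤ degFilt e B :=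
  fun _ hs i => degreeLT_mono h (hs i)

theorem exists_mem_degFilt (s : S) : ∃ A, s ∈ degFilt e A := by
  refine ⟨(Finset.univ.sup fun i => (e.repr s i).natDegree) + 1, fun i => ?_⟩
  rw [mem_degreeLT]
  refine lt_of_le_of_lt degree_le_natDegree ?_
  exact_mod_cast Nat.lt_succ_of_le
    (Finset.le_sup (f := fun i => (e.repr s i).natDegree) (Finset.mem_univ i))

theorem exists_forall_mem_degFilt {ι : Type*} [Finite ι] (s : ι → S) :
    ∃ A, ∀ i, s i ∈ degFilt e A := by
  cases nonempty_fintype ι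
  choose A hA using fun i => exists_mem_degFilt e (s i)
  exact ⟨Finset.univ.sup A, fun i => degFilt_mono e (Finset.le_sup (Finset.mem_univ i)) (hA i)⟩

theorem smul_mem_degFilt {A B : ℕ} {a : k[X]} {s : S} (ha : a ∈ degreeLT k A)
    (hs : s ∈ degFilt e B) : a • s ∈ degFilt e (A + B) := fun i => by
  rw [map_smul, Finsupp.smul_apply, smul_eq_mul, mem_degreeLT]
  have h1 := mem_degreeLT.1 ha
  have h2 := mem_degreeLT.1 (hs i)
  by_cases h : a = 0
  · simp [h]
  by_cases h' : e.repr s i = 0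
  · simp [h']
  rw [degree_eq_natDegree h] at h1
  rw [degree_eq_natDegree h'] at h2
  rw [degree_mul, degree_eq_natDegree h, degree_eq_natDegree h']
  norm_cast at *
  omega

theorem exists_mul_mem_degFilt : ∃ c, ∀ A B (s t : S), s ∈ degFilt e A → t ∈ degFilt e B →
    s * t ∈ degFilt e (A + B + c) := by
  obtain ⟨c, hc⟩ := exists_forall_mem_degFilt e fun p : Fin r × Fin r => e p.1 * e p.2
  refine ⟨c, fun A B s t hs ht => ?_⟩
  rw [← e.sum_repr s, ← e.sum_repr t, Finset.sum_mul_sum]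
  refine Submodule.sum_mem _ fun i _ => Submodule.sum_mem _ fun j _ => ?_
  rw [smul_mul_smul_comm, mul_smul, add_assoc]
  exact smul_mem_degFilt e (hs i) (smul_mem_degFilt e (ht j) (hc (i, j)))

theorem exists_algHom_mem_degFilt (σ : S →ₐ[k[X]] S) : ∃ c, ∀ A s, s ∈ degFilt e A →
    σ s ∈ degFilt e (A + c) := by
  obtain ⟨c, hc⟩ := exists_forall_mem_degFilt e fun i => σ (e i)
  refine ⟨c, fun A s hs => ?_⟩
  rw [← e.sum_repr s, map_sum]
  refine Submodule.sum_mem _ fun i _ => ?_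
  rw [map_smul]
  exact smul_mem_degFilt e (hs i) (hc i)

theorem pow_mem_degFilt {c : ℕ} (hc : ∀ A B (s t : S), s ∈ degFilt e A → t ∈ degFilt e B →
    s * t ∈ degFilt e (A + B + c)) {A : ℕ} {s : S} (hs : s ∈ degFilt e A) {n : ℕ} (hn : 1 ≤ n) :
    s ^ n ∈ degFilt e (n * (A + c)) := by
  induction n, hn using Nat.le_induction with
  | base => simpa using degFilt_mono e (Nat.le_add_right A c) hs
  | succ n _ ih =>
    rw [pow_succ]
    convert hc _ _ _ _ ih hs using 2
    ring

variable [IsDomain S]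

/-- The quotient by a nonzero element of bounded degree has bounded dimension. -/
theorem finrank_range_le_of_mem_degFilt {c : ℕ} (hc : ∀ A B (s t : S), s ∈ degFilt e A →
    t ∈ degFilt e B → s * t ∈ degFilt e (A + B + c)) {E : ℕ} {s : S} (hs : s ∈ degFilt e E)
    (hs0 : s ≠ 0) {V : Type*} [AddCommGroup V] [Module k V] (f : S →ₗ[k] V)
    (hf : ∀ t, f (s * t) = 0) (T : ℕ) :
    Module.finrank k ((degFilt e (T + E + c)).map f) ≤ r * (E + c) := by
  set W := degFilt e (T + E + c)
  let g : degFilt e T →ₗ[k] LinearMap.ker (f.domRestrict W) :=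
    { toFun := fun t => ⟨⟨s * t, by
          have := hc _ _ _ _ hs t.2
          rwa [add_comm E T] at this⟩, hf _⟩
      map_add' := fun a b => by ext; simp [mul_add]
      map_smul' := fun a b => by ext; simp }
  have hg : Function.Injective g := fun a b hab => by
    have : s * (a : S) = s * b := congrArg (fun z : LinearMap.ker (f.domRestrict W) => ((z : W) : S)) hab
    exact Subtype.ext (mul_left_cancel₀ hs0 this)
  have h1 := LinearMap.finrank_le_finrank_of_injective hg
  have h2 := LinearMap.finrank_range_add_finrank_ker (f.domRestrict W)
  have h3 : LinearMap.range (f.domRestrict W) = W.map f := by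
    rw [LinearMap.range_domRestrict]
  rw [h3] at h2
  rw [finrank_degFilt] at h1 h2
  have : r * (T + E + c) = r * T + r * (E + c) := by ring
  omega

theorem finite_of_mem_degFilt {c : ℕ} (hc : ∀ A B (s t : S), s ∈ degFilt e A →
    t ∈ degFilt e B → s * t ∈ degFilt e (A + B + c)) {E : ℕ} {s : S} (hs : s ∈ degFilt e E)
    (hs0 : s ≠ 0) {V : Type*} [AddCommGroup V] [Module k V] (f : S →ₗ[k] V)
    (hsurj : Function.Surjective f) (hf : ∀ t, f (s * t) = 0) :
    Module.Finite k V ∧ Module.finrank k V ≤ r * (E + c) := by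
  have key : ∃ T, (degFilt e (T + E + c)).map f = ⊤ := by
    set d : ℕ → ℕ := fun T => Module.finrank k ((degFilt e (T + E + c)).map f)
    have hb : BddAbove (Set.range d) := ⟨r * (E + c), by
      rintro _ ⟨T, rfl⟩; exact finrank_range_le_of_mem_degFilt e hc hs hs0 f hf T⟩
    obtain ⟨T, hT⟩ := Nat.sSup_mem (Set.range_nonempty d) hb
    refine ⟨T, eq_top_iff.2 fun v _ => ?_⟩
    obtain ⟨t, rfl⟩ := hsurj v
    obtain ⟨B, hB⟩ := exists_mem_degFilt e t
    have hle : (degFilt e (T + E + c)).map f ≤ (degFilt e (max T B + E + c)).map f :=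
      Submodule.map_mono (degFilt_mono e (by have := le_max_left T B; omega))
    have heq := Submodule.eq_of_le_of_finrank_le hle (by
      change d (max T B) ≤ d T
      rw [hT]; exact le_csSup hb ⟨_, rfl⟩)
    rw [heq]
    exact ⟨t, degFilt_mono e (by have := le_max_right T B; omega) hB, rfl⟩
  obtain ⟨T, hT⟩ := key
  constructor
  · have : Module.Finite k ((degFilt e (T + E + c)).map f) := inferInstance
    rw [hT] at this
    exact Module.Finite.equiv Submodule.topEquiv
  · have := finrank_range_le_of_mem_degFilt e hc hs hs0 f hf T
    rwa [hT, finrank_top] at this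

variable {e}

theorem le_of_X_pow_dvd {c : ℕ} (hc : ∀ A B (s t : S), s ∈ degFilt e A →
    t ∈ degFilt e B → s * t ∈ degFilt e (A + B + c)) (θ : S →ₐ[k[X]] PowerSeries k)
    {E : ℕ} {s : S} (hs : s ∈ degFilt e E) (hs0 : s ≠ 0) {n : ℕ}
    (hn : (PowerSeries.X : PowerSeries k) ^ n ∣ θ s) : n ≤ r * (E + c) := by
  let f : S →ₗ[k] (Fin n → k) :=
    LinearMap.pi fun i => (PowerSeries.coeff (R := k) (i : ℕ)).comp
      ((θ.restrictScalars k).toLinearMap)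
  have hf : ∀ t (i : Fin n), f t i = PowerSeries.coeff (i : ℕ) (θ t) := fun t i => rfl
  have hsurj : Function.Surjective f := fun v => by
    refine ⟨algebraMap k[X] S (∑ i : Fin n, monomial (i : ℕ) (v i)), funext fun i => ?_⟩
    rw [hf, AlgHom.commutes, PowerSeries.algebraMap_apply']
    simp [coeff_monomial, Fin.val_inj]
  have h := (finite_of_mem_degFilt e hc hs hs0 f hsurj fun t => funext fun i => by
    rw [hf, map_mul]
    exact PowerSeries.X_pow_dvd_iff.1 (hn.mul_right _) _ i.2).2
  simpa using h

variable [Fintype k]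

/-- A linear combination of independent elements of bounded degree with coefficients that are
high powers of power series only vanishes trivially. -/
theorem X_pow_dvd_of_sum_mul_pow_eq_zero {c : ℕ} (hc : ∀ A B (s t : S), s ∈ degFilt e A →
    t ∈ degFilt e B → s * t ∈ degFilt e (A + B + c)) (θ : S →ₐ[k[X]] PowerSeries k)
    {A : ℕ} {ι : Type*} [Fintype ι] (u : ι → S) (hu : ∀ i, u i ∈ degFilt e A)
    (hui : LinearIndependent k u) {j : ℕ} (hP : r * (A + c) < Fintype.card k ^ j)
    (γ : ι → PowerSeries k) (h : ∑ i, θ (u i) * γ i ^ (Fintype.card k ^ j) = 0) (n : ℕ) (i : ι) :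
    (PowerSeries.X : PowerSeries k) ^ n ∣ γ i := by
  obtain ⟨p, hp⟩ := CharP.exists k
  obtain ⟨l, hpp, hl⟩ := FiniteField.card k p
  have : Fact p.Prime := ⟨hpp⟩
  have : CharP (PowerSeries k) p := charP_of_injective_algebraMap (algebraMap k _).injective p
  have hcard : Fintype.card k ^ j = p ^ (l * j : ℕ) := by rw [hl, pow_mul]
  induction n generalizing i with
  | zero => simp
  | succ n ih =>
    choose δ hδ using ih
    have h1 : ∑ i, θ (u i) * δ i ^ (Fintype.card k ^ j) = 0 := by
      have : (PowerSeries.X ^ n) ^ (Fintype.card k ^ j) *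
          ∑ i, θ (u i) * δ i ^ (Fintype.card k ^ j) = 0 := by
        rw [← h, Finset.mul_sum]
        refine Finset.sum_congr rfl fun i _ => ?_
        rw [hδ i, mul_pow]; ring
      exact (mul_eq_zero.1 this).resolve_left
        (pow_ne_zero _ (pow_ne_zero _ PowerSeries.X_ne_zero))
    set s : S := ∑ i, PowerSeries.constantCoeff (δ i) • u i with hs
    have hsA : s ∈ degFilt e A :=
      Submodule.sum_mem _ fun i _ => Submodule.smul_mem _ _ (hu i)
    have hdvd : (PowerSeries.X : PowerSeries k) ^ (Fintype.card k ^ j) ∣ θ s := by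
      have : θ s = - ∑ i, θ (u i) *
          (δ i - PowerSeries.C (PowerSeries.constantCoeff (δ i))) ^ (Fintype.card k ^ j) := by
        have hC : ∀ a : k, (PowerSeries.C a) ^ (Fintype.card k ^ j) = PowerSeries.C a := fun a => by
          rw [← map_pow, FiniteField.pow_card_pow]
        simp_rw [hcard, sub_pow_char_pow, ← hcard, hC, mul_sub, Finset.sum_sub_distrib, h1, hs,
          map_sum]
        rw [zero_sub, neg_neg]
        refine Finset.sum_congr rfl fun i _ => ?_
        have := map_smul (θ.restrictScalars k) (PowerSeries.constantCoeff (δ i)) (u i)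
        rw [AlgHom.restrictScalars_apply, AlgHom.restrictScalars_apply] at this
        rw [this, PowerSeries.smul_eq_C_mul, mul_comm]
      rw [this]
      refine (Finset.dvd_sum fun i _ => Dvd.dvd.mul_left (pow_dvd_pow_of_dvd ?_ _) _).neg_right
      rw [PowerSeries.X_dvd_iff]; simp
    have hs0 : s = 0 := by
      by_contra hs0
      exact absurd (le_of_X_pow_dvd hc θ hsA hs0 hdvd) (not_le.2 hP)
    have h0 := Fintype.linearIndependent_iff.1 hui _ hs0 i
    rw [hδ i, pow_succ]
    exact mul_dvd_mul_left _ (PowerSeries.X_dvd_iff.2 h0)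

/-- The numerical choice of parameters in Stepanov's method. -/
theorem exists_stepanov_parameters {r : ℕ} (hr : 0 < r) (c d : ℕ) :
    ∃ C P₀ : ℕ, ∀ P, P₀ ≤ P → ∃ A B : ℕ, r * (A + c) < P ∧
      P * (A + c) + (B + d) + c < r * A * B ∧
      r * (A + P * (B + c) + c + c) ≤ P ^ 2 + C * P := by
  set m := 4 * (c + 2) + 1 with hm
  refine ⟨r * m + 3 * (r * c) + 1, 4 * r + 2 * (r * c) + m + c + d + 1, fun P hP => ?_⟩
  refine ⟨P / (2 * r), P / r + m, ?_⟩
  obtain ⟨A, hA⟩ : ∃ A, A = P / (2 * r) := ⟨_, rfl⟩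
  obtain ⟨B, hB⟩ : ∃ B, B = P / r := ⟨_, rfl⟩
  have hA1 : 2 * r * A ≤ P := by rw [hA]; exact Nat.mul_div_le _ _
  have hA2 : P < 2 * r * (A + 1) := by
    rw [hA]; exact Nat.lt_mul_div_succ _ (by omega)
  have hB1 : r * B ≤ P := by rw [hB]; exact Nat.mul_div_le _ _
  have hB2 : P < r * (B + 1) := by rw [hB]; exact Nat.lt_mul_div_succ _ hr
  have hB3 : B ≤ P := by rw [hB]; exact Nat.div_le_self _ _
  rw [← hA, ← hB]
  have hApos : 0 < A := by
    rw [hA]; exact Nat.div_pos (by omega) (by omega)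
  refine ⟨by nlinarith, ?_, ?_⟩
  · have h1 : P + 4 * (r * (c + 2)) + 1 ≤ r * (B + m) := by
      rw [hm]; nlinarith
    have h2 : A * (P + 4 * (r * (c + 2)) + 1) ≤ r * A * (B + m) := by
      calc _ ≤ A * (r * (B + m)) := Nat.mul_le_mul_left _ h1
        _ = _ := by ring
    have h3 : P * (c + 2) ≤ A * (4 * (r * (c + 2))) := by
      have : P ≤ 4 * r * A := by nlinarith
      nlinarith
    nlinarith
  · have h1 : r * A ≤ P := by nlinarith
    have h2 : 1 ≤ P := by omega
    have h3 : r * c ≤ P * (r * c) := Nat.le_mul_of_pos_left _ h2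
    have h4 : P * (r * B) ≤ P * P := Nat.mul_le_mul_left _ hB1
    nlinarith

/-- Stepanov's method: the number of geometric points with prescribed Frobenius. -/
theorem card_le_of_pow_eq {k S Ω : Type*} [Field k] [Fintype k] [CommRing S] [IsDomain S]
    [Algebra k S] [Algebra k[X] S] [IsScalarTower k k[X] S] {r : ℕ}
    (e : Module.Basis (Fin r) k[X] S) (θ : S →ₐ[k[X]] PowerSeries k)
    (hθ : Function.Injective θ) [Field Ω] [Algebra k Ω] (σ : S →ₐ[k[X]] S) :
    ∃ C j₀ : ℕ, ∀ j, j₀ ≤ j → ∀ Φ : Finset (S →ₐ[k] Ω),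
      (∀ φ ∈ Φ, ∀ s, φ s ^ ((Fintype.card k ^ j) ^ 2) = φ (σ s)) →
      Φ.card ≤ (Fintype.card k ^ j) ^ 2 + C * Fintype.card k ^ j := by
  have hr : 0 < r := by
    rcases Nat.eq_zero_or_pos r with rfl | h
    · have := e.index_nonempty
      exact this.elim fun i => i.elim0
    · exact h
  obtain ⟨c, hc⟩ := exists_mul_mem_degFilt (k := k) e
  obtain ⟨d, hd⟩ := exists_algHom_mem_degFilt (k := k) e σ
  obtain ⟨C, P₀, hpar⟩ := exists_stepanov_parameters hr c d
  refine ⟨C, P₀, fun j hj Φ hΦ => ?_⟩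
  obtain ⟨p, hp⟩ := CharP.exists k
  obtain ⟨l, hpp, hl⟩ := FiniteField.card k p
  have : Fact p.Prime := ⟨hpp⟩
  have : CharP Ω p := charP_of_injective_algebraMap (algebraMap k _).injective p
  have hcard : Fintype.card k ^ j = p ^ (l * j : ℕ) := by rw [hl, pow_mul]
  obtain ⟨A, B, h1, h2, h3⟩ := hpar (Fintype.card k ^ j)
    (hj.trans (Nat.lt_pow_self Fintype.one_lt_card).le)
  have hP1 : 1 ≤ Fintype.card k ^ j := Nat.one_le_pow _ _ Fintype.card_pos
  set P := Fintype.card k ^ j with hP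
  let u := Module.finBasis k (degFilt e A)
  let v := Module.finBasis k (degFilt e B)
  let Ψ : (Fin (Module.finrank k (degFilt e A)) × Fin (Module.finrank k (degFilt e B)) → k) →ₗ[k]
      degFilt e (P * (A + c) + (B + d) + c) :=
    Fintype.linearCombination k fun ij => ⟨(u ij.1 : S) ^ P * σ (v ij.2),
      hc _ _ _ _ (pow_mem_degFilt e hc (u ij.1).2 hP1) (hd _ _ (v ij.2).2)⟩
  have hker : LinearMap.ker Ψ ≠ ⊥ := by
    refine LinearMap.ker_ne_bot_of_finrank_lt ?_
    rw [finrank_degFilt, Module.finrank_fintype_fun_eq_card, Fintype.card_prod, Fintype.card_fin,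
      Fintype.card_fin, finrank_degFilt, finrank_degFilt]
    calc _ < r * (r * A * B) := Nat.mul_lt_mul_of_pos_left h2 hr
      _ = _ := by ring
  obtain ⟨a, ha, ha0⟩ := Submodule.exists_mem_ne_zero_of_ne_bot hker
  have hΨ : ∑ ij, a ij • ((u ij.1 : S) ^ P * σ (v ij.2)) = 0 := by
    have := congrArg Subtype.val (LinearMap.mem_ker.1 ha)
    simpa [Ψ, Fintype.linearCombination_apply] using this
  set s : S := ∑ ij, a ij • ((u ij.1 : S) * (v ij.2 : S) ^ P) with hs
  have hsE : s ∈ degFilt e (A + P * (B + c) + c) :=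
    Submodule.sum_mem _ fun ij _ => Submodule.smul_mem _ _
      (hc _ _ _ _ (u ij.1).2 (pow_mem_degFilt e hc (v ij.2).2 hP1))
  have hφs : ∀ φ ∈ Φ, φ s = 0 := fun φ hφ => by
    refine eq_zero_of_pow_eq_zero (n := P) ?_
    have : φ s ^ P = φ (∑ ij, a ij • ((u ij.1 : S) ^ P * σ (v ij.2))) := by
      rw [hs, map_sum, map_sum, hcard, sum_pow_char_pow, ← hcard]
      refine Finset.sum_congr rfl fun ij _ => ?_
      rw [map_smul, map_smul, _root_.smul_pow, map_mul, map_mul, mul_pow, map_pow, map_pow,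
        ← pow_mul, ← sq, hΦ φ hφ, hP, FiniteField.pow_card_pow]
    rw [this, hΨ, map_zero]
  have hs0 : s ≠ 0 := fun hs0 => ha0 (by
    have hγ : ∑ i, θ (u i : S) * (θ (∑ j, a (i, j) • (v j : S))) ^ P = 0 := by
      have : CharP (PowerSeries k) p :=
        charP_of_injective_algebraMap (algebraMap k _).injective p
      have : CharP S p := charP_of_injective_algebraMap (algebraMap k _).injective p
      rw [← map_zero θ, ← hs0, hs, Fintype.sum_prod_type, map_sum]
      refine Finset.sum_congr rfl fun i _ => ?_
      rw [← map_pow, ← map_mul, hcard, sum_pow_char_pow, ← hcard, Finset.mul_sum]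
      congr 1
      refine Finset.sum_congr rfl fun j _ => ?_
      rw [_root_.smul_pow, hP, FiniteField.pow_card_pow, mul_smul_comm]
    have hz := X_pow_dvd_of_sum_mul_pow_eq_zero hc θ (fun i => (u i : S)) (fun i => (u i).2)
      (u.linearIndependent.map' (degFilt e A).subtype (Submodule.ker_subtype _)) h1 _ hγ
    funext ⟨i, j⟩
    have h0 : ∑ j, a (i, j) • (v j : S) = 0 := by
      refine hθ ?_
      rw [map_zero]
      ext n
      exact PowerSeries.X_pow_dvd_iff.1 (hz (n + 1) i) n n.lt_succ_self
    exact Fintype.linearIndependent_iff.1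
      (v.linearIndependent.map' (degFilt e B).subtype (Submodule.ker_subtype _)) _ h0 j)
  let I : Ideal S := Ideal.span {s}
  obtain ⟨hfin, hrank⟩ := finite_of_mem_degFilt e hc hsE hs0 (Ideal.Quotient.mkₐ k I).toLinearMap
    (Ideal.Quotient.mkₐ_surjective k I) fun t =>
      Ideal.Quotient.eq_zero_iff_mem.2
        (Ideal.mul_mem_right t I (Ideal.mem_span_singleton_self s))
  refine le_trans ?_ (hrank.trans h3)
  let lift : Φ → ((S ⧸ I) →ₐ[k] Ω) := fun φ => Ideal.Quotient.liftₐ I φ.1 fun x hx => by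
    obtain ⟨y, rfl⟩ := Ideal.mem_span_singleton.1 hx
    rw [map_mul, hφs φ.1 φ.2, zero_mul]
  have hinj : Function.Injective lift := fun φ ψ h => Subtype.ext (AlgHom.ext fun x =>
    AlgHom.congr_fun h (Ideal.Quotient.mk I x))
  calc Φ.card = Nat.card Φ := by simp
    _ ≤ Nat.card ((S ⧸ I) →ₐ[k] Ω) := Nat.card_le_card_of_injective _ hinj
    _ ≤ _ := card_algHom_le_finrank k (S ⧸ I) Ω

end DegreeFiltration

section LangTorsor

variable {F ι : Type*} [Field F] [Fintype F] [Fintype ι] [DecidableEq ι]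

theorem Matrix.map_pow_card_mul (F : Type*) [Field F] [Fintype F] {D : Type*} [CommRing D]
    [Algebra F D] (A B : Matrix ι ι D) :
    (A * B).map (· ^ Fintype.card F) =
      A.map (· ^ Fintype.card F) * B.map (· ^ Fintype.card F) :=
  map_mul (FiniteField.frobeniusAlgHom F D).mapMatrix A B

theorem Matrix.map_pow_card_pow_mul (F : Type*) [Field F] [Fintype F] {D : Type*} [CommRing D]
    [Algebra F D] (A B : Matrix ι ι D) (n : ℕ) :
    (A * B).map (· ^ Fintype.card F ^ n) =
      A.map (· ^ Fintype.card F ^ n) * B.map (· ^ Fintype.card F ^ n) := by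
  induction n with
  | zero => simp
  | succ n ih =>
    have h : ∀ M : Matrix ι ι D, M.map (· ^ Fintype.card F ^ (n + 1)) =
        (M.map (· ^ Fintype.card F ^ n)).map (· ^ Fintype.card F) := fun M => by
      ext i j; simp [pow_succ, pow_mul]
    rw [h, h, h, ih, Matrix.map_pow_card_mul F]

theorem Matrix.map_algebraMap_map_pow_card {ι D : Type*} [CommRing D] [Algebra F D]
    (A : Matrix ι ι F) : (A.map (algebraMap F D)).map (· ^ Fintype.card F) =
      A.map (algebraMap F D) := by
  ext i j; simp [← map_pow, FiniteField.pow_card]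

theorem Matrix.det_map_pow_card (F : Type*) [Field F] [Fintype F] {D : Type*} [CommRing D]
    [Algebra F D] (A : Matrix ι ι D) :
    (A.map (· ^ Fintype.card F)).det = A.det ^ Fintype.card F :=
  ((FiniteField.frobeniusAlgHom F D).toRingHom.map_det A).symm

theorem FiniteField.mem_range_algebraMap_of_pow_card {D : Type*} [Field D] [Algebra F D] {x : D}
    (hx : x ^ Fintype.card F = x) : x ∈ Set.range (algebraMap F D) := by
  have h := FiniteField.roots_X_pow_card_sub_X F
  have hs : Polynomial.Splits (X ^ Fintype.card F - X : F[X]) := by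
    rw [splits_iff_card_roots, h, FiniteField.X_pow_card_sub_X_natDegree_eq F Fintype.one_lt_card]
    simp
  have h2 := hs.roots_map (algebraMap F D)
  have h3 : x ∈ ((X ^ Fintype.card F - X : F[X]).map (algebraMap F D)).roots := by
    rw [mem_roots']
    refine ⟨?_, by simp [hx]⟩
    rw [Ne, Polynomial.map_eq_zero]
    exact FiniteField.X_pow_card_sub_X_ne_zero F Fintype.one_lt_card
  rw [h2, Multiset.mem_map] at h3
  obtain ⟨a, -, ha⟩ := h3
  exact ⟨a, ha⟩

/-- Two solutions of a Frobenius-linear system differ by a constant matrix. -/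
theorem exists_eq_mul_map_algebraMap {D : Type*} [Field D] [Algebra F D] {W Y Z : Matrix ι ι D}
    (hW : W.det ≠ 0) (hY0 : Y.det ≠ 0) (hY : Y.map (· ^ Fintype.card F) = W * Y)
    (hZ : Z.map (· ^ Fintype.card F) = W * Z) :
    ∃ h : Matrix ι ι F, Z = Y * h.map (algebraMap F D) := by
  have hYu : IsUnit Y.det := isUnit_iff_ne_zero.2 hY0
  have hWu : IsUnit W.det := isUnit_iff_ne_zero.2 hW
  have hYZ : Y * (Y⁻¹ * Z) = Z := by
    rw [← mul_assoc, Matrix.mul_nonsing_inv _ hYu, one_mul]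
  have hfix : (Y⁻¹ * Z).map (· ^ Fintype.card F) = Y⁻¹ * Z := by
    have h1 : W * Y * (Y⁻¹ * Z).map (· ^ Fintype.card F) = W * Y * (Y⁻¹ * Z) := by
      rw [← hY, ← Matrix.map_pow_card_mul F, hYZ, hZ, hY, mul_assoc, hYZ]
    have hu : IsUnit (W * Y) := (Matrix.isUnit_iff_isUnit_det _).2 (by
      rw [Matrix.det_mul]; exact hWu.mul hYu)
    exact hu.mul_left_cancel h1
  have : ∀ i j, ∃ a : F, algebraMap F D a = (Y⁻¹ * Z) i j := fun i j =>
    FiniteField.mem_range_algebraMap_of_pow_card (congrFun (congrFun hfix i) j)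
  choose h hh using this
  refine ⟨Matrix.of h, ?_⟩
  have : (Matrix.of h).map (algebraMap F D) = Y⁻¹ * Z := by
    ext i j; exact hh i j
  rw [this, hYZ]

theorem isIntegral_of_pow_mem_span {R L τ : Type*} [CommRing R] [Field L] [Algebra R L]
    [Finite τ] (y : τ → L) {n : ℕ} (hn : 2 ≤ n)
    (h : ∀ a, y a ^ n ∈ Submodule.span R (Set.range y)) (a : τ) : IsIntegral R (y a) := by
  have key : y a ∈ (integralClosure (Subring.closure (Set.range (algebraMap R L))) L).toSubring := by
    rw [← iInf_valuationSubring_superset]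
    simp only [Subring.mem_iInf]
    rintro ⟨V, hV⟩
    have : Nonempty τ := ⟨a⟩
    obtain ⟨b, hb⟩ := Finite.exists_max fun a => V.valuation (y a)
    have hspan : ∀ z ∈ Submodule.span R (Set.range y), V.valuation z ≤ V.valuation (y b) := by
      intro z hz
      induction hz using Submodule.span_induction with
      | mem x hx => obtain ⟨c, rfl⟩ := hx; exact hb c
      | zero => simp
      | add x x' _ _ hx hx' => exact V.valuation.map_add_le hx hx'
      | smul c x _ hx =>
        rw [Algebra.smul_def, map_mul]
        have : V.valuation (algebraMap R L c) ≤ 1 :=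
          (V.valuation_le_one_iff _).2 (hV ⟨c, rfl⟩)
        exact (mul_le_of_le_one_left' this).trans hx
    have hle : V.valuation (y b) ≤ 1 := by
      by_contra hlt
      have h1 := hspan _ (h b)
      rw [map_pow] at h1
      exact absurd h1 (not_le.2 (lt_self_pow₀ (not_le.1 hlt) (by omega)))
    exact (V.valuation_le_one_iff _).1 ((hb a).trans hle)
  have hcl : Subring.closure (Set.range (algebraMap R L)) = (algebraMap R L).range := by
    rw [← RingHom.coe_range, Subring.closure_eq]
  rw [hcl] at key
  obtain ⟨p, hp, hp'⟩ : IsIntegral (algebraMap R L).range (y a) := key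
  have hlift : p ∈ Polynomial.lifts (algebraMap R L).rangeRestrict :=  by
    rw [Polynomial.mem_lifts]
    exact Polynomial.map_surjective _ (algebraMap R L).rangeRestrict_surjective p
  obtain ⟨P, hP, -, hPm⟩ := Polynomial.lifts_and_degree_eq_and_monic hlift hp
  refine ⟨P, hPm, ?_⟩
  rw [← hp', ← hP, eval₂_map]
  rfl

/-- A field generated by an invertible solution of a Frobenius-linear system is Galois. -/
theorem isGalois_of_map_pow_card_eq {K₀ K : Type*} [Field K₀] [Field K] [Algebra K₀ K]
    [Algebra F K₀] {W : Matrix ι ι K₀} {Y : Matrix ι ι K} (hY0 : Y.det ≠ 0)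
    (hY : Y.map (· ^ Fintype.card F) = W.map (algebraMap K₀ K) * Y)
    (hgen : IntermediateField.adjoin K₀ (Set.range fun p : ι × ι => Y p.1 p.2) = ⊤) :
    FiniteDimensional K₀ K ∧ IsGalois K₀ K := by
  let _ : Algebra F K := ((algebraMap K₀ K).comp (algebraMap F K₀)).toAlgebra
  have : IsScalarTower F K₀ K := IsScalarTower.of_algebraMap_eq' rfl
  have hW : W.det ≠ 0 := fun h0 => hY0 (by
    have := congrArg Matrix.det hY
    rw [Matrix.det_map_pow_card, Matrix.det_mul, ← RingHom.mapMatrix_apply, ← RingHom.map_det, h0,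
      map_zero, zero_mul] at this
    exact eq_zero_of_pow_eq_zero this)
  have hYint : ∀ p : ι × ι, IsIntegral K₀ (Y p.1 p.2) := by
    refine isIntegral_of_pow_mem_span (fun p : ι × ι => Y p.1 p.2) (Fintype.one_lt_card (α := F)) ?_
    rintro ⟨i, j⟩
    have := congrFun (congrFun hY i) j
    rw [Matrix.map_apply, Matrix.mul_apply] at this
    rw [this]
    refine Submodule.sum_mem _ fun l _ => ?_
    rw [Matrix.map_apply, ← Algebra.smul_def]
    exact Submodule.smul_mem _ _ (Submodule.subset_span ⟨(l, j), rfl⟩)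
  have hfin : FiniteDimensional K₀ K := by
    have : FiniteDimensional K₀ (IntermediateField.adjoin K₀
        (Set.range fun p : ι × ι => Y p.1 p.2)) :=
      IntermediateField.finiteDimensional_adjoin fun x hx => by
        obtain ⟨p, rfl⟩ := hx; exact hYint p
    rw [hgen] at this
    exact IntermediateField.topEquiv.toLinearEquiv.finiteDimensional
  have hsep : Algebra.IsSeparable K₀ K := by
    obtain ⟨p, hp⟩ := CharP.exists F
    obtain ⟨l, hpp, hl⟩ := FiniteField.card F p
    have : Fact p.Prime := ⟨hpp⟩
    have : CharP K₀ p := charP_of_injective_algebraMap (algebraMap F _).injective p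
    rw [← separableClosure.eq_top_iff, eq_top_iff, ← hgen, IntermediateField.adjoin_le_iff]
    set Ks := separableClosure K₀ K
    have : ExpChar Ks p := expChar_of_injective_algebraMap (algebraMap K₀ Ks).injective p
    have hexp : ∀ x : ι × ι, ∃ n, Y x.1 x.2 ^ p ^ n ∈ Ks := fun x => by
      obtain ⟨n, z, hz⟩ := IsPurelyInseparable.pow_mem Ks p (Y x.1 x.2)
      exact ⟨n, hz ▸ z.2⟩
    choose N hN using hexp
    have hlast : ∀ i j, (Y.map (· ^ Fintype.card F ^ (Finset.univ.sup N))) i j ∈ Ks := fun i j => by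
      have hle : N (i, j) ≤ l * Finset.univ.sup N :=
        (Finset.le_sup (Finset.mem_univ _)).trans (Nat.le_mul_of_pos_left _ l.pos)
      obtain ⟨d, hd⟩ := Nat.exists_eq_add_of_le hle
      rw [Matrix.map_apply, hl, ← pow_mul, hd, pow_add, pow_mul]
      exact pow_mem (hN (i, j)) _
    have hdesc : ∀ m, (∀ i j, (Y.map (· ^ Fintype.card F ^ m)) i j ∈ Ks) → ∀ i j, Y i j ∈ Ks := by
      intro m
      induction m with
      | zero => intro h i j; simpa using h i j
      | succ m ih =>
        intro h
        refine ih fun i j => ?_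
        set Wm : Matrix ι ι K₀ := W.map (· ^ Fintype.card F ^ m)
        have hWm : IsUnit Wm.det := by
          have : ∀ m, (W.map (· ^ Fintype.card F ^ m)).det = W.det ^ Fintype.card F ^ m := by
            intro m
            induction m with
            | zero => simp
            | succ m ih =>
              rw [pow_succ, pow_mul, ← ih, ← Matrix.det_map_pow_card]
              congr 1; ext i j; simp [pow_mul]
          rw [this]
          exact isUnit_iff_ne_zero.2 (pow_ne_zero _ hW)
        have h1 : Y.map (· ^ Fintype.card F ^ (m + 1)) =
            Wm.map (algebraMap K₀ K) * Y.map (· ^ Fintype.card F ^ m) := by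
          have : Y.map (· ^ Fintype.card F ^ (m + 1)) =
              (Y.map (· ^ Fintype.card F)).map (· ^ Fintype.card F ^ m) := by
            ext i j; simp [pow_succ', pow_mul]
          rw [this, hY, Matrix.map_pow_card_pow_mul F]
          congr 1
          ext i j; simp [Wm]
        have h2 : Y.map (· ^ Fintype.card F ^ m) =
            (Wm⁻¹).map (algebraMap K₀ K) * Y.map (· ^ Fintype.card F ^ (m + 1)) := by
          rw [h1, ← mul_assoc, ← Matrix.map_mul, Matrix.nonsing_inv_mul _ hWm]
          simp
        rw [h2, Matrix.mul_apply]
        exact sum_mem fun l _ => mul_mem (Ks.algebraMap_mem _) (h l j)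
    rintro _ ⟨⟨i, j⟩, rfl⟩
    exact hdesc _ hlast i j
  have hnormal : Normal K₀ K := by
    let Ω := AlgebraicClosure K
    have : Algebra.IsAlgebraic K₀ Ω := Algebra.IsAlgebraic.trans K₀ K Ω
    have : IsAlgClosure K₀ Ω := ⟨inferInstance, inferInstance⟩
    have : Normal K₀ Ω := IsAlgClosure.normal K₀ Ω
    let f : K →ₐ[K₀] Ω := IsScalarTower.toAlgHom K₀ K Ω
    have hY' : ∀ g : K →ₐ[K₀] Ω, (Y.map g).map (· ^ Fintype.card F) =
        W.map (algebraMap K₀ Ω) * Y.map g := fun g => by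
      have : (Y.map g).map (· ^ Fintype.card F) = (Y.map (· ^ Fintype.card F)).map g := by
        ext i j; simp
      rw [this, hY, Matrix.map_mul]
      congr 1; ext i j; simp
    have hnorm : Normal K₀ f.fieldRange := by
      rw [IntermediateField.normal_iff_forall_fieldRange_le]
      intro σ
      have hfr : f.fieldRange = IntermediateField.adjoin K₀
          (Set.range fun p : ι × ι => f (Y p.1 p.2)) := by
        rw [AlgHom.fieldRange_eq_map, ← hgen, IntermediateField.adjoin_map, ← Set.range_comp]
        rfl
      let g : K →ₐ[K₀] Ω := σ.comp f.rangeRestrict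
      have hgr : σ.fieldRange = IntermediateField.adjoin K₀
          (Set.range fun p : ι × ι => g (Y p.1 p.2)) := by
        have : σ.fieldRange = g.fieldRange := by
          ext z
          constructor
          · rintro ⟨⟨_, ⟨y, rfl⟩⟩, rfl⟩; exact ⟨y, rfl⟩
          · rintro ⟨y, rfl⟩; exact ⟨_, rfl⟩
        rw [this, AlgHom.fieldRange_eq_map, ← hgen, IntermediateField.adjoin_map, ← Set.range_comp]
        rfl
      rw [hgr, IntermediateField.adjoin_le_iff]
      rintro _ ⟨⟨i, j⟩, rfl⟩
      obtain ⟨h, hh⟩ := exists_eq_mul_map_algebraMap (F := F) (D := Ω) (Y := Y.map f)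
        (Z := Y.map g) (W := W.map (algebraMap K₀ Ω))
        (by
          rw [← RingHom.mapMatrix_apply, ← RingHom.map_det]
          simpa using hW)
        (by
          change ((f : K →+* Ω).mapMatrix Y).det ≠ 0
          rw [← RingHom.map_det]
          simpa using hY0)
        (hY' f) (hY' g)
      have hij := congrFun (congrFun hh i) j
      rw [Matrix.map_apply, Matrix.mul_apply] at hij
      change g (Y i j) ∈ f.fieldRange
      rw [hij]
      refine sum_mem fun l _ => mul_mem ⟨_, rfl⟩ ?_
      rw [Matrix.map_apply, IsScalarTower.algebraMap_apply F K₀ Ω]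
      exact f.fieldRange.algebraMap_mem _
    exact Normal.of_algEquiv (AlgEquiv.ofBijective f.rangeRestrict
      ⟨f.rangeRestrict.injective, f.rangeRestrict_surjective⟩ : K ≃ₐ[K₀] f.fieldRange).symm
  exact ⟨hfin, isGalois_iff.2 ⟨hsep, hnormal⟩⟩

end LangTorsor

section LangSeries

variable (F : Type*) {k ι : Type*} [Field F] [Fintype F] [Fintype ι] [DecidableEq ι]
  [Field k] [Algebra F k]

theorem PowerSeries.coeff_pow_card (f : PowerSeries k) (n : ℕ) :
    PowerSeries.coeff n (f ^ Fintype.card F) =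
      if Fintype.card F ∣ n then PowerSeries.coeff (n / Fintype.card F) f ^ Fintype.card F
      else 0 := by
  obtain ⟨p, hp⟩ := CharP.exists F
  obtain ⟨l, hpp, hl⟩ := FiniteField.card F p
  have : Fact p.Prime := ⟨hpp⟩
  have : CharP k p := charP_of_injective_algebraMap (algebraMap F k).injective p
  have h : f ^ Fintype.card F =
      PowerSeries.map (iterateFrobenius k p l)
        (PowerSeries.expand (p ^ (l : ℕ)) (pow_ne_zero _ hpp.ne_zero) f) := by
    rw [hl]
    exact (MvPowerSeries.map_iterateFrobenius_expand p hpp.ne_zero f l).symm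
  rw [h, PowerSeries.coeff_map, PowerSeries.coeff_expand, hl]
  split_ifs
  · rfl
  · simp

variable (N : Matrix ι ι k)

/-- The coefficients of the power series solution of `Y^(q) = (1 - X N) Y`, `Y(0) = 1`. -/
noncomputable def langCoeff : ℕ → Matrix ι ι k
  | 0 => 1
  | n + 1 =>
    have := Nat.div_lt_self n.succ_pos (Fintype.one_lt_card (α := F))
    N * langCoeff n +
      if Fintype.card F ∣ n + 1 then
        (langCoeff ((n + 1) / Fintype.card F)).map (· ^ Fintype.card F)
      else 0
decreasing_by
  · exact n.lt_succ_self
  · assumption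

/-- The power series solution of `Y^(q) = (1 - X N) Y`, `Y(0) = 1`. -/
noncomputable def langSeries : Matrix ι ι (PowerSeries k) :=
  Matrix.of fun i j => PowerSeries.mk fun n => langCoeff F N n i j

omit [Algebra F k] in
theorem coeff_langSeries (n : ℕ) (i j : ι) :
    PowerSeries.coeff n (langSeries F N i j) = langCoeff F N n i j := by
  simp [langSeries]

theorem langSeries_map_pow_card :
    (langSeries F N).map (· ^ Fintype.card F) =
      (1 - (X : k[X]) • N.map C).map (algebraMap k[X] (PowerSeries k)) * langSeries F N := by
  have hW : (1 - (X : k[X]) • N.map C).map (algebraMap k[X] (PowerSeries k)) =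
      1 - (PowerSeries.X : PowerSeries k) • N.map PowerSeries.C := by
    ext1 i j
    simp [PowerSeries.algebraMap_apply', Matrix.one_apply, apply_ite, mul_comm (PowerSeries.X)]
  rw [hW]
  ext i j n
  rw [Matrix.map_apply, PowerSeries.coeff_pow_card, sub_mul, one_mul, Matrix.sub_apply, map_sub,
    Matrix.smul_mul, Matrix.smul_apply, smul_eq_mul, coeff_langSeries, coeff_langSeries]
  rcases n with _ | n
  · simp [langCoeff, Matrix.one_apply, ite_pow]
  · rw [PowerSeries.coeff_succ_X_mul, Matrix.mul_apply, map_sum]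
    simp_rw [Matrix.map_apply, PowerSeries.coeff_C_mul, coeff_langSeries]
    rw [← Matrix.mul_apply, langCoeff, Matrix.add_apply, add_sub_cancel_left]
    split_ifs <;> simp

theorem commute_langCoeff {A : Matrix ι ι F} (hA : Commute (A.map (algebraMap F k)) N) (n : ℕ) :
    Commute (A.map (algebraMap F k)) (langCoeff F N n) := by
  induction n using Nat.strong_induction_on with
  | _ n ih =>
    rcases n with _ | n
    · rw [langCoeff]; exact Commute.one_right _
    · rw [langCoeff]
      refine (hA.mul_right (ih n n.lt_succ_self)).add_right ?_
      split_ifs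
      · have h := ih _ (Nat.div_lt_self n.succ_pos (Fintype.one_lt_card (α := F)))
        rw [Commute, SemiconjBy] at h ⊢
        have h2 := congrArg (fun M : Matrix ι ι k => M.map (· ^ Fintype.card F)) h
        simpa only [Matrix.map_pow_card_mul F, Matrix.map_algebraMap_map_pow_card] using h2
      · exact Commute.zero_right _

theorem commute_langSeries {A : Matrix ι ι F} (hA : Commute (A.map (algebraMap F k)) N) :
    Commute (A.map (algebraMap F (PowerSeries k))) (langSeries F N) := by
  have h := commute_langCoeff F N hA
  simp only [Commute, SemiconjBy] at h ⊢
  ext i j n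
  have := congrFun (congrFun (h n) i) j
  simp only [Matrix.mul_apply, Matrix.map_apply] at this
  simpa [Matrix.mul_apply, PowerSeries.algebraMap_apply, coeff_langSeries] using this

omit [Algebra F k] in
theorem det_langSeries_ne_zero : (langSeries F N).det ≠ 0 := by
  intro h
  have := congrArg (PowerSeries.constantCoeff (R := k)) h
  rw [RingHom.map_det] at this
  have h1 : (PowerSeries.constantCoeff (R := k)).mapMatrix (langSeries F N) = 1 := by
    ext i j
    rw [RingHom.mapMatrix_apply, Matrix.map_apply, ← PowerSeries.coeff_zero_eq_constantCoeff_apply,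
      coeff_langSeries, langCoeff]
  simp [h1] at this

end LangSeries

section LangCover

universe u v w

/-- A finite Galois covering of the affine line trivialising the system `Y^(q) = (1 - X N) Y`. -/
structure LangCover (F : Type v) {k : Type u} {ι : Type w} [Field F] [Fintype F] [Fintype ι]
    [DecidableEq ι] [Field k] [Algebra F k] (N : Matrix ι ι k) where
  /-- The coordinate ring. -/
  S : Type u
  [commRing : CommRing S]
  [isDomain : IsDomain S]
  [algebra : Algebra k[X] S]
  /-- The degree of the covering. -/
  rank : ℕ
  basis : Module.Basis (Fin rank) k[X] S
  /-- Expansion at the base point. -/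
  toSeries : S →ₐ[k[X]] PowerSeries k
  injective : Function.Injective toSeries
  finite_aut : Finite (S ≃ₐ[k[X]] S)
  invariant : Algebra.IsInvariant k[X] S (S ≃ₐ[k[X]] S)
  /-- The solution. -/
  Y : Matrix ι ι S
  map_Y : Y.map toSeries = langSeries F N
  eq_refl_of_map_eq : ∀ σ : S ≃ₐ[k[X]] S, Y.map σ = Y → σ = AlgEquiv.refl

attribute [instance] LangCover.commRing LangCover.isDomain LangCover.algebra

variable (F : Type v) {k : Type u} {ι : Type w} [Field F] [Fintype F] [Fintype ι]
    [DecidableEq ι] [Field k] [Algebra F k] (N : Matrix ι ι k)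

variable {F N} in
/-- Auxiliary form of `nonempty_langCover` with abstract function fields. -/
theorem nonempty_langCover_of_adjoin_eq_top {K₀ L : Type*} {K : Type u} [Field K₀] [Field K]
    [Field L] [Algebra k[X] K₀] [IsFractionRing k[X] K₀] [Algebra (PowerSeries k) L]
    [IsFractionRing (PowerSeries k) L] [Algebra k[X] L] [IsScalarTower k[X] (PowerSeries k) L]
    [Algebra K₀ K] [Algebra K L] [Algebra k[X] K] [IsScalarTower k[X] K₀ K]
    [IsScalarTower k[X] K L] (YK : Matrix ι ι K)
    (hYK : YK.map (algebraMap K L) = (langSeries F N).map (algebraMap (PowerSeries k) L))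
    (hgen : IntermediateField.adjoin K₀ (Set.range fun p : ι × ι => YK p.1 p.2) = ⊤) :
    Nonempty (LangCover F N) := by
  let Wp : Matrix ι ι k[X] := 1 - (X : k[X]) • N.map C
  let YL : Matrix ι ι L := (langSeries F N).map (algebraMap _ L)
  have hYL : YL.map (· ^ Fintype.card F) = Wp.map (algebraMap k[X] L) * YL := by
    have := congrArg (fun M : Matrix ι ι (PowerSeries k) => M.map (algebraMap _ L))
      (langSeries_map_pow_card F N)
    simp only [Matrix.map_mul] at this
    convert this using 1
    · ext i j; simp [YL]
    · congr 1
      ext i j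
      simp only [Matrix.map_apply, ← IsScalarTower.algebraMap_apply, Wp]
  have hYKeq : YK.map (· ^ Fintype.card F) =
      (Wp.map (algebraMap k[X] K₀)).map (algebraMap K₀ K) * YK := by
    have hi : Function.Injective fun M : Matrix ι ι K => M.map (algebraMap K L) :=
      Matrix.map_injective (algebraMap K L).injective
    apply hi
    simp only [Matrix.map_mul]
    rw [hYK]
    refine Eq.trans ?_ (hYL.trans ?_)
    · change _ = ((langSeries F N).map (algebraMap (PowerSeries k) L)).map _
      rw [← hYK]
      ext i j
      simp
    · congr 1
      ext i j
      simp only [Matrix.map_apply, ← IsScalarTower.algebraMap_apply]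
  have hYK0 : YK.det ≠ 0 := fun h => by
    have h1 := congrArg (algebraMap K L) h
    rw [RingHom.map_det, RingHom.mapMatrix_apply, hYK, map_zero] at h1
    have h2 := RingHom.map_det (algebraMap (PowerSeries k) L) (langSeries F N)
    rw [RingHom.mapMatrix_apply] at h2
    rw [h1] at h2
    exact det_langSeries_ne_zero F N ((map_eq_zero_iff _ (IsFractionRing.injective _ L)).1 h2)
  let _ : Algebra F K₀ := ((algebraMap k[X] K₀).comp (C.comp (algebraMap F k))).toAlgebra
  obtain ⟨hfd, hgal⟩ := isGalois_of_map_pow_card_eq (F := F) hYK0 hYKeq hgen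
  let S := integralClosure k[X] K
  have : IsFractionRing S K :=
    IsIntegralClosure.isFractionRing_of_finite_extension k[X] K₀ K S
  have : Module.Finite k[X] S := IsIntegralClosure.finite k[X] K₀ K S
  have : Module.IsTorsionFree k[X] K := Module.IsTorsionFree.trans_faithfulSMul k[X] K₀ K
  have : Module.Free k[X] S := IsIntegralClosure.module_free k[X] K₀ K S
  have hYint : ∀ p : ι × ι, IsIntegral k[X] (YK p.1 p.2) := by
    refine isIntegral_of_pow_mem_span (fun p : ι × ι => YK p.1 p.2)
      (Fintype.one_lt_card (α := F)) ?_
    rintro ⟨i, j⟩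
    have := congrFun (congrFun hYKeq i) j
    rw [Matrix.map_apply, Matrix.mul_apply] at this
    rw [this]
    refine Submodule.sum_mem _ fun l _ => ?_
    rw [Matrix.map_apply, Matrix.map_apply, ← IsScalarTower.algebraMap_apply, ← Algebra.smul_def]
    exact Submodule.smul_mem _ _ (Submodule.subset_span ⟨(l, j), rfl⟩)
  let Y : Matrix ι ι S := Matrix.of fun i j => ⟨YK i j, hYint (i, j)⟩
  let ps : PowerSeries k →ₐ[k[X]] L := IsScalarTower.toAlgHom k[X] (PowerSeries k) L
  let g : S →ₐ[k[X]] L := (IsScalarTower.toAlgHom k[X] K L).comp S.val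
  have hg : ∀ s, g s ∈ ps.range := fun s => by
    have h1 : IsIntegral k[X] (g s) := IsIntegral.map g (Algebra.IsIntegral.isIntegral s)
    have h2 : IsIntegral (PowerSeries k) (g s) := h1.tower_top
    obtain ⟨y, hy⟩ := IsIntegrallyClosed.isIntegral_iff.1 h2
    exact ⟨y, hy⟩
  have hps : Function.Injective ps := IsFractionRing.injective (PowerSeries k) L
  let θ : S →ₐ[k[X]] PowerSeries k :=
    (AlgEquiv.ofInjective ps hps).symm.toAlgHom.comp (g.codRestrict ps.range hg)
  have hθ : ∀ s, ps (θ s) = g s := fun s =>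
    congrArg Subtype.val ((AlgEquiv.ofInjective ps hps).apply_symm_apply ⟨g s, hg s⟩)
  have hginj : Function.Injective g := fun a b hab =>
    Subtype.ext ((algebraMap K L).injective hab)
  refine ⟨{
    S := S
    rank := _
    basis := Module.finBasis k[X] S
    toSeries := θ
    injective := fun a b hab => hginj (by rw [← hθ, hab, hθ])
    finite_aut := Finite.of_equiv _ (galRestrict k[X] K₀ K S).toEquiv
    invariant := Algebra.isInvariant_of_isGalois' k[X] K₀ K S
    Y := Y
    map_Y := by
      ext1 i j
      exact hps ((hθ (Y i j)).trans (congrFun (congrFun hYK i) j))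
    eq_refl_of_map_eq := fun σ hσ => by
      obtain ⟨τ, rfl⟩ := (galRestrict k[X] K₀ K S).surjective σ
      have hτ : τ = 1 := by
        have : (τ : K →ₐ[K₀] K) = AlgHom.id K₀ K := by
          refine AlgHom.ext fun x => ?_
          have hx : x ∈ IntermediateField.adjoin K₀ (Set.range fun p : ι × ι => YK p.1 p.2) :=
            hgen ▸ IntermediateField.mem_top
          have hle : IntermediateField.adjoin K₀ (Set.range fun p : ι × ι => YK p.1 p.2) ≤
              IntermediateField.fixedField (Subgroup.zpowers τ) := by
            rw [IntermediateField.adjoin_le_iff]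
            rintro _ ⟨⟨i, j⟩, rfl⟩
            have h1 : τ • YK i j = YK i j := by
              have := congrArg (algebraMap S K) (congrFun (congrFun hσ i) j)
              rw [Matrix.map_apply, algebraMap_galRestrict_apply] at this
              exact this
            rintro ⟨ρ, hρ⟩
            have : Subgroup.zpowers τ ≤ MulAction.stabilizer _ (YK i j) := by
              rw [Subgroup.zpowers_le]; exact h1
            exact this hρ
          exact hle hx ⟨τ, Subgroup.mem_zpowers τ⟩
        exact AlgEquiv.ext fun x => AlgHom.congr_fun this x
      rw [hτ, map_one]; rfl }⟩

theorem nonempty_langCover : Nonempty (LangCover F N) := by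
  let L := FractionRing (PowerSeries k)
  let K₀ := FractionRing k[X]
  have hinj : Function.Injective (algebraMap k[X] L) := by
    rw [IsScalarTower.algebraMap_eq k[X] (PowerSeries k) L]
    refine (IsFractionRing.injective (PowerSeries k) L).comp ?_
    intro a b hab
    simpa [PowerSeries.algebraMap_apply'] using hab
  have : FaithfulSMul k[X] L := (faithfulSMul_iff_algebraMap_injective _ _).2 hinj
  let _ : Algebra K₀ L := FractionRing.liftAlgebra k[X] L
  have : IsScalarTower k[X] K₀ L := FractionRing.isScalarTower_liftAlgebra k[X] L
  let YL : Matrix ι ι L := (langSeries F N).map (algebraMap _ L)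
  let gens : Set L := Set.range fun p : ι × ι => YL p.1 p.2
  let K := IntermediateField.adjoin K₀ gens
  let YK : Matrix ι ι K := Matrix.of fun i j =>
    ⟨YL i j, IntermediateField.subset_adjoin _ _ ⟨(i, j), rfl⟩⟩
  have : IsScalarTower k[X] K L := IsScalarTower.of_algebraMap_eq fun x => by
    rw [IsScalarTower.algebraMap_apply k[X] K₀ L, IsScalarTower.algebraMap_apply k[X] K₀ K]
    rfl
  refine nonempty_langCover_of_adjoin_eq_top (K₀ := K₀) (L := L) YK rfl ?_
  apply IntermediateField.lift_injective K
  rw [IntermediateField.lift_adjoin, IntermediateField.lift_top, ← Set.range_comp]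
  rfl

end LangCover

section Galois

/-- Two ring homomorphisms to a domain agreeing on the invariants of a finite group differ, on
any finite family, by an element of the group. -/
theorem Algebra.IsInvariant.exists_forall_eq_smul {A B G Ω : Type*} [CommRing A] [CommRing B]
    [Algebra A B] [Group G] [Finite G] [MulSemiringAction G B] [Algebra.IsInvariant A B G]
    [CommRing Ω] [IsDomain Ω] (φ ψ : B →+* Ω)
    (h : ∀ a, φ (algebraMap A B a) = ψ (algebraMap A B a)) {r : ℕ} (y : Fin r → B) :
    ∃ g : G, ∀ i, ψ (y i) = φ (g • y i) := by
  cases nonempty_fintype G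
  let s : B[X] := ∑ i : Fin r, monomial (i : ℕ) (y i)
  have hs : ∀ i, s.coeff (i : Fin r) = y i := fun i => by
    simp [s, Polynomial.coeff_monomial, Fin.val_inj]
  let P : B[X][X] := MulSemiringAction.charpoly G s
  have hP : P.map (mapRingHom φ) = P.map (mapRingHom ψ) := by
    ext n m
    rw [coeff_map, coeff_map, coe_mapRingHom, coe_mapRingHom, coeff_map, coeff_map]
    obtain ⟨a, ha⟩ := Algebra.IsInvariant.isInvariant (A := A) (G := G) ((P.coeff n).coeff m)
      (fun g => by rw [← Polynomial.coeff_smul, MulSemiringAction.smul_coeff_charpoly])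
    rw [← ha, h]
  have h0 : (P.map (mapRingHom φ)).eval (mapRingHom ψ s) = 0 := by
    rw [hP, eval_map, eval₂_hom, MulSemiringAction.eval_charpoly, map_zero]
  rw [show P = _ from MulSemiringAction.charpoly_eq (G := G) s, Polynomial.map_prod, eval_prod, Finset.prod_eq_zero_iff] at h0
  obtain ⟨g, -, hg⟩ := h0
  refine ⟨g, fun i => ?_⟩
  rw [Polynomial.map_sub, map_X, map_C, eval_sub, eval_X, eval_C, sub_eq_zero] at hg
  have := congrArg (fun p => p.coeff (i : ℕ)) hg
  simpa [hs] using this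

theorem nonempty_algHom_of_isAlgClosed (A S Ω : Type*) [CommRing A] [CommRing S] [Algebra A S]
    [Module.Finite A S] [Module.Free A S] [Nontrivial S] [Field Ω] [IsAlgClosed Ω] [Algebra A Ω] :
    Nonempty (S →ₐ[A] Ω) := by
  have : Nontrivial (TensorProduct A Ω S) := Module.FaithfullyFlat.rTensor_nontrivial A S Ω
  obtain ⟨m, hm⟩ := Ideal.exists_maximal (TensorProduct A Ω S)
  let _ : Field (TensorProduct A Ω S ⧸ m) := Ideal.Quotient.field m
  have : Algebra.IsIntegral Ω (TensorProduct A Ω S ⧸ m) := inferInstance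
  let e := AlgEquiv.ofBijective (Algebra.ofId Ω (TensorProduct A Ω S ⧸ m))
    IsAlgClosed.algebraMap_bijective_of_isIntegral
  exact ⟨((e.symm.toAlgHom.restrictScalars A).comp
    ((Ideal.Quotient.mkₐ Ω m).restrictScalars A)).comp Algebra.TensorProduct.includeRight⟩

end Galois

namespace LangCover

universe u v w

variable {F : Type v} {k : Type u} {ι : Type w} [Field F] [Fintype F] [Fintype ι]
    [DecidableEq ι] [Field k] [Algebra F k] {N : Matrix ι ι k} (c : LangCover F N)

/-- The group of the covering. -/
abbrev Gal : Type u := c.S ≃ₐ[k[X]] c.S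

instance : Finite c.Gal := c.finite_aut

instance : Algebra.IsInvariant k[X] c.S c.Gal := c.invariant

noncomputable instance : Algebra k c.S := ((algebraMap k[X] c.S).comp C).toAlgebra

instance : IsScalarTower k k[X] c.S := IsScalarTower.of_algebraMap_eq' rfl

instance : Module.Finite k[X] c.S := Module.Finite.of_basis c.basis

instance : Module.Free k[X] c.S := Module.Free.of_basis c.basis

theorem Y_map_pow_card : c.Y.map (· ^ Fintype.card F) =
    (1 - (X : k[X]) • N.map C).map (algebraMap k[X] c.S) * c.Y := by
  apply Matrix.map_injective c.injective
  have h := langSeries_map_pow_card F N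
  rw [← c.map_Y] at h
  refine (Eq.trans ?_ h).trans ?_
  · ext1 i j; simp
  · change _ = c.toSeries.toRingHom.mapMatrix _
    rw [map_mul]
    congr 1
    ext1 i j
    exact (c.toSeries.commutes ((1 - (X : k[X]) • N.map C : Matrix ι ι k[X]) i j)).symm

theorem commute_Y {A : Matrix ι ι F} (hA : Commute (A.map (algebraMap F k)) N) :
    Commute ((A.map (algebraMap F k)).map (algebraMap k c.S)) c.Y := by
  have h := commute_langSeries F N hA
  rw [← c.map_Y] at h
  have h1 : A.map (algebraMap F (PowerSeries k)) =
      ((A.map (algebraMap F k)).map (algebraMap k c.S)).map c.toSeries := by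
    ext1 i j
    simp only [Matrix.map_apply]
    rw [IsScalarTower.algebraMap_apply k k[X] c.S, c.toSeries.commutes]
    rw [IsScalarTower.algebraMap_apply F k (PowerSeries k), PowerSeries.algebraMap_apply' ]
    simp
  rw [h1] at h
  apply Matrix.map_injective c.injective
  have h2 : ∀ A B : Matrix ι ι c.S, (A * B).map c.toSeries = A.map c.toSeries * B.map c.toSeries :=
    fun A B => map_mul c.toSeries.toRingHom.mapMatrix A B
  simp only [h2]
  exact h

theorem exists_map_eq_mul (σ : c.Gal) : ∃ h : Matrix ι ι F,
    c.Y.map σ = c.Y * (h.map (algebraMap F k)).map (algebraMap k c.S) := by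
  let L := FractionRing (PowerSeries k)
  let f : c.S →+* L := (algebraMap (PowerSeries k) L).comp (c.toSeries : c.S →+* PowerSeries k)
  have hf : Function.Injective f := (IsFractionRing.injective (PowerSeries k) L).comp c.injective
  let _ : Algebra F L := (f.comp ((algebraMap k c.S).comp (algebraMap F k))).toAlgebra
  let W := (1 - (X : k[X]) • N.map C).map (algebraMap k[X] c.S)
  have hmul : ∀ A B : Matrix ι ι c.S, (A * B).map f = A.map f * B.map f :=
    fun A B => map_mul f.mapMatrix A B
  have hpow : ∀ A : Matrix ι ι c.S,
      (A.map f).map (· ^ Fintype.card F) = (A.map (· ^ Fintype.card F)).map f := fun A => by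
    ext1 i j; simp
  have hY := congrArg (fun A => A.map f) c.Y_map_pow_card
  simp only [hmul] at hY
  rw [← hpow] at hY
  have hY0 : (c.Y.map f).det ≠ 0 := by
    have h1 : c.Y.map f = (langSeries F N).map (algebraMap _ L) := by
      rw [← c.map_Y]; rfl
    have h2 := RingHom.map_det (algebraMap (PowerSeries k) L) (langSeries F N)
    rw [RingHom.mapMatrix_apply] at h2
    rw [h1, ← h2]
    exact (map_ne_zero_iff _ (IsFractionRing.injective _ L)).2 (det_langSeries_ne_zero F N)
  have hW : (W.map f).det ≠ 0 := fun h => by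
    have := congrArg Matrix.det hY
    rw [Matrix.det_map_pow_card, Matrix.det_mul, h, zero_mul] at this
    exact hY0 (eq_zero_of_pow_eq_zero this)
  obtain ⟨h, hh⟩ := exists_eq_mul_map_algebraMap (F := F) (D := L) (W := W.map f)
    (Y := c.Y.map f) (Z := (c.Y.map σ).map f) hW hY0 hY (by
      have := congrArg (fun A => A.map σ) c.Y_map_pow_card
      have h2 : (W * c.Y).map σ = W * c.Y.map σ := by
        change (σ : c.S →+* c.S).mapMatrix (W * c.Y) = _
        rw [map_mul]
        congr 1
        ext1 i j
        simp [W]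
      rw [hpow, ← hmul, ← h2]
      congr 1
      refine Eq.trans ?_ this
      ext1 i j; simp)
  refine ⟨h, Matrix.map_injective hf ?_⟩
  simp only [hmul]
  exact hh

end LangCover

theorem Matrix.mul_left_cancel_of_det_ne_zero {ι D : Type*} [Fintype ι] [DecidableEq ι]
    [CommRing D] [IsDomain D] {Y A B : Matrix ι ι D} (hY : Y.det ≠ 0) (h : Y * A = Y * B) :
    A = B := by
  have h1 := congrArg (fun M => Y.adjugate * M) h
  simp only [← Matrix.mul_assoc, Matrix.adjugate_mul, Matrix.smul_mul, Matrix.one_mul] at h1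
  ext i j
  exact mul_left_cancel₀ hY (congrFun (congrFun h1 i) j)

namespace LangCover

universe u v w

variable {F : Type v} {k : Type u} {ι : Type w} [Field F] [Fintype F] [Fintype ι]
    [DecidableEq ι] [Field k] [Algebra F k] {N : Matrix ι ι k} (c : LangCover F N)

theorem det_Y_ne_zero : c.Y.det ≠ 0 := fun h => by
  have h1 := c.toSeries.toRingHom.map_det c.Y
  rw [h, map_zero] at h1
  exact det_langSeries_ne_zero F N ((congrArg Matrix.det c.map_Y).symm.trans h1.symm)

/-- Scalar matrices in the coordinate ring. -/
noncomputable abbrev const (h : Matrix ι ι F) : Matrix ι ι c.S :=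
  (h.map (algebraMap F k)).map (algebraMap k c.S)

theorem const_mul (g h : Matrix ι ι F) : c.const (g * h) = c.const g * c.const h := by
  simp only [const, Matrix.map_mul]

theorem const_injective : Function.Injective c.const :=
  (Matrix.map_injective (algebraMap k c.S).injective).comp
    (Matrix.map_injective (algebraMap F k).injective)

theorem const_map (σ : c.Gal) (h : Matrix ι ι F) : (c.const h).map σ = c.const h := by
  ext1 i j
  exact σ.commutes (C (algebraMap F k (h i j)))

theorem map_mul (σ : c.Gal) (A B : Matrix ι ι c.S) : (A * B).map σ = A.map σ * B.map σ :=
  _root_.map_mul (σ : c.S →+* c.S).mapMatrix A B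

/-- The monodromy matrix of an automorphism. -/
noncomputable def eta (σ : c.Gal) : Matrix ι ι F := (c.exists_map_eq_mul σ).choose

theorem map_eq_mul_eta (σ : c.Gal) : c.Y.map σ = c.Y * c.const (c.eta σ) :=
  (c.exists_map_eq_mul σ).choose_spec

theorem eta_mul (σ τ : c.Gal) : c.eta (σ * τ) = c.eta σ * c.eta τ := by
  apply c.const_injective
  refine Matrix.mul_left_cancel_of_det_ne_zero c.det_Y_ne_zero ?_
  rw [← map_eq_mul_eta, const_mul, ← mul_assoc, ← map_eq_mul_eta]
  have : c.Y.map (σ * τ) = (c.Y.map τ).map σ := rfl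
  rw [this, map_eq_mul_eta c τ, map_mul, const_map]

theorem eta_one : c.eta 1 = 1 := by
  apply c.const_injective
  refine Matrix.mul_left_cancel_of_det_ne_zero c.det_Y_ne_zero ?_
  rw [← map_eq_mul_eta]
  have h1 : c.const 1 = 1 := by
    simp only [const, Matrix.map_one _ (map_zero _) (map_one _)]
  rw [h1, mul_one]
  rfl

theorem eta_injective : Function.Injective c.eta := fun σ τ h => by
  have h1 : c.eta (τ⁻¹ * σ) = 1 := by rw [eta_mul, h, ← eta_mul, inv_mul_cancel, eta_one]
  have h2 : c.Y.map (τ⁻¹ * σ : c.Gal) = c.Y := by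
    rw [map_eq_mul_eta, h1, ← eta_one c, ← map_eq_mul_eta]
    rfl
  exact (inv_mul_eq_one.1 (c.eq_refl_of_map_eq _ h2)).symm

theorem commute_eta {A : Matrix ι ι F} (hA : Commute (A.map (algebraMap F k)) N) (σ : c.Gal) :
    Commute A (c.eta σ) := by
  have h := c.commute_Y hA
  rw [Commute, SemiconjBy] at h ⊢
  have h1 := congrArg (fun M : Matrix ι ι c.S => M.map σ) h
  simp only [map_mul] at h1
  have h2 := c.const_map σ A
  simp only [const] at h2
  rw [h2, map_eq_mul_eta, ← mul_assoc, h] at h1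
  apply c.const_injective
  refine Matrix.mul_left_cancel_of_det_ne_zero c.det_Y_ne_zero ?_
  rw [const_mul, const_mul, ← mul_assoc, ← mul_assoc]
  exact h1

variable {Ω : Type*} [Field Ω] [Algebra k Ω]

/-- The parameter of a point of the covering. -/
noncomputable def param (φ : c.S →ₐ[k] Ω) : Ω := φ (algebraMap k[X] c.S X)

theorem map_algebraMap (φ : c.S →ₐ[k] Ω) (p : k[X]) :
    φ (algebraMap k[X] c.S p) = aeval (c.param φ) p := by
  have : φ.comp (IsScalarTower.toAlgHom k k[X] c.S) = aeval (c.param φ) := by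
    ext; simp [param]
  exact AlgHom.congr_fun this p

theorem map_map_mul (φ : c.S →ₐ[k] Ω) (A B : Matrix ι ι c.S) :
    (A * B).map φ = A.map φ * B.map φ :=
  _root_.map_mul φ.toRingHom.mapMatrix A B

theorem map_system (φ : c.S →ₐ[k] Ω) :
    ((1 - (X : k[X]) • N.map C).map (algebraMap k[X] c.S)).map φ =
      1 - c.param φ • N.map (algebraMap k Ω) := by
  ext1 i j
  simp only [Matrix.map_apply, map_algebraMap]
  simp [Matrix.one_apply, apply_ite, mul_comm (c.param φ)]

theorem map_Y_pow_card (φ : c.S →ₐ[k] Ω) : (c.Y.map φ).map (· ^ Fintype.card F) =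
    (1 - c.param φ • N.map (algebraMap k Ω)) * c.Y.map φ := by
  rw [← map_system, ← map_map_mul, ← Y_map_pow_card]
  ext1 i j
  simp

theorem det_map_Y_ne_zero (φ : c.S →ₐ[k] Ω)
    (h : (1 - c.param φ • N.map (algebraMap k Ω)).det ≠ 0) : (c.Y.map φ).det ≠ 0 := by
  let _ : Algebra F c.S := ((algebraMap k c.S).comp (algebraMap F k)).toAlgebra
  have h1 := congrArg Matrix.det c.Y_map_pow_card
  rw [Matrix.det_map_pow_card, Matrix.det_mul] at h1
  obtain ⟨n, hn⟩ : ∃ n, Fintype.card F = n + 1 := ⟨_, (Nat.succ_pred Fintype.card_ne_zero).symm⟩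
  rw [hn, pow_succ] at h1
  have h2 := congrArg φ (mul_right_cancel₀ c.det_Y_ne_zero h1)
  have hd : ∀ A : Matrix ι ι c.S, φ A.det = (A.map φ).det := φ.toRingHom.map_det
  rw [hd, map_system, map_pow, hd] at h2
  intro h0
  rw [h0] at h2
  have hn0 : n ≠ 0 := by
    have := Fintype.one_lt_card (α := F)
    omega
  rw [zero_pow hn0] at h2
  exact h h2.symm

theorem comp_injective (φ : c.S →ₐ[k] Ω)
    (h : (1 - c.param φ • N.map (algebraMap k Ω)).det ≠ 0) :
    Function.Injective fun τ : c.Gal => φ.comp (τ.toAlgHom.restrictScalars k) := fun σ τ hστ => by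
  apply c.eta_injective
  have h1 : ∀ τ : c.Gal, c.Y.map (φ.comp (τ.toAlgHom.restrictScalars k)) =
      c.Y.map φ * ((c.eta τ).map (algebraMap F k)).map (algebraMap k Ω) := fun τ => by
    have h2 := congrArg (fun A : Matrix ι ι c.S => A.map φ) (c.map_eq_mul_eta τ)
    simp only [map_map_mul] at h2
    refine Eq.trans (by rfl) (h2.trans ?_)
    congr 1
    ext1 i j
    simp
  have h3 : c.Y.map φ * ((c.eta σ).map (algebraMap F k)).map (algebraMap k Ω) =
      c.Y.map φ * ((c.eta τ).map (algebraMap F k)).map (algebraMap k Ω) := by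
    rw [← h1, ← h1, show φ.comp (σ.toAlgHom.restrictScalars k) = _ from hστ]
  exact Matrix.map_injective (algebraMap F k).injective (Matrix.map_injective
    (algebraMap k Ω).injective
      (Matrix.mul_left_cancel_of_det_ne_zero (c.det_map_Y_ne_zero φ h) h3))

theorem exists_param_eq [IsAlgClosed Ω] (t : Ω) : ∃ φ : c.S →ₐ[k] Ω, c.param φ = t := by
  let _ : Algebra k[X] Ω := (aeval (R := k) t).toRingHom.toAlgebra
  have : IsScalarTower k k[X] Ω := IsScalarTower.of_algebraMap_eq fun x => by
    change _ = aeval t (C x)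
    simp
  obtain ⟨φ⟩ := nonempty_algHom_of_isAlgClosed k[X] c.S Ω
  refine ⟨φ.restrictScalars k, ?_⟩
  change φ (algebraMap k[X] c.S X) = t
  rw [φ.commutes]
  change aeval t X = t
  simp

theorem exists_pow_eq [Fintype k] (φ : c.S →ₐ[k] Ω) {n : ℕ}
    (h : c.param φ ^ Fintype.card k ^ n = c.param φ) :
    ∃ σ : c.Gal, ∀ s, φ s ^ Fintype.card k ^ n = φ (σ s) := by
  let ψ : c.S →ₐ[k] Ω := ((FiniteField.frobeniusAlgHom k Ω) ^ n).comp φ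
  have hψ : ∀ s, ψ s = φ s ^ Fintype.card k ^ n := fun s => by
    change ((FiniteField.frobeniusAlgHom k Ω) ^ n) (φ s) = _
    rw [AlgHom.coe_pow, FiniteField.coe_frobeniusAlgHom, pow_iterate]
  have hp : c.param ψ = c.param φ := (hψ _).trans h
  have hx : ∀ p : k[X], φ (algebraMap k[X] c.S p) = ψ (algebraMap k[X] c.S p) := fun p => by
    rw [map_algebraMap, map_algebraMap, hp]
  obtain ⟨σ, hσ⟩ := Algebra.IsInvariant.exists_forall_eq_smul (A := k[X]) (G := c.Gal)
    (φ : c.S →+* Ω) (ψ : c.S →+* Ω) hx c.basis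
  refine ⟨σ, fun s => ?_⟩
  rw [← hψ, ← c.basis.sum_repr s]
  simp only [map_sum, Algebra.smul_def, _root_.map_mul, AlgEquiv.commutes]
  refine Finset.sum_congr rfl fun i _ => ?_
  rw [hx]
  congr 1
  exact hσ i

end LangCover

section Pencil

variable {F ι : Type*} [Field F] [Fintype F] [Fintype ι] [DecidableEq ι]
  {R : Type*} [CommRing R] [Algebra F R]

/-- The pencil `M₀ - x M₁`. -/
def pencil (M₀ M₁ : Matrix ι ι F) (x : R) : Matrix ι ι R :=
  M₀.map (algebraMap F R) - x • M₁.map (algebraMap F R)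

/-- The twisted norm `∏_{i < n} (M₀ - x ^ (q ^ i) M₁)`. -/
def pencilNorm (M₀ M₁ : Matrix ι ι F) (x : R) : ℕ → Matrix ι ι R
  | 0 => 1
  | n + 1 => pencil M₀ M₁ (x ^ Fintype.card F ^ n) * pencilNorm M₀ M₁ x n

variable {M₀ M₁ : Matrix ι ι F}

theorem pencil_map_pow_card (x : R) :
    (pencil M₀ M₁ x).map (· ^ Fintype.card F) = pencil M₀ M₁ (x ^ Fintype.card F) := by
  change (FiniteField.frobeniusAlgHom F R).mapMatrix _ = _
  rw [pencil, map_sub]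
  ext1 i j
  simp [pencil, ← map_pow, FiniteField.pow_card, mul_pow]

theorem pencil_map_pow_card_pow (x : R) (n : ℕ) :
    (pencil M₀ M₁ x).map (· ^ Fintype.card F ^ n) = pencil M₀ M₁ (x ^ Fintype.card F ^ n) := by
  induction n with
  | zero => simp
  | succ n ih =>
    rw [pow_succ, pow_mul, ← pencil_map_pow_card, ← ih]
    ext1 i j
    simp [pow_mul]

omit [Fintype F] [Fintype ι] [DecidableEq ι] in
theorem pencil_map {R' : Type*} [CommRing R'] [Algebra F R'] (f : R →ₐ[F] R') (x : R) :
    (pencil M₀ M₁ x).map f = pencil M₀ M₁ (f x) := by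
  ext1 i j
  simp [pencil]

theorem det_pencil_pow (x : R) (n : ℕ) :
    (pencil M₀ M₁ (x ^ Fintype.card F ^ n)).det = (pencil M₀ M₁ x).det ^ Fintype.card F ^ n := by
  induction n with
  | zero => simp
  | succ n ih =>
    rw [pow_succ, pow_mul, ← pencil_map_pow_card, Matrix.det_map_pow_card, ih, ← pow_mul]

theorem det_pencilNorm_ne_zero [IsDomain R] {x : R} (hx : (pencil M₀ M₁ x).det ≠ 0) (n : ℕ) :
    (pencilNorm M₀ M₁ x n).det ≠ 0 := by
  induction n with
  | zero => simp [pencilNorm]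
  | succ n ih =>
    rw [pencilNorm, Matrix.det_mul, det_pencil_pow]
    exact mul_ne_zero (pow_ne_zero _ hx) ih

omit [Fintype F] [DecidableEq ι] in
theorem commute_pencil {A : Matrix ι ι R} (h₀ : Commute A (M₀.map (algebraMap F R)))
    (h₁ : Commute A (M₁.map (algebraMap F R))) (x : R) : Commute A (pencil M₀ M₁ x) :=
  h₀.sub_right (h₁.smul_right x)

theorem commute_pencilNorm {A : Matrix ι ι R} (h₀ : Commute A (M₀.map (algebraMap F R)))
    (h₁ : Commute A (M₁.map (algebraMap F R))) (x : R) (n : ℕ) :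
    Commute A (pencilNorm M₀ M₁ x n) := by
  induction n with
  | zero => exact Commute.one_right A
  | succ n ih => exact (commute_pencil h₀ h₁ _).mul_right ih

omit [Fintype F] in
theorem commute_map_algebraMap {D : Type*} [CommRing D] [Algebra F D] {A B : Matrix ι ι F}
    (h : Commute A B) : Commute (A.map (algebraMap F D)) (B.map (algebraMap F D)) :=
  Commute.map h (algebraMap F D).mapMatrix

end Pencil

namespace LangCover

variable {F k ι Ω : Type*} [Field F] [Fintype F] [Fintype ι] [DecidableEq ι] [Field k]
  [Algebra F k] [Field Ω] [Algebra k Ω] [Algebra F Ω] [IsScalarTower F k Ω]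
  {M₀ M₁ : Matrix ι ι F} {x₀ : k}

omit [Fintype F] in
theorem commute_mul_inv_pencil (hx₀ : (pencil M₀ M₁ x₀).det ≠ 0) {A : Matrix ι ι F}
    (h₀ : Commute A M₀) (h₁ : Commute A M₁) :
    Commute (A.map (algebraMap F k)) (M₁.map (algebraMap F k) * (pencil M₀ M₁ x₀)⁻¹) := by
  have hP := commute_pencil (commute_map_algebraMap h₀) (commute_map_algebraMap h₁) x₀
  have hu : IsUnit (pencil M₀ M₁ x₀).det := hx₀.isUnit
  refine (commute_map_algebraMap h₁).mul_right ?_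
  obtain ⟨U, hU⟩ := (Matrix.isUnit_iff_isUnit_det _).2 hu
  rw [← hU] at hP ⊢
  rw [← Matrix.coe_units_inv]
  exact hP.units_inv_right

omit [Fintype F] in
theorem system_mul_pencil (hx₀ : (pencil M₀ M₁ x₀).det ≠ 0) (t : Ω) :
    (1 - t • (M₁.map (algebraMap F k) * (pencil M₀ M₁ x₀)⁻¹).map (algebraMap k Ω)) *
      pencil M₀ M₁ (algebraMap k Ω x₀) = pencil M₀ M₁ (algebraMap k Ω x₀ + t) := by
  have h1 : pencil M₀ M₁ (algebraMap k Ω x₀) = (pencil M₀ M₁ x₀).map (algebraMap k Ω) :=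
    (pencil_map (IsScalarTower.toAlgHom F k Ω) x₀).symm
  have h2 : (M₁.map (algebraMap F k) * (pencil M₀ M₁ x₀)⁻¹).map (algebraMap k Ω) *
      pencil M₀ M₁ (algebraMap k Ω x₀) = M₁.map (algebraMap F Ω) := by
    rw [h1, ← Matrix.map_mul, mul_assoc, Matrix.nonsing_inv_mul _ hx₀.isUnit, mul_one,
      Matrix.map_map, ← RingHom.coe_comp, ← IsScalarTower.algebraMap_eq]
  rw [sub_mul, one_mul, Matrix.smul_mul, h2, pencil, pencil, add_smul, sub_sub]

variable (c : LangCover F (M₁.map (algebraMap F k) * (pencil M₀ M₁ x₀)⁻¹))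

theorem commute_map_Y (hx₀ : (pencil M₀ M₁ x₀).det ≠ 0) {A : Matrix ι ι F}
    (h₀ : Commute A M₀) (h₁ : Commute A M₁) (φ : c.S →ₐ[k] Ω) :
    Commute (c.Y.map φ) (A.map (algebraMap F Ω)) := by
  have h := c.commute_Y (commute_mul_inv_pencil hx₀ h₀ h₁)
  have h2 := Commute.map h φ.toRingHom.mapMatrix
  refine Commute.symm ?_
  have h3 : φ.toRingHom.mapMatrix ((A.map (algebraMap F k)).map (algebraMap k c.S)) =
      A.map (algebraMap F Ω) := by
    ext1 i j
    simp [← IsScalarTower.algebraMap_apply]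
  rw [h3] at h2
  exact h2

theorem map_Y_pow_mul_pencilNorm (hM : Commute M₀ M₁) (hx₀ : (pencil M₀ M₁ x₀).det ≠ 0)
    (φ : c.S →ₐ[k] Ω) (n : ℕ) :
    (c.Y.map φ).map (· ^ Fintype.card F ^ n) * pencilNorm M₀ M₁ (algebraMap k Ω x₀) n =
      pencilNorm M₀ M₁ (algebraMap k Ω x₀ + c.param φ) n * c.Y.map φ := by
  have hc₀ := c.commute_map_Y hx₀ (Commute.refl M₀) hM φ
  have hc₁ := c.commute_map_Y hx₀ hM.symm (Commute.refl M₁) φ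
  induction n with
  | zero => simp [pencilNorm]
  | succ n ih =>
    have h1 : (c.Y.map φ).map (· ^ Fintype.card F ^ (n + 1)) =
        ((c.Y.map φ).map (· ^ Fintype.card F)).map (· ^ Fintype.card F ^ n) := by
      ext1 i j
      simp [pow_succ', pow_mul]
    have h2 := commute_pencil hc₀ hc₁ (algebraMap k Ω x₀)
    rw [Commute, SemiconjBy] at h2
    have h3 := congrArg (fun A : Matrix ι ι Ω => A.map (· ^ Fintype.card F ^ n)) h2
    simp only [Matrix.map_pow_card_pow_mul, pencil_map_pow_card_pow] at h3
    have h4 := congrArg (fun A : Matrix ι ι Ω => A.map (· ^ Fintype.card F ^ n))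
      (system_mul_pencil hx₀ (c.param φ))
    simp only [Matrix.map_pow_card_pow_mul, pencil_map_pow_card_pow] at h4
    rw [h1, map_Y_pow_card, Matrix.map_pow_card_pow_mul, pencilNorm, pencilNorm, ← mul_assoc,
      mul_assoc _ _ (pencil _ _ _), h3, ← mul_assoc, h4, mul_assoc, ih, mul_assoc]

theorem pencilNorm_eq (hM : Commute M₀ M₁) (hx₀ : (pencil M₀ M₁ x₀).det ≠ 0)
    (φ : c.S →ₐ[k] Ω) (hx : (pencil M₀ M₁ (algebraMap k Ω x₀ + c.param φ)).det ≠ 0) {n : ℕ}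
    {σ : c.Gal} (hσ : ∀ s, φ s ^ Fintype.card F ^ n = φ (σ s)) :
    pencilNorm M₀ M₁ (algebraMap k Ω x₀ + c.param φ) n =
      (c.eta σ).map (algebraMap F Ω) * pencilNorm M₀ M₁ (algebraMap k Ω x₀) n := by
  have hc₀ := c.commute_map_Y hx₀ (Commute.refl M₀) hM φ
  have hc₁ := c.commute_map_Y hx₀ hM.symm (Commute.refl M₁) φ
  have h1 := c.map_Y_pow_mul_pencilNorm hM hx₀ φ n
  have h2 : (c.Y.map φ).map (· ^ Fintype.card F ^ n) =
      c.Y.map φ * (c.eta σ).map (algebraMap F Ω) := by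
    have h3 := congrArg (fun A : Matrix ι ι c.S => A.map φ) (c.map_eq_mul_eta σ)
    simp only [map_map_mul] at h3
    refine Eq.trans ?_ (h3.trans ?_)
    · ext1 i j
      exact hσ _
    · congr 1
      ext1 i j
      simp [← IsScalarTower.algebraMap_apply]
  rw [h2, mul_assoc, ← (commute_pencilNorm hc₀ hc₁ _ n).eq] at h1
  refine (Matrix.mul_left_cancel_of_det_ne_zero (c.det_map_Y_ne_zero φ ?_) h1).symm
  intro h
  rw [← system_mul_pencil hx₀, Matrix.det_mul, h, zero_mul] at hx
  exact hx rfl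

end LangCover

namespace LangCover

variable {F k ι Ω : Type*} [Field F] [Fintype F] [Fintype ι] [DecidableEq ι] [Field k]
  [Algebra F k] [Field Ω] [Algebra k Ω] [Algebra F Ω] [IsScalarTower F k Ω]
  {M₀ M₁ : Matrix ι ι F} {x₀ : k}
  (c : LangCover F (M₁.map (algebraMap F k) * (pencil M₀ M₁ x₀)⁻¹))

omit [Fintype F] in
theorem det_system_ne_zero (hx₀ : (pencil M₀ M₁ x₀).det ≠ 0) {t : Ω}
    (hx : (pencil M₀ M₁ (algebraMap k Ω x₀ + t)).det ≠ 0) :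
    (1 - t • (M₁.map (algebraMap F k) * (pencil M₀ M₁ x₀)⁻¹).map (algebraMap k Ω)).det ≠ 0 := by
  intro h
  rw [← system_mul_pencil hx₀, Matrix.det_mul, h, zero_mul] at hx
  exact hx rfl

theorem exists_pencilNorm_eq [Fintype k] (hM : Commute M₀ M₁)
    (hx₀ : (pencil M₀ M₁ x₀).det ≠ 0) {M : ℕ} (hk : Fintype.card k = Fintype.card F ^ M)
    (φ : c.S →ₐ[k] Ω) (j : ℕ) {x : Ω} (hφ : algebraMap k Ω x₀ + c.param φ = x)
    (hx : (pencil M₀ M₁ x).det ≠ 0) (hxj : x ^ Fintype.card F ^ (2 * M * j) = x) :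
    ∃ σ : c.Gal, (∀ s, φ s ^ Fintype.card F ^ (2 * M * j) = φ (σ s)) ∧
      pencilNorm M₀ M₁ x (2 * M * j) = (c.eta σ).map (algebraMap F Ω) *
        pencilNorm M₀ M₁ (algebraMap k Ω x₀) (2 * M * j) := by
  have hq : Fintype.card F ^ (2 * M * j) = Fintype.card k ^ (2 * j) := by
    rw [hk, ← pow_mul]
    congr 1
    ring
  have hx₀k : (algebraMap k Ω x₀) ^ Fintype.card k ^ (2 * j) = algebraMap k Ω x₀ := by
    rw [← map_pow, FiniteField.pow_card_pow]
  obtain ⟨σ, hσ⟩ := c.exists_pow_eq φ (n := 2 * j) (by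
    have h1 : c.param φ = x - algebraMap k Ω x₀ := by rw [← hφ]; ring
    have h2 : (x - algebraMap k Ω x₀) ^ Fintype.card k ^ (2 * j) =
        x ^ Fintype.card k ^ (2 * j) - (algebraMap k Ω x₀) ^ Fintype.card k ^ (2 * j) := by
      have := map_sub ((FiniteField.frobeniusAlgHom k Ω) ^ (2 * j)) x (algebraMap k Ω x₀)
      simpa only [AlgHom.coe_pow, FiniteField.coe_frobeniusAlgHom, pow_iterate] using this
    rw [h1, h2, hx₀k, ← hq, hxj])
  rw [← hq] at hσ
  refine ⟨σ, hσ, ?_⟩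
  subst hφ
  exact c.pencilNorm_eq hM hx₀ φ hx hσ

theorem card_mul_card_le [Fintype k] [IsAlgClosed Ω] (hM : Commute M₀ M₁)
    (hx₀ : (pencil M₀ M₁ x₀).det ≠ 0) {M : ℕ} (hk : Fintype.card k = Fintype.card F ^ M)
    (hcomm : ∀ σ τ : c.Gal, Commute (c.eta σ) (c.eta τ)) :
    ∃ C j₀ : ℕ, ∀ j, j₀ ≤ j → ∀ (σ : c.Gal) (X : Finset Ω),
      (∀ x ∈ X, x ^ Fintype.card F ^ (2 * M * j) = x ∧ (pencil M₀ M₁ x).det ≠ 0 ∧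
        pencilNorm M₀ M₁ x (2 * M * j) = (c.eta σ).map (algebraMap F Ω) *
          pencilNorm M₀ M₁ (algebraMap k Ω x₀) (2 * M * j)) →
      Nat.card c.Gal * X.card ≤
        (Fintype.card F ^ (M * j)) ^ 2 + C * Fintype.card F ^ (M * j) := by
  classical
  cases nonempty_fintype c.Gal
  choose C j₀ hC using fun σ : c.Gal =>
    card_le_of_pow_eq c.basis c.toSeries c.injective (Ω := Ω) σ.toAlgHom
  refine ⟨∑ σ, C σ, ∑ σ, j₀ σ, fun j hj σ X hX => ?_⟩
  choose φ hφ using fun t : Ω => c.exists_param_eq t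
  have hφx : ∀ x, algebraMap k Ω x₀ + c.param (φ (x - algebraMap k Ω x₀)) = x := fun x => by
    rw [hφ]; ring
  let f : c.Gal × Ω → (c.S →ₐ[k] Ω) := fun p =>
    (φ (p.2 - algebraMap k Ω x₀)).comp (p.1.toAlgHom.restrictScalars k)
  have hpar : ∀ p, c.param (f p) = p.2 - algebraMap k Ω x₀ := fun p => by
    rw [← hφ (p.2 - algebraMap k Ω x₀)]
    exact congrArg (φ _) (p.1.commutes Polynomial.X)
  have hinj : Set.InjOn f ((Finset.univ ×ˢ X : Finset (c.Gal × Ω)) : Set (c.Gal × Ω)) := by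
    rintro ⟨σ₁, x⟩ h₁ ⟨σ₂, y⟩ - h
    have hxy : x = y := by
      have := congrArg c.param h
      rwa [hpar, hpar, sub_left_inj] at this
    subst hxy
    rw [Finset.mem_coe, Finset.mem_product] at h₁
    have := c.comp_injective (φ (x - algebraMap k Ω x₀))
      (det_system_ne_zero hx₀ (by rw [hφx]; exact (hX x h₁.2).2.1)) h
    exact Prod.ext this rfl
  have hq : Fintype.card F ^ (2 * M * j) = (Fintype.card k ^ j) ^ 2 := by
    rw [hk, ← pow_mul, ← pow_mul]
    congr 1
    ring
  have hle := hC σ j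
    ((Finset.single_le_sum (fun _ _ => Nat.zero_le _) (Finset.mem_univ σ)).trans hj)
    ((Finset.univ ×ˢ X).image f) (by
      rintro _ hψ s
      obtain ⟨⟨τ, x⟩, hp, rfl⟩ := Finset.mem_image.1 hψ
      have hx := hX x (Finset.mem_product.1 hp).2
      obtain ⟨σ', h1, h2⟩ := c.exists_pencilNorm_eq hM hx₀ hk
        (φ (x - algebraMap k Ω x₀)) j (hφx x) hx.2.1 hx.1
      have h3 : c.eta σ' = c.eta σ := by
        have hd : (pencilNorm M₀ M₁ (algebraMap k Ω x₀) (2 * M * j)).det ≠ 0 := by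
          refine det_pencilNorm_ne_zero ?_ _
          have h0 := (algebraMap k Ω).map_det (pencil M₀ M₁ x₀)
          have h0' := pencil_map (M₀ := M₀) (M₁ := M₁) (IsScalarTower.toAlgHom F k Ω) x₀
          exact fun h => hx₀ ((map_eq_zero _).1
            (h0.trans ((congrArg Matrix.det h0').trans h)))
        have h4 := h2.symm.trans hx.2.2
        have hu := (Matrix.isUnit_iff_isUnit_det _).2 hd.isUnit
        exact Matrix.map_injective (algebraMap F Ω).injective (hu.mul_right_cancel h4)
      have h5 := c.eta_injective h3
      subst h5
      rw [← hq]
      have h6 : σ' * τ = τ * σ' := c.eta_injective (by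
        rw [eta_mul, eta_mul]; exact hcomm _ _)
      refine (h1 (τ s)).trans ?_
      exact congrArg (φ _) (AlgEquiv.congr_fun h6 s))
  rw [Finset.card_image_of_injOn hinj, Finset.card_product, Finset.card_univ] at hle
  rw [Nat.card_eq_fintype_card]
  refine hle.trans ?_
  rw [hk, ← pow_mul (Fintype.card F) M j]
  refine Nat.add_le_add_left (Nat.mul_le_mul_right _ ?_) _
  exact Finset.single_le_sum (f := C) (fun _ _ => Nat.zero_le _) (Finset.mem_univ σ)

end LangCover

section CommAlgebra

variable {F B ι Ω : Type*} [Field F] [Fintype ι] [DecidableEq ι]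
  [CommRing B] [Algebra F B] (b : Module.Basis ι F B)

/-- The regular representation is its own centraliser. -/
theorem exists_leftMulMatrix_eq {h : Matrix ι ι F}
    (hh : ∀ a, Commute (Algebra.leftMulMatrix b a) h) : ∃ a, Algebra.leftMulMatrix b a = h := by
  refine ⟨b.equivFun.symm (h.mulVec (b.equivFun 1)), ?_⟩
  set a := b.equivFun.symm (h.mulVec (b.equivFun 1)) with ha
  have h1 : ∀ x y : B, (Algebra.leftMulMatrix b x).mulVec (b.equivFun y) = b.equivFun (x * y) :=
    fun x y => Algebra.leftMulMatrix_mulVec_repr b x y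
  apply Matrix.mulVec_injective
  funext v
  obtain ⟨y, rfl⟩ := b.equivFun.surjective v
  have h2 : b.equivFun a = h.mulVec (b.equivFun 1) := by
    rw [ha, LinearEquiv.apply_symm_apply]
  rw [h1, mul_comm, ← h1, h2, Matrix.mulVec_mulVec, (hh y).eq, ← Matrix.mulVec_mulVec, h1, mul_one]

variable [Fintype F] [Field Ω] [IsAlgClosed Ω] [Algebra F Ω] [Algebra.IsAlgebraic F Ω]

theorem exists_subgroup_pencilNorm (b₀ b₁ : B) {x₀ : Ω}
    (hx₀ : (pencil (Algebra.leftMulMatrix b b₀) (Algebra.leftMulMatrix b b₁) x₀).det ≠ 0) :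
    ∃ (H : Subgroup Bˣ) (M C j₀ : ℕ), 0 < M ∧
      (∀ j, x₀ ^ Fintype.card F ^ (2 * M * j) = x₀) ∧ ∀ j, j₀ ≤ j →
      (∀ x : Ω, x ^ Fintype.card F ^ (2 * M * j) = x →
        (pencil (Algebra.leftMulMatrix b b₀) (Algebra.leftMulMatrix b b₁) x).det ≠ 0 →
        ∃ h ∈ H, pencilNorm (Algebra.leftMulMatrix b b₀) (Algebra.leftMulMatrix b b₁) x (2 * M * j) =
          (Algebra.leftMulMatrix b (h : B)).map (algebraMap F Ω) *
            pencilNorm (Algebra.leftMulMatrix b b₀) (Algebra.leftMulMatrix b b₁) x₀ (2 * M * j)) ∧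
      (∀ h ∈ H, ∀ X : Finset Ω, (∀ x ∈ X, x ^ Fintype.card F ^ (2 * M * j) = x ∧
        (pencil (Algebra.leftMulMatrix b b₀) (Algebra.leftMulMatrix b b₁) x).det ≠ 0 ∧
        pencilNorm (Algebra.leftMulMatrix b b₀) (Algebra.leftMulMatrix b b₁) x (2 * M * j) =
          (Algebra.leftMulMatrix b (h : B)).map (algebraMap F Ω) *
            pencilNorm (Algebra.leftMulMatrix b b₀) (Algebra.leftMulMatrix b b₁) x₀ (2 * M * j)) →
        Nat.card H * X.card ≤
          (Fintype.card F ^ (M * j)) ^ 2 + C * Fintype.card F ^ (M * j)) := by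
  let L := Algebra.leftMulMatrix b
  have hL : ∀ x y : B, Commute (L x) (L y) := fun x y => (Commute.all x y).map L
  have hLinj : Function.Injective L := Algebra.leftMulMatrix_injective b
  let k := IntermediateField.adjoin F {x₀}
  let x₀' : k := ⟨x₀, IntermediateField.mem_adjoin_simple_self F x₀⟩
  have hfd : FiniteDimensional F k :=
    IntermediateField.adjoin.finiteDimensional (Algebra.IsIntegral.isIntegral x₀)
  have : Finite k := Module.finite_of_finite F
  let _ : Fintype k := Fintype.ofFinite k
  have hk : Fintype.card k = Fintype.card F ^ Module.finrank F k := Module.card_eq_pow_finrank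
  have hx₀' : (pencil (L b₀) (L b₁) x₀').det ≠ 0 := by
    intro h
    apply hx₀
    have h1 := (algebraMap k Ω).map_det (pencil (L b₀) (L b₁) x₀')
    rw [h, map_zero] at h1
    have h2 := pencil_map (M₀ := L b₀) (M₁ := L b₁) (IsScalarTower.toAlgHom F k Ω) x₀'
    exact (congrArg Matrix.det h2).symm.trans h1.symm
  obtain ⟨c⟩ := nonempty_langCover F ((L b₁).map (algebraMap F k) * (pencil (L b₀) (L b₁) x₀')⁻¹)
  have heta : ∀ σ, ∃ a, L a = c.eta σ := fun σ => exists_leftMulMatrix_eq b fun a =>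
    c.commute_eta (LangCover.commute_mul_inv_pencil hx₀' (hL _ _) (hL _ _)) σ
  choose β hβ using heta
  let βm : c.Gal →* B :=
    { toFun := β
      map_one' := hLinj (by rw [hβ, c.eta_one, map_one])
      map_mul' := fun σ τ => hLinj (by rw [map_mul, hβ, hβ, hβ, c.eta_mul]) }
  let βu : c.Gal →* Bˣ := βm.toHomUnits
  have hβu : ∀ σ, L (βu σ : B) = c.eta σ := hβ
  have hinj : Function.Injective βu := fun σ τ h => c.eta_injective (by rw [← hβu, ← hβu, h])
  obtain ⟨C, j₀, hC⟩ := c.card_mul_card_le (Ω := Ω) (hL _ _) hx₀' hk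
    (fun σ τ => by rw [← hβu, ← hβu]; exact hL _ _)
  refine ⟨βu.range, Module.finrank F k, C, j₀, Module.finrank_pos, fun j => ?_, fun j hj =>
    ⟨fun x hxj hx => ?_, ?_⟩⟩
  · have h1 : x₀' ^ Fintype.card F ^ (2 * Module.finrank F k * j) = x₀' := by
      rw [mul_comm 2, mul_assoc, pow_mul, ← hk, FiniteField.pow_card_pow]
    exact congrArg Subtype.val h1
  · obtain ⟨φ, hφ⟩ := c.exists_param_eq (x - x₀)
    obtain ⟨σ, -, hσ⟩ := c.exists_pencilNorm_eq (hL _ _) hx₀' hk φ j (x := x) (by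
      rw [hφ]; exact add_sub_cancel x₀ x) hx hxj
    refine ⟨βu σ, ⟨σ, rfl⟩, ?_⟩
    rw [← hβu] at hσ
    exact hσ
  · rintro _ ⟨σ, rfl⟩ X hX
    have h1 : Nat.card βu.range = Nat.card c.Gal :=
      Nat.card_congr (MonoidHom.ofInjective hinj).toEquiv.symm
    rw [h1]
    refine hC j hj σ X fun x hx => ?_
    have := hX x hx
    have h2 := hβu σ
    simp only [L] at h2
    rw [h2] at this
    exact this

end CommAlgebra

section FrobeniusOrbit

variable {F Ω : Type*} [Field F] [Fintype F] [Field Ω] [Algebra F Ω]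

theorem minpoly_pow_card_pow [Algebra.IsAlgebraic F Ω] (x : Ω) (i : ℕ) :
    minpoly F (x ^ Fintype.card F ^ i) = minpoly F x := by
  have hx : IsIntegral F x := Algebra.IsIntegral.isIntegral x
  symm
  refine minpoly.eq_of_irreducible_of_monic (minpoly.irreducible hx) ?_ (minpoly.monic hx)
  have : x ^ Fintype.card F ^ i = (FiniteField.frobeniusAlgHom F Ω ^ i) x := by
    simp [AlgHom.coe_pow, FiniteField.coe_frobeniusAlgHom]
  rw [this, aeval_algHom_apply, minpoly.aeval, map_zero]

theorem map_minpoly_pow [IsAlgClosed Ω] [Algebra.IsAlgebraic F Ω] {x : Ω} {m : ℕ}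
    (hx : x ^ Fintype.card F ^ m = x) :
    (minpoly F x).natDegree * (m / (minpoly F x).natDegree) = m ∧
      (minpoly F x ^ (m / (minpoly F x).natDegree)).map (algebraMap F Ω) =
      ∏ i ∈ Finset.range m, (X - C (x ^ Fintype.card F ^ i)) := by
  set f : Polynomial Ω := ∏ i ∈ Finset.range m, (X - C (x ^ Fintype.card F ^ i)) with hf
  have hxi : IsIntegral F x := Algebra.IsIntegral.isIntegral x
  have hfm : f.Monic := monic_prod_of_monic _ _ fun i _ => monic_X_sub_C _
  have hfd : f.natDegree = m := by
    rw [hf, natDegree_prod_of_monic _ _ fun i _ => monic_X_sub_C _]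
    simp only [natDegree_X_sub_C, Finset.sum_const, Finset.card_range, smul_eq_mul, mul_one]
  have hfix : f.map (FiniteField.frobeniusAlgHom F Ω : Ω →+* Ω) = f := by
    have h1 : f.map (FiniteField.frobeniusAlgHom F Ω : Ω →+* Ω) =
        ∏ i ∈ Finset.range m, (X - C (x ^ Fintype.card F ^ (i + 1))) := by
      rw [hf, Polynomial.map_prod]
      refine Finset.prod_congr rfl fun i _ => ?_
      simp [← pow_mul, pow_succ']
    have h2 := (Finset.prod_range_succ (fun i => X - C (x ^ Fintype.card F ^ i)) m).symm.trans
      (Finset.prod_range_succ' (fun i => X - C (x ^ Fintype.card F ^ i)) m)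
    rw [hx, ← h1, ← hf, pow_zero, pow_one] at h2
    exact (mul_right_cancel₀ (X_sub_C_ne_zero x) h2).symm
  obtain ⟨g, hgf, hgd, hgm⟩ := lifts_and_natDegree_eq_and_monic (f := algebraMap F Ω) (p := f)
    ((lifts_iff_coeff_lifts f).2 fun n => FiniteField.mem_range_algebraMap_of_pow_card (by
      have := congrArg (fun p => p.coeff n) hfix
      simpa [coeff_map] using this)) hfm
  have hPi := minpoly.irreducible hxi
  have hroot : ∀ y : Ω, aeval y g = 0 → minpoly F y = minpoly F x := by
    intro y hy
    rw [aeval_def, ← eval_map, hgf, hf, eval_prod, Finset.prod_eq_zero_iff] at hy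
    obtain ⟨i, -, hi⟩ := hy
    rw [eval_sub, eval_X, eval_C, sub_eq_zero] at hi
    rw [hi, minpoly_pow_card_pow]
  obtain ⟨r, hr, hgr⟩ := (FiniteMultiplicity.of_not_isUnit hPi.not_isUnit
    hgm.ne_zero).exists_eq_pow_mul_and_not_dvd
  set P := minpoly F x with hP
  have hrm : r.Monic := ((minpoly.monic hxi).pow _).of_mul_monic_left (hr ▸ hgm)
  have hr1 : r = 1 := by
    by_contra hne
    have hdeg : (r.map (algebraMap F Ω)).degree ≠ 0 := by
      rw [degree_map]
      exact fun h => hne (hrm.degree_le_zero_iff_eq_one.1 h.le)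
    obtain ⟨y, hy⟩ := IsAlgClosed.exists_root _ hdeg
    have hy' : aeval y r = 0 := by rwa [aeval_def, ← eval_map]
    apply hgr
    rw [← hroot y (by rw [hr, map_mul, hy', mul_zero])]
    exact minpoly.dvd F y hy'
  rw [hr1, mul_one] at hr
  have hdm : m = P.natDegree * multiplicity P g := by
    rw [← hfd, ← hgd]; conv_lhs => rw [hr]
    rw [natDegree_pow, mul_comm]
  have hpos : 0 < P.natDegree := minpoly.natDegree_pos hxi
  have hdiv : m / P.natDegree = multiplicity P g := by
    conv_lhs => rw [hdm]
    exact Nat.mul_div_cancel_left _ hpos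
  rw [hdiv]
  exact ⟨hdm.symm, by rw [← hr, hgf]⟩

theorem pow_card_pow_natDegree_minpoly [Algebra.IsAlgebraic F Ω] (x : Ω) :
    x ^ Fintype.card F ^ (minpoly F x).natDegree = x := by
  have hx : IsIntegral F x := Algebra.IsIntegral.isIntegral x
  let k := IntermediateField.adjoin F {x}
  have hfd : FiniteDimensional F k := IntermediateField.adjoin.finiteDimensional hx
  have : Finite k := Module.finite_of_finite F
  let _ : Fintype k := Fintype.ofFinite k
  have hk : Fintype.card k = Fintype.card F ^ (minpoly F x).natDegree := by
    rw [← IntermediateField.adjoin.finrank hx]; exact Module.card_eq_pow_finrank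
  rw [← hk]
  exact congrArg Subtype.val
    (FiniteField.pow_card (⟨x, IntermediateField.mem_adjoin_simple_self F x⟩ : k))

end FrobeniusOrbit

section HomEval

variable {F B : Type*} [Field F] [CommRing B] [Algebra F B]

/-- Evaluation of the homogenization of `f` in degree `f.natDegree` at `(b₀, b₁)`. -/
noncomputable def homEval (b₀ b₁ : B) : F[X] →* B where
  toFun f := MvPolynomial.aeval ![b₀, b₁] (f.homogenize f.natDegree)
  map_one' := by simp
  map_mul' f g := by
    by_cases hf : f = 0
    · simp [hf]
    by_cases hg : g = 0
    · simp [hg]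
    rw [natDegree_mul hf hg, homogenize_mul _ _ le_rfl le_rfl, map_mul]

variable {ι Ω : Type*} [Fintype ι] [DecidableEq ι] [Fintype F] [Field Ω] [Algebra F Ω]
  (b : Module.Basis ι F B) (b₀ b₁ : B)

open TensorProduct in
theorem pencilNorm_eq_map_homEval {x : Ω} {n : ℕ} {f : F[X]} (hn : f.natDegree = n)
    (hf : f.map (algebraMap F Ω) = ∏ i ∈ Finset.range n, (X - C (x ^ Fintype.card F ^ i))) :
    pencilNorm (Algebra.leftMulMatrix b b₀) (Algebra.leftMulMatrix b b₁) x n =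
      (Algebra.leftMulMatrix b (homEval b₀ b₁ f)).map (algebraMap F Ω) := by
  let Φ : Ω ⊗[F] B →ₐ[Ω] Matrix ι ι Ω := Algebra.TensorProduct.lift (Algebra.ofId Ω _)
    ((Algebra.ofId F Ω).mapMatrix.comp (Algebra.leftMulMatrix b))
    (fun x y => Algebra.commutes x _)
  have hΦ : ∀ y : B, Φ (1 ⊗ₜ y) = (Algebra.leftMulMatrix b y).map (algebraMap F Ω) := fun y => by
    refine (Algebra.TensorProduct.lift_tmul _ _ _ _ _).trans ?_
    rw [map_one, one_mul]
    rfl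
  have h1 : ∀ n, pencilNorm (Algebra.leftMulMatrix b b₀) (Algebra.leftMulMatrix b b₁) x n =
      Φ (∏ i ∈ Finset.range n, ((1 : Ω) ⊗ₜ b₀ - (x ^ Fintype.card F ^ i) • ((1 : Ω) ⊗ₜ[F] b₁))) := by
    intro n
    induction n with
    | zero => simp [pencilNorm]
    | succ n ih =>
      rw [pencilNorm, Finset.prod_range_succ, mul_comm, map_mul, ← ih, map_sub, map_smul, hΦ, hΦ]
      rfl
  rw [h1, ← hΦ]
  congr 1
  have h2 : (f.map (algebraMap F Ω)).homogenize n = ∏ i ∈ Finset.range n,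
      (MvPolynomial.X 0 - MvPolynomial.C (x ^ Fintype.card F ^ i) * MvPolynomial.X 1) := by
    have := homogenize_finsetProd (s := Finset.range n)
      (p := fun i => X - C (x ^ Fintype.card F ^ i)) (n := fun _ => 1)
      fun i _ => (natDegree_X_sub_C _).le
    rw [Finset.sum_const, Finset.card_range, smul_eq_mul, mul_one] at this
    rw [hf, this]
    refine Finset.prod_congr rfl fun i _ => ?_
    rw [homogenize_sub, homogenize_X one_ne_zero, homogenize_C]
    simp
  have h3 := congrArg (MvPolynomial.aeval ![(1 : Ω) ⊗ₜ[F] b₀, (1 : Ω) ⊗ₜ[F] b₁]) h2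
  rw [homogenize_map, MvPolynomial.aeval_map_algebraMap] at h3
  have h4 : (MvPolynomial.aeval ![(1 : Ω) ⊗ₜ[F] b₀, (1 : Ω) ⊗ₜ[F] b₁] : MvPolynomial (Fin 2) F →ₐ[F] _)
      = (Algebra.TensorProduct.includeRight).comp (MvPolynomial.aeval ![b₀, b₁]) := by
    ext i
    fin_cases i <;> simp
  rw [h4] at h3
  rw [homEval, MonoidHom.coe_mk, OneHom.coe_mk, hn]
  refine Eq.trans ?_ h3.symm
  simp [map_prod, Algebra.smul_def]

variable [IsAlgClosed Ω] [Algebra.IsAlgebraic F Ω]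

theorem pencilNorm_eq_map_homEval_minpoly {x : Ω} {m : ℕ} (hx : x ^ Fintype.card F ^ m = x) :
    pencilNorm (Algebra.leftMulMatrix b b₀) (Algebra.leftMulMatrix b b₁) x m =
      (Algebra.leftMulMatrix b
        (homEval b₀ b₁ (minpoly F x ^ (m / (minpoly F x).natDegree)))).map (algebraMap F Ω) := by
  obtain ⟨h1, h2⟩ := map_minpoly_pow hx
  exact pencilNorm_eq_map_homEval b b₀ b₁ (by rw [natDegree_pow, mul_comm, h1]) h2

omit [Fintype F] in
theorem isUnit_iff_det_leftMulMatrix_ne_zero (y : B) :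
    IsUnit y ↔ (Algebra.leftMulMatrix b y).det ≠ 0 := by
  constructor
  · intro h
    exact ((h.map (Algebra.leftMulMatrix b)).map Matrix.detMonoidHom).ne_zero
  · intro h
    have : Module.Finite F B := Module.Finite.of_basis b
    have hinj : Function.Injective (LinearMap.mulLeft F y) := by
      rw [← LinearMap.ker_eq_bot]
      by_contra hne
      apply h
      rw [← Algebra.norm_eq_matrix_det, Algebra.norm_apply]
      exact LinearMap.det_eq_zero_iff_ker_ne_bot.2 hne
    obtain ⟨z, hz⟩ := LinearMap.injective_iff_surjective.1 hinj 1
    exact IsUnit.of_mul_eq_one z hz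

theorem det_pencil_ne_zero_iff (x : Ω) :
    (pencil (Algebra.leftMulMatrix b b₀) (Algebra.leftMulMatrix b b₁) x).det ≠ 0 ↔
      IsUnit (homEval b₀ b₁ (minpoly F x)) := by
  have hpos : 0 < (minpoly F x).natDegree := minpoly.natDegree_pos (Algebra.IsIntegral.isIntegral x)
  have h := pencilNorm_eq_map_homEval_minpoly b b₀ b₁ (pow_card_pow_natDegree_minpoly (F := F) x)
  rw [Nat.div_self hpos, pow_one] at h
  rw [isUnit_iff_det_leftMulMatrix_ne_zero b]
  have h2 : (Algebra.leftMulMatrix b (homEval b₀ b₁ (minpoly F x))).det ≠ 0 ↔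
      (pencilNorm (Algebra.leftMulMatrix b b₀) (Algebra.leftMulMatrix b b₁) x
        (minpoly F x).natDegree).det ≠ 0 := by
    rw [h, ← RingHom.mapMatrix_apply, ← RingHom.map_det, _root_.map_ne_zero]
  rw [h2]
  refine ⟨fun h => det_pencilNorm_ne_zero h _, fun h0 h1 => h0 ?_⟩
  obtain ⟨n, hn⟩ := Nat.exists_eq_add_of_lt hpos
  rw [hn, zero_add, pencilNorm, Matrix.det_mul, det_pencil_pow, h1, zero_pow (by positivity),
    zero_mul]

/-- Equidistribution upper bound for `homEval` along the fixed points of Frobenius powers. -/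
theorem exists_subgroup_homEval [Finite B] {x₀ : Ω} (hx₀ : IsUnit (homEval b₀ b₁ (minpoly F x₀))) :
    ∃ (H : Subgroup Bˣ) (M C j₀ : ℕ), 0 < M ∧
      (∀ j, x₀ ^ Fintype.card F ^ (2 * M * j) = x₀) ∧ ∀ j, j₀ ≤ j →
      (∀ x : Ω, x ^ Fintype.card F ^ (2 * M * j) = x → IsUnit (homEval b₀ b₁ (minpoly F x)) →
        ∃ h ∈ H, homEval b₀ b₁ (minpoly F x ^ (2 * M * j / (minpoly F x).natDegree)) =
          h * homEval b₀ b₁ (minpoly F x₀ ^ (2 * M * j / (minpoly F x₀).natDegree))) ∧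
      (∀ h ∈ H, ∀ Y : Finset Ω, (∀ x ∈ Y, x ^ Fintype.card F ^ (2 * M * j) = x ∧
        IsUnit (homEval b₀ b₁ (minpoly F x)) ∧
        homEval b₀ b₁ (minpoly F x ^ (2 * M * j / (minpoly F x).natDegree)) =
          h * homEval b₀ b₁ (minpoly F x₀ ^ (2 * M * j / (minpoly F x₀).natDegree))) →
        Nat.card H * Y.card ≤
          (Fintype.card F ^ (M * j)) ^ 2 + C * Fintype.card F ^ (M * j)) := by
  have : Module.Finite F B := Module.Finite.of_finite
  let b := Module.finBasis F B
  obtain ⟨H, M, C, j₀, hM, hx₀M, hj⟩ :=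
    exists_subgroup_pencilNorm b b₀ b₁ ((det_pencil_ne_zero_iff b b₀ b₁ x₀).2 hx₀)
  have hinj : ∀ y z : B, (Algebra.leftMulMatrix b y).map (algebraMap F Ω) =
      (Algebra.leftMulMatrix b z).map (algebraMap F Ω) → y = z := fun y z h =>
    Algebra.leftMulMatrix_injective b (Matrix.map_injective (algebraMap F Ω).injective h)
  refine ⟨H, M, C, j₀, hM, hx₀M, fun j hjj => ⟨fun x hxj hx => ?_, fun h hh Y hY => ?_⟩⟩
  · obtain ⟨h, hh, he⟩ := (hj j hjj).1 x hxj ((det_pencil_ne_zero_iff b b₀ b₁ x).2 hx)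
    refine ⟨h, hh, hinj _ _ ?_⟩
    rw [pencilNorm_eq_map_homEval_minpoly b b₀ b₁ hxj,
      pencilNorm_eq_map_homEval_minpoly b b₀ b₁ (hx₀M j), ← Matrix.map_mul, ← map_mul] at he
    exact he
  · refine (hj j hjj).2 h hh Y fun x hx => ?_
    obtain ⟨h1, h2, h3⟩ := hY x hx
    refine ⟨h1, (det_pencil_ne_zero_iff b b₀ b₁ x).2 h2, ?_⟩
    rw [pencilNorm_eq_map_homEval_minpoly b b₀ b₁ h1,
      pencilNorm_eq_map_homEval_minpoly b b₀ b₁ (hx₀M j), ← Matrix.map_mul, ← map_mul, h3]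

end HomEval

section MonicSums

variable {F : Type*} [Field F]

theorem coeff_lowPoly {n : ℕ} (x : Fin n → F) (i : Fin n) : (lowPoly F n x).coeff i = x i := by
  rw [lowPoly, finsetSum_coeff, Finset.sum_eq_single i]
  · simp
  · intro j _ hj
    rw [coeff_C_mul, coeff_X_pow, if_neg (fun h => hj (Fin.ext h.symm)), mul_zero]
  · simp

theorem lowPoly_injective (n : ℕ) : Function.Injective (lowPoly F n) := fun x y h =>
  funext fun i => by rw [← coeff_lowPoly x, h, coeff_lowPoly]

theorem degree_lowPoly_lt {n : ℕ} (x : Fin n → F) : (lowPoly F n x).degree < n :=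
  (degree_sum_le _ _).trans_lt <| (Finset.sup_lt_iff (WithBot.bot_lt_coe n)).2 fun i _ =>
    (degree_C_mul_X_pow_le _ _).trans_lt (WithBot.coe_lt_coe.2 i.2)

variable (F) in
/-- The monic polynomials of degree `n`. -/
noncomputable def monicPolys [Fintype F] (n : ℕ) : Finset F[X] :=
  Finset.univ.map ⟨fun x : Fin n → F => X ^ n + lowPoly F n x, fun _ _ h =>
    lowPoly_injective n (add_left_cancel h)⟩

variable [Fintype F]

@[simp]
theorem mem_monicPolys {n : ℕ} {f : F[X]} : f ∈ monicPolys F n ↔ f.Monic ∧ f.natDegree = n := by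
  simp only [monicPolys, Finset.mem_map, Finset.mem_univ, true_and]
  constructor
  · rintro ⟨x, rfl⟩
    change (X ^ n + lowPoly F n x).Monic ∧ (X ^ n + lowPoly F n x).natDegree = n
    have h := degree_lowPoly_lt x
    refine ⟨monic_X_pow_add h, ?_⟩
    rw [natDegree_add_eq_left_of_degree_lt (by rwa [degree_X_pow]), natDegree_X_pow]
  · rintro ⟨hf, rfl⟩
    refine ⟨fun i => f.coeff i, ?_⟩
    conv_rhs => rw [hf.as_sum]
    change X ^ _ + lowPoly F _ _ = _
    rw [lowPoly, Fin.sum_univ_eq_sum_range (fun i => C (f.coeff i) * X ^ i)]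

open scoped Classical

theorem sum_antidiagonal_monicPolys {A : Type*} [CommSemiring A] (φ : F[X] →* A)
    (u : F[X] → A) (n : ℕ) :
    ∑ ij ∈ Finset.HasAntidiagonal.antidiagonal n, (∑ d ∈ monicPolys F ij.1, u d * φ d) *
      ∑ e ∈ monicPolys F ij.2, φ e =
    ∑ f ∈ monicPolys F n, (∑ d ∈ ((Finset.range (n + 1)).biUnion (monicPolys F)).filter
      (· ∣ f), u d) * φ f := by
  simp_rw [Finset.sum_mul_sum, Finset.sum_mul, Finset.sum_sigma']
  refine Finset.sum_bij (fun a _ => ⟨a.2.1 * a.2.2, a.2.1⟩) ?_ ?_ ?_ ?_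
  · rintro ⟨⟨i, j⟩, d, e⟩ h
    simp only [Finset.mem_sigma, Finset.HasAntidiagonal.mem_antidiagonal, mem_monicPolys, Finset.mem_filter,
      Finset.mem_biUnion, Finset.mem_range] at h ⊢
    obtain ⟨h1, ⟨hd, rfl⟩, ⟨he, rfl⟩⟩ := h
    exact ⟨⟨hd.mul he, by rw [hd.natDegree_mul he, h1]⟩,
      ⟨d.natDegree, by omega, hd, rfl⟩, dvd_mul_right _ _⟩
  · rintro ⟨⟨i, j⟩, d, e⟩ h ⟨⟨i', j'⟩, d', e'⟩ h' heq
    simp only [Finset.mem_sigma, Finset.HasAntidiagonal.mem_antidiagonal, mem_monicPolys] at h h'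
    obtain ⟨h1, ⟨hd, rfl⟩, ⟨he, rfl⟩⟩ := h
    obtain ⟨h1', ⟨hd', rfl⟩, ⟨he', rfl⟩⟩ := h'
    simp only [Sigma.mk.injEq, heq_eq_eq] at heq
    obtain ⟨h2, rfl⟩ := heq
    obtain rfl := mul_left_cancel₀ hd.ne_zero h2
    rfl
  · rintro ⟨f, d⟩ h
    simp only [Finset.mem_sigma, mem_monicPolys, Finset.mem_filter,
      Finset.mem_biUnion, Finset.mem_range] at h
    obtain ⟨⟨hf, rfl⟩, ⟨_, _, hd, rfl⟩, e, rfl⟩ := h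
    have he := hd.of_mul_monic_left hf
    exact ⟨⟨(d.natDegree, e.natDegree), d, e⟩, by
      simp [hd, he, hd.natDegree_mul he], rfl⟩
  · rintro ⟨⟨i, j⟩, d, e⟩ h
    simp only [map_mul, mul_assoc]

omit [Fintype F] in
theorem polyMu_mul_of_irreducible {P f : F[X]} (hP : Irreducible P) (hf : f ≠ 0) (h : ¬ P ∣ f) :
    polyMu (P * f) = - polyMu f := by
  have hcop : IsRelPrime P f := (hP.coprime_iff_not_dvd.2 h).isRelPrime
  have hsq : Squarefree (P * f) ↔ Squarefree f := by
    rw [squarefree_mul_iff]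
    exact ⟨fun h => h.2.2, fun h => ⟨hcop, hP.squarefree, h⟩⟩
  unfold polyMu
  rw [hsq, UniqueFactorizationMonoid.normalizedFactors_mul hP.ne_zero hf,
    UniqueFactorizationMonoid.normalizedFactors_irreducible hP]
  split_ifs
  · rw [Multiset.card_add, Multiset.card_singleton, pow_add, pow_one, neg_one_mul]
  · simp

omit [Fintype F] in
theorem polyMu_one : polyMu (1 : F[X]) = 1 := by
  simp [polyMu, UniqueFactorizationMonoid.normalizedFactors_one]

theorem sum_polyMu_dvd
    {n : ℕ} (hn : n ≠ 0) {f : F[X]} (hf : f ∈ monicPolys F n) :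
    ∑ d ∈ ((Finset.range (n + 1)).biUnion (monicPolys F)).filter
      (· ∣ f), polyMu d = 0 := by
  rw [mem_monicPolys] at hf
  obtain ⟨hfm, rfl⟩ := hf
  have hfu : ¬ IsUnit f := fun h => hn (natDegree_eq_zero_of_isUnit h)
  obtain ⟨P, hPm, hP, hPf⟩ := exists_monic_irreducible_factor f hfu
  have key : ∀ c, Squarefree (P * c) → ¬ P ∣ c := fun c h hc => hP.not_isUnit
    (h P (mul_dvd_mul_left P hc))
  rw [← Finset.sum_filter_of_ne (p := Squarefree) fun d _ hd => by
    by_contra h; exact hd (if_neg h)]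
  refine Finset.sum_involution (fun d _ => if P ∣ d then d / P else P * d) ?_ ?_ ?_ ?_
  · intro d hd
    simp only [Finset.mem_filter] at hd
    split_ifs with h
    · obtain ⟨c, rfl⟩ := h
      rw [mul_div_cancel_left₀ _ hP.ne_zero, polyMu_mul_of_irreducible hP
        (right_ne_zero_of_mul hd.2.ne_zero) (key c hd.2), neg_add_cancel]
    · rw [polyMu_mul_of_irreducible hP hd.2.ne_zero h, add_neg_cancel]
  · intro d hd _
    simp only [Finset.mem_filter] at hd
    split_ifs with h
    · obtain ⟨c, rfl⟩ := h
      rw [mul_div_cancel_left₀ _ hP.ne_zero]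
      intro h
      exact key c hd.2 (h ▸ dvd_mul_right P c)
    · intro h'
      exact h (h' ▸ dvd_mul_right P d)
  · intro d hd
    simp only [Finset.mem_filter, Finset.mem_biUnion, Finset.mem_range, mem_monicPolys] at hd ⊢
    obtain ⟨⟨⟨_, hd1, hdm, rfl⟩, hdf⟩, hsq⟩ := hd
    split_ifs with h
    · obtain ⟨c, rfl⟩ := h
      rw [mul_div_cancel_left₀ _ hP.ne_zero]
      have hc := hPm.of_mul_monic_left hdm
      have hcf := (dvd_mul_left c P).trans hdf
      exact ⟨⟨⟨_, Nat.lt_succ_of_le (natDegree_le_of_dvd hcf hfm.ne_zero), hc, rfl⟩, hcf⟩,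
        hsq.squarefree_of_dvd (dvd_mul_left c P)⟩
    · have hcop : IsRelPrime P d := (hP.coprime_iff_not_dvd.2 h).isRelPrime
      have hdv : P * d ∣ f := hcop.mul_dvd hPf hdf
      exact ⟨⟨⟨_, Nat.lt_succ_of_le (natDegree_le_of_dvd hdv hfm.ne_zero), hPm.mul hdm, rfl⟩, hdv⟩,
        squarefree_mul_iff.2 ⟨hcop, hP.squarefree, hsq⟩⟩
  · intro d hd
    simp only [Finset.mem_filter] at hd
    by_cases h : P ∣ d
    · obtain ⟨c, rfl⟩ := h
      simp only [dvd_mul_right, if_true, mul_div_cancel_left₀ _ hP.ne_zero, if_neg (key c hd.2)]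
    · simp only [if_neg h, dvd_mul_right, if_true, mul_div_cancel_left₀ _ hP.ne_zero]

end MonicSums

section MonicSeries

open scoped Classical

variable {F : Type*} [Field F] [Fintype F] (φ : F[X] →* ℂ)

/-- The sum of `φ` over monic polynomials of degree `n`. -/
noncomputable def monicSum (n : ℕ) : ℂ := ∑ f ∈ monicPolys F n, φ f

/-- The sum of `μ φ` over monic polynomials of degree `n`. -/
noncomputable def moebiusSum (n : ℕ) : ℂ := ∑ f ∈ monicPolys F n, (polyMu f : ℂ) * φ f

/-- The sum of `deg P * φ (P ^ j)` over powers `P ^ j` of degree `m` of monic irreducible `P`. -/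
noncomputable def primeSum (m : ℕ) : ℂ :=
  ∑ d ∈ m.divisors, ∑ P ∈ (monicPolys F d).filter Irreducible, (d : ℂ) * φ P ^ (m / d)

theorem monicSum_zero : monicSum φ 0 = 1 := by
  have : monicPolys F 0 = {1} := by
    ext f
    rw [mem_monicPolys, Finset.mem_singleton]
    exact ⟨fun h => h.1.natDegree_eq_zero.1 h.2, fun h => by simp [h]⟩
  simp [monicSum, this]

theorem mk_moebiusSum_mul_mk_monicSum :
    PowerSeries.mk (moebiusSum φ) * PowerSeries.mk (monicSum φ) = 1 := by
  ext n
  rw [PowerSeries.coeff_mul, PowerSeries.coeff_one]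
  simp only [PowerSeries.coeff_mk]
  rw [show ∑ p ∈ Finset.HasAntidiagonal.antidiagonal n, moebiusSum φ p.1 * monicSum φ p.2 = _ from
    sum_antidiagonal_monicPolys φ (fun f => (polyMu f : ℂ)) n]
  split_ifs with hn
  · subst hn
    have h0 : monicPolys F 0 = {1} := by
      ext f
      rw [mem_monicPolys, Finset.mem_singleton]
      exact ⟨fun h => h.1.natDegree_eq_zero.1 h.2, fun h => by simp [h]⟩
    simp [h0, Finset.filter_singleton, polyMu_one]
  · refine Finset.sum_eq_zero fun f hf => ?_
    rw [← Int.cast_sum, sum_polyMu_dvd hn hf, Int.cast_zero, zero_mul]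

omit [Fintype F] in
theorem pow_dvd_iff_le_count {P f : F[X]} (hP : Irreducible P) (hPm : P.Monic) (hf : f ≠ 0)
    (j : ℕ) : P ^ j ∣ f ↔ j ≤ (UniqueFactorizationMonoid.normalizedFactors f).count P := by
  rw [pow_dvd_iff_le_emultiplicity,
    UniqueFactorizationMonoid.emultiplicity_eq_count_normalizedFactors hP hf,
    hPm.normalize_eq_self, Nat.cast_le]

omit [Fintype F] in
theorem monic_of_mem_normalizedFactors {P f : F[X]}
    (hP : P ∈ UniqueFactorizationMonoid.normalizedFactors f) : P.Monic := by
  rw [← UniqueFactorizationMonoid.normalize_normalized_factor P hP]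
  exact monic_normalize (UniqueFactorizationMonoid.irreducible_of_normalized_factor P hP).ne_zero

omit [Fintype F] in
theorem natDegree_eq_sum_count {f : F[X]} (hf : f.Monic) :
    f.natDegree = ∑ P ∈ (UniqueFactorizationMonoid.normalizedFactors f).toFinset,
      ∑ _j ∈ Finset.Icc 1 ((UniqueFactorizationMonoid.normalizedFactors f).count P),
        P.natDegree := by
  have h1 : (UniqueFactorizationMonoid.normalizedFactors f).prod = f := by
    rw [UniqueFactorizationMonoid.prod_normalizedFactors_eq hf.ne_zero, hf.normalize_eq_self]
  conv_lhs => rw [← h1]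
  rw [natDegree_multiset_prod _ (UniqueFactorizationMonoid.zero_notMem_normalizedFactors f),
    Finset.sum_multiset_map_count]
  refine Finset.sum_congr rfl fun P _ => ?_
  rw [Finset.sum_const, Nat.card_Icc, Nat.add_sub_cancel]

theorem natCast_mul_monicSum (n : ℕ) : (n : ℂ) * monicSum φ n =
    ∑ p ∈ Finset.HasAntidiagonal.antidiagonal n, primeSum φ p.1 * monicSum φ p.2 := by
  have h1 : (n : ℂ) * monicSum φ n = ∑ f ∈ monicPolys F n,
      ∑ P ∈ (UniqueFactorizationMonoid.normalizedFactors f).toFinset,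
      ∑ _j ∈ Finset.Icc 1 ((UniqueFactorizationMonoid.normalizedFactors f).count P),
        (P.natDegree : ℂ) * φ f := by
    rw [monicSum, Finset.mul_sum]
    refine Finset.sum_congr rfl fun f hf => ?_
    rw [mem_monicPolys] at hf
    rw [← hf.2, natDegree_eq_sum_count hf.1]
    push_cast
    simp_rw [Finset.sum_mul]
  rw [h1]
  simp_rw [primeSum, monicSum, Finset.sum_mul, Finset.mul_sum, Finset.sum_sigma']
  symm
  refine Finset.sum_bij (fun a _ => ⟨a.2.2.1 ^ (a.1.1 / a.2.1) * a.2.2.2, a.2.2.1, a.1.1 / a.2.1⟩)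
    ?_ ?_ ?_ ?_
  · rintro ⟨⟨m, i⟩, d, P, g⟩ h
    simp only [Finset.mem_sigma, Finset.HasAntidiagonal.mem_antidiagonal, mem_monicPolys,
      Finset.mem_filter, Nat.mem_divisors, Multiset.mem_toFinset, Finset.mem_Icc] at h ⊢
    obtain ⟨h1, ⟨⟨j, rfl⟩, hm⟩, ⟨⟨hP, rfl⟩, hPi⟩, hg, rfl⟩ := h
    have hd : 0 < P.natDegree := hPi.natDegree_pos
    have hj : 0 < j := Nat.pos_of_ne_zero fun h => hm (by rw [h, mul_zero])
    rw [Nat.mul_div_cancel_left _ hd]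
    have hfm : (P ^ j * g).Monic := (hP.pow j).mul hg
    have hc := (pow_dvd_iff_le_count hPi hP hfm.ne_zero j).1 (dvd_mul_right _ _)
    refine ⟨⟨hfm, ?_⟩, Multiset.count_pos.1 (hj.trans_le hc), hj, hc⟩
    rw [(hP.pow j).natDegree_mul hg, natDegree_pow, mul_comm j, h1]
  · rintro ⟨⟨m, i⟩, d, P, g⟩ h ⟨⟨m', i'⟩, d', P', g'⟩ h' heq
    simp only [Finset.mem_sigma, Finset.HasAntidiagonal.mem_antidiagonal, mem_monicPolys,
      Finset.mem_filter, Nat.mem_divisors] at h h'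
    obtain ⟨h1, ⟨⟨j, rfl⟩, hm⟩, ⟨⟨hP, rfl⟩, hPi⟩, hg, rfl⟩ := h
    obtain ⟨h1', ⟨⟨j', rfl⟩, hm'⟩, ⟨⟨hP', rfl⟩, hPi'⟩, hg', rfl⟩ := h'
    simp only [Nat.mul_div_cancel_left _ hPi.natDegree_pos,
      Nat.mul_div_cancel_left _ hPi'.natDegree_pos, Sigma.mk.injEq, heq_eq_eq] at heq
    obtain ⟨h2, rfl, rfl⟩ := heq
    obtain rfl := mul_left_cancel₀ (hP.pow j).ne_zero h2
    rfl
  · rintro ⟨f, P, j⟩ h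
    simp only [Finset.mem_sigma, mem_monicPolys, Multiset.mem_toFinset, Finset.mem_Icc] at h
    obtain ⟨⟨hf, rfl⟩, hP, hj, hjc⟩ := h
    have hPi := UniqueFactorizationMonoid.irreducible_of_normalized_factor P hP
    have hPm := monic_of_mem_normalizedFactors hP
    obtain ⟨g, rfl⟩ := (pow_dvd_iff_le_count hPi hPm hf.ne_zero j).2 hjc
    have hg := (hPm.pow j).of_mul_monic_left hf
    refine ⟨⟨(P.natDegree * j, g.natDegree), P.natDegree, P, g⟩, ?_, ?_⟩
    · simp only [Finset.mem_sigma, Finset.HasAntidiagonal.mem_antidiagonal, mem_monicPolys,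
        Finset.mem_filter, Nat.mem_divisors]
      refine ⟨?_, ⟨dvd_mul_right _ _, ?_⟩, ⟨⟨hPm, trivial⟩, hPi⟩, hg, trivial⟩
      · rw [(hPm.pow j).natDegree_mul hg, natDegree_pow, mul_comm]
      · exact (Nat.mul_pos hPi.natDegree_pos hj).ne'
    · simp only [Nat.mul_div_cancel_left _ hPi.natDegree_pos]
  · rintro ⟨⟨m, i⟩, d, P, g⟩ h
    simp only [Finset.mem_sigma, mem_monicPolys, Finset.mem_filter] at h
    simp only [h.2.2.1.1.2, map_mul, map_pow, mul_assoc]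

theorem X_mul_derivative_monicSum :
    PowerSeries.X * PowerSeries.derivative ℂ (PowerSeries.mk (monicSum φ)) =
      PowerSeries.mk (primeSum φ) * PowerSeries.mk (monicSum φ) := by
  ext n
  rw [PowerSeries.coeff_mul n (PowerSeries.mk (primeSum φ))]
  simp only [PowerSeries.coeff_mk]
  rw [← natCast_mul_monicSum]
  cases n with
  | zero => simp
  | succ n =>
    rw [PowerSeries.coeff_succ_X_mul, PowerSeries.coeff_derivative, PowerSeries.coeff_mk]
    push_cast
    ring

theorem natCast_mul_moebiusSum (n : ℕ) : (n : ℂ) * moebiusSum φ n =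
    -∑ p ∈ Finset.HasAntidiagonal.antidiagonal n, primeSum φ p.1 * moebiusSum φ p.2 := by
  set A := PowerSeries.mk (monicSum φ)
  set H := PowerSeries.mk (moebiusSum φ) with hH
  set S := PowerSeries.mk (primeSum φ) with hS
  have h1 : H * A = 1 := mk_moebiusSum_mul_mk_monicSum φ
  have h2 : PowerSeries.X * PowerSeries.derivative ℂ A = S * A := X_mul_derivative_monicSum φ
  have h3 : PowerSeries.X * PowerSeries.derivative ℂ H = -(S * H) := by
    have h4 := congrArg (PowerSeries.derivative ℂ) h1
    rw [Derivation.leibniz, Derivation.map_one_eq_zero, smul_eq_mul, smul_eq_mul] at h4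
    linear_combination (PowerSeries.X * H) * h4 -
      (PowerSeries.X * PowerSeries.derivative ℂ H + S * H) * h1 - H ^ 2 * h2
  have h5 := congrArg (PowerSeries.coeff n) h3
  rw [map_neg, PowerSeries.coeff_mul n S] at h5
  simp only [hS, hH, PowerSeries.coeff_mk] at h5
  rw [← h5]
  cases n with
  | zero => simp
  | succ n =>
    rw [PowerSeries.coeff_succ_X_mul, PowerSeries.coeff_derivative, PowerSeries.coeff_mk]
    push_cast
    ring

end MonicSeries

section FrobFixed

open scoped Classical

variable (F Ω : Type*) [Field F] [Fintype F] [Field Ω] [Algebra F Ω]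

/-- The elements of `Ω` fixed by the `m`-th power of the Frobenius of `F`. -/
noncomputable def frobFixed (m : ℕ) : Finset Ω :=
  (X ^ Fintype.card F ^ m - X : Polynomial Ω).roots.toFinset

variable {F Ω}

omit [Algebra F Ω] in
theorem mem_frobFixed {m : ℕ} (hm : m ≠ 0) {x : Ω} :
    x ∈ frobFixed F Ω m ↔ x ^ Fintype.card F ^ m = x := by
  rw [frobFixed, Multiset.mem_toFinset,
    mem_roots (FiniteField.X_pow_card_pow_sub_X_ne_zero Ω hm Fintype.one_lt_card), IsRoot.def,
    eval_sub, eval_pow, eval_X, sub_eq_zero]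

theorem card_frobFixed [IsAlgClosed Ω] {m : ℕ} (hm : m ≠ 0) :
    (frobFixed F Ω m).card = Fintype.card F ^ m := by
  obtain ⟨p, hp⟩ := CharP.exists F
  have : CharP Ω p := charP_of_injective_algebraMap (algebraMap F Ω).injective p
  have hdvd : p ∣ Fintype.card F ^ m :=
    dvd_pow ((CharP.cast_eq_zero_iff F p _).1 (Nat.cast_card_eq_zero F)) hm
  rw [frobFixed, Multiset.toFinset_card_of_nodup (nodup_roots (galois_poly_separable p _ hdvd)),
    ← (IsAlgClosed.splits _).natDegree_eq_card_roots,
    FiniteField.X_pow_card_pow_sub_X_natDegree_eq Ω hm Fintype.one_lt_card]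

theorem primeSum_eq_sum_frobFixed [IsAlgClosed Ω] [Algebra.IsAlgebraic F Ω] (φ : F[X] →* ℂ) {m : ℕ}
    (hm : m ≠ 0) : primeSum φ m =
      ∑ x ∈ frobFixed F Ω m, φ (minpoly F x ^ (m / (minpoly F x).natDegree)) := by
  rw [primeSum, Finset.sum_sigma']
  symm
  refine (Finset.sum_fiberwise_of_maps_to (g := fun x => (⟨(minpoly F x).natDegree, minpoly F x⟩ :
    (_ : ℕ) × F[X])) (fun x hx => ?_) _).symm.trans (Finset.sum_congr rfl ?_)
  · have hxi : IsIntegral F x := Algebra.IsIntegral.isIntegral x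
    simp only [Finset.mem_sigma, Finset.mem_filter, mem_monicPolys, Nat.mem_divisors]
    exact ⟨⟨⟨_, (map_minpoly_pow ((mem_frobFixed hm).1 hx)).1.symm⟩, hm⟩,
      ⟨minpoly.monic hxi, trivial⟩, minpoly.irreducible hxi⟩
  · rintro ⟨d, P⟩ hP
    simp only [Finset.mem_sigma, Finset.mem_filter, mem_monicPolys, Nat.mem_divisors] at hP
    obtain ⟨⟨⟨j, hj⟩, -⟩, ⟨hPm, rfl⟩, hPi⟩ := hP
    have hfib : (frobFixed F Ω m).filter (fun x => (⟨(minpoly F x).natDegree, minpoly F x⟩ :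
        (_ : ℕ) × F[X]) = ⟨P.natDegree, P⟩) = (P.aroots Ω).toFinset := by
      ext x
      have hxi : IsIntegral F x := Algebra.IsIntegral.isIntegral x
      simp only [Finset.mem_filter, Multiset.mem_toFinset, mem_frobFixed hm,
        mem_aroots, Sigma.mk.injEq, heq_eq_eq]
      constructor
      · rintro ⟨-, -, rfl⟩
        exact ⟨hPi.ne_zero, minpoly.aeval F x⟩
      · rintro ⟨-, h⟩
        have h1 : minpoly F x = P := (minpoly.eq_of_irreducible_of_monic hPi h hPm).symm
        refine ⟨?_, by rw [h1], h1⟩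
        have h2 := pow_card_pow_natDegree_minpoly (F := F) x
        rw [h1] at h2
        rw [hj]
        clear hj
        induction j with
        | zero => simp
        | succ j ih => rw [Nat.mul_succ, pow_add, pow_mul, ih, h2]
    rw [hfib, Finset.sum_congr rfl (g := fun _ => φ P ^ (m / P.natDegree)), Finset.sum_const,
      nsmul_eq_mul]
    · congr 2
      rw [Multiset.toFinset_card_of_nodup
        (nodup_roots ((PerfectField.separable_of_irreducible hPi).map)),
        ← (IsAlgClosed.splits _).natDegree_eq_card_roots, natDegree_map]
    · intro x hx
      rw [Multiset.mem_toFinset, mem_aroots] at hx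
      rw [minpoly.eq_of_irreducible_of_monic hPi hx.2 hPm, map_pow]

end FrobFixed

section PowerSums

theorem exists_le_re_pow (s : Finset ℂ) (N : ℕ) :
    ∃ j, N ≤ j ∧ ∀ z ∈ s, ‖z‖ ^ j / 2 ≤ (z ^ j).re := by
  let u : ℕ → s → ℂ := fun n z => ((z : ℂ) / ‖(z : ℂ)‖) ^ n
  have hle : ∀ z : ℂ, ‖z / ‖z‖‖ ≤ 1 := fun z => by
    rw [norm_div, Complex.norm_real, norm_norm]
    exact div_self_le_one _
  have hu : ∀ n, u n ∈ Metric.closedBall (0 : s → ℂ) 1 := fun n => by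
    rw [mem_closedBall_zero_iff, pi_norm_le_iff_of_nonneg zero_le_one]
    intro z
    rw [norm_pow]
    exact pow_le_one₀ (norm_nonneg _) (hle z)
  obtain ⟨a, -, g, hg, hlim⟩ := (isCompact_closedBall (0 : s → ℂ) 1).tendsto_subseq hu
  obtain ⟨n₀, hn₀⟩ := Metric.cauchySeq_iff'.1 hlim.cauchySeq (1 / 2) (by norm_num)
  have hgn : N + g n₀ ≤ g (n₀ + N + g n₀) := by
    have := hg.le_apply (x := n₀ + N + g n₀)
    omega
  refine ⟨g (n₀ + N + g n₀) - g n₀, by omega, fun z hz => ?_⟩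
  by_cases hz0 : z = 0
  · subst hz0
    rcases Nat.eq_zero_or_pos (g (n₀ + N + g n₀) - g n₀) with h | h
    · rw [h]; norm_num
    · simp [zero_pow h.ne']
  have hn0 : (‖z‖ : ℂ) ≠ 0 := by simpa using hz0
  set w : ℂ := z / ‖z‖ with hw
  have hwn : ‖w‖ = 1 := by
    rw [hw, norm_div, Complex.norm_real, norm_norm, div_self (norm_ne_zero_iff.2 hz0)]
  set j := g (n₀ + N + g n₀) - g n₀ with hj
  have h1 : ‖w ^ j - 1‖ < 1 / 2 := by
    have h2 := hn₀ (n₀ + N + g n₀) (by omega)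
    have h3 := (dist_le_pi_dist (u (g (n₀ + N + g n₀))) (u (g n₀)) ⟨z, hz⟩).trans_lt h2
    have h4 : w ^ g (n₀ + N + g n₀) = w ^ g n₀ * w ^ j := by
      rw [← pow_add]; congr 1; omega
    change dist (w ^ g (n₀ + N + g n₀)) (w ^ g n₀) < 1 / 2 at h3
    rwa [dist_eq_norm, h4, ← mul_sub_one, norm_mul, norm_pow, hwn, one_pow, one_mul] at h3
  have h5 : 1 / 2 ≤ (w ^ j).re := by
    have := (abs_le.1 ((Complex.abs_re_le_norm (w ^ j - 1)).trans h1.le)).1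
    rw [Complex.sub_re, Complex.one_re] at this
    linarith
  have h6 : z ^ j = ((‖z‖ ^ j : ℝ) : ℂ) * w ^ j := by
    rw [Complex.ofReal_pow, ← mul_pow, hw, mul_div_cancel₀ _ hn0]
  rw [h6, Complex.re_ofReal_mul]
  nlinarith [pow_nonneg (norm_nonneg z) j]

theorem exists_sum_norm_pow_le_re (s : Multiset ℂ) (N : ℕ) :
    ∃ j, N ≤ j ∧ (s.map fun z => ‖z‖ ^ j / 2).sum ≤ ((s.map fun z => z ^ j).sum).re := by
  classical
  obtain ⟨j, hj, h⟩ := exists_le_re_pow s.toFinset N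
  refine ⟨j, hj, ?_⟩
  have h1 : ((s.map fun z => z ^ j).sum).re = (s.map fun z => (z ^ j).re).sum := by
    rw [← Complex.coe_reAddGroupHom, map_multiset_sum, Multiset.map_map]; rfl
  rw [h1]
  exact Multiset.sum_map_le_sum_map _ _ fun z hz => h z (Multiset.mem_toFinset.2 hz)

theorem norm_le_of_norm_sum_pow_le {s : Multiset ℂ} {C R : ℝ} (hR : 0 < R) {m j₀ : ℕ} (hm : 0 < m)
    (h : ∀ j, j₀ ≤ j → ‖(s.map fun z => z ^ (m * j)).sum‖ ≤ C * R ^ (m * j)) {z : ℂ} (hz : z ∈ s) :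
    ‖z‖ ≤ R := by
  by_contra! hlt
  have h1 : 1 < (‖z‖ / R) ^ m := one_lt_pow₀ ((one_lt_div hR).2 hlt) hm.ne'
  obtain ⟨N, hN⟩ := pow_unbounded_of_one_lt (2 * C) h1
  obtain ⟨j, hj, hle⟩ := exists_sum_norm_pow_le_re (s.map (· ^ m)) (max j₀ N)
  rw [Multiset.map_map, Multiset.map_map] at hle
  have h2 : ‖z‖ ^ (m * j) / 2 ≤ C * R ^ (m * j) := by
    calc ‖z‖ ^ (m * j) / 2 = ‖z ^ m‖ ^ j / 2 := by rw [norm_pow, pow_mul]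
      _ ≤ _ := Multiset.single_le_sum (s := s.map fun z => ‖z ^ m‖ ^ j / 2) (fun x hx => by
          obtain ⟨y, -, rfl⟩ := Multiset.mem_map.1 hx
          positivity) _ (Multiset.mem_map_of_mem (fun z => ‖z ^ m‖ ^ j / 2) hz)
      _ ≤ _ := hle
      _ ≤ _ := (Complex.re_le_norm _).trans (by
          simpa only [Function.comp, ← pow_mul] using h j (le_of_max_le_left hj))
  have h3 : ((‖z‖ / R) ^ m) ^ j ≤ 2 * C := by
    rw [← pow_mul, div_pow, div_le_iff₀ (by positivity)]
    linarith
  exact absurd (h3.trans_lt hN) (not_lt.2 (pow_le_pow_right₀ h1.le (le_of_max_le_right hj)))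

/-- The logarithmic derivative of `∏ (1 - α X)` is the generating series of power sums. -/
theorem mk_powerSum_mul_prod (s : Multiset ℂ) :
    PowerSeries.mk (fun m => if m = 0 then 0 else -(s.map (· ^ m)).sum) *
      (s.map fun α => 1 - PowerSeries.C α * PowerSeries.X).prod =
    PowerSeries.X * PowerSeries.derivative ℂ
      (s.map fun α => 1 - PowerSeries.C α * PowerSeries.X).prod := by
  induction s using Multiset.induction_on with
  | empty => simp only [Multiset.map_zero, Multiset.sum_zero, Multiset.prod_zero, mul_one,
      Derivation.map_one_eq_zero, mul_zero]; ext n; simp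
  | cons a s ih =>
    set L := (s.map fun α => 1 - PowerSeries.C α * PowerSeries.X).prod
    set S := PowerSeries.mk (fun m => if m = 0 then 0 else -(s.map (· ^ m)).sum)
    have h1 : PowerSeries.mk (fun m => if m = 0 then 0 else -((a ::ₘ s).map (· ^ m)).sum) =
        S + PowerSeries.mk (fun m => if m = 0 then 0 else - a ^ m) := by
      ext m
      simp only [S, map_add, PowerSeries.coeff_mk, Multiset.map_cons, Multiset.sum_cons]
      split_ifs <;> ring
    have h2 : PowerSeries.mk (fun m => if m = 0 then 0 else - a ^ m) *
        (1 - PowerSeries.C a * PowerSeries.X) = - (PowerSeries.C a * PowerSeries.X) := by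
      ext m
      rw [mul_sub, mul_one, ← mul_assoc, mul_comm _ (PowerSeries.C a), mul_assoc]
      rcases m with _ | _ | m
      · simp
      · simp [PowerSeries.coeff_succ_mul_X, PowerSeries.coeff_C_mul]
      · simp [PowerSeries.coeff_succ_mul_X, PowerSeries.coeff_C_mul]
        ring
    rw [h1, Multiset.map_cons, Multiset.prod_cons, Derivation.leibniz, smul_eq_mul, smul_eq_mul,
      map_sub, Derivation.leibniz]
    simp only [Derivation.map_one_eq_zero, PowerSeries.derivative_C, PowerSeries.derivative_X,
      smul_eq_mul, zero_sub, mul_zero, add_zero, mul_one]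
    linear_combination (1 - PowerSeries.C a * PowerSeries.X) * ih + L * h2

/-- A polynomial with constant coefficient `1` factors as `∏ (1 - α X)`. -/
theorem exists_eq_prod_one_sub_mul_X {f : ℂ[X]} (hf : f.coeff 0 = 1) :
    ∃ s : Multiset ℂ, s.card = f.natDegree ∧ f = (s.map fun α => 1 - C α * X).prod := by
  have hf0 : f ≠ 0 := fun h => by simp [h] at hf
  have htr : f.natTrailingDegree = 0 := natTrailingDegree_eq_zero.2 (Or.inr (by rw [hf]; norm_num))
  have hmon : f.reverse.Monic := by
    rw [Monic, reverse_leadingCoeff, trailingCoeff, htr, hf]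
  have hdeg : f.reverse.natDegree = f.natDegree := by rw [reverse_natDegree, htr, Nat.sub_zero]
  refine ⟨f.reverse.roots, ?_, ?_⟩
  · rw [← (IsAlgClosed.splits _).natDegree_eq_card_roots, hdeg]
  · have h1 := (IsAlgClosed.splits f.reverse).eq_prod_roots_of_monic hmon
    have h2 : f = f.reverse.reverse := by
      ext n
      rw [coeff_reverse, hdeg, coeff_reverse, revAt_invol]
    conv_lhs => rw [h2, h1]
    generalize f.reverse.roots = s
    induction s using Multiset.induction_on with
    | empty => simpa using reverse_C (1 : ℂ)
    | cons a s ih =>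
      rw [Multiset.map_cons, Multiset.prod_cons, reverse_mul_of_domain, ih, Multiset.map_cons,
        Multiset.prod_cons]
      congr 1
      rw [reverse, natDegree_X_sub_C, reflect_sub, reflect_C, reflect_one_X]
      simp

end PowerSums

section RiemannHypothesis

open scoped Classical

theorem exists_primeSum_eq_neg_sum_pow {F : Type*} [Field F] [Fintype F] (φ : F[X] →* ℂ) {D : ℕ}
    (hD : ∀ n, D ≤ n → monicSum φ n = 0) :
    ∃ s : Multiset ℂ, s.card ≤ D ∧ ∀ m, m ≠ 0 → primeSum φ m = -(s.map (· ^ m)).sum := by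
  let f : ℂ[X] := ∑ n ∈ Finset.range D, monomial n (monicSum φ n)
  have hfc : ∀ n, f.coeff n = monicSum φ n := fun n => by
    simp only [f, finsetSum_coeff, coeff_monomial, Finset.sum_ite_eq', Finset.mem_range]
    split_ifs with h
    · rfl
    · exact (hD n (not_lt.1 h)).symm
  obtain ⟨s, hs, hf⟩ := exists_eq_prod_one_sub_mul_X (f := f) (by rw [hfc, monicSum_zero])
  have hL : PowerSeries.mk (monicSum φ) =
      (s.map fun α => 1 - PowerSeries.C α * PowerSeries.X).prod := by
    have h1 : PowerSeries.mk (monicSum φ) = (f : PowerSeries ℂ) := by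
      ext n
      rw [PowerSeries.coeff_mk, coeff_coe, hfc]
    rw [h1, hf, ← coeToPowerSeries.ringHom_apply, map_multiset_prod, Multiset.map_map]
    congr 1
    refine Multiset.map_congr rfl fun α _ => ?_
    simp [coeToPowerSeries.ringHom_apply]
  have hL0 : PowerSeries.mk (monicSum φ) ≠ 0 := fun h => by
    have := congrArg (PowerSeries.coeff 0) h
    rw [PowerSeries.coeff_mk, monicSum_zero, map_zero] at this
    exact one_ne_zero this
  refine ⟨s, ?_, fun m hm => ?_⟩
  · rw [hs, natDegree_le_iff_coeff_eq_zero]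
    intro n hn
    rw [hfc, hD n hn.le]
  · have h1 := mk_powerSum_mul_prod s
    rw [← hL, X_mul_derivative_monicSum] at h1
    have h2 := congrArg (PowerSeries.coeff m) (mul_right_cancel₀ hL0 h1)
    rw [PowerSeries.coeff_mk, PowerSeries.coeff_mk, if_neg hm] at h2
    exact h2.symm

/-- If the fibres of `g` on `s` are nearly of equal size, then a mean-zero function of `g` has
small sum over `s`. -/
theorem norm_sum_le_of_card_fiber_le {α ι : Type*} [Fintype ι] [DecidableEq ι] [Nonempty ι]
    (s : Finset α)
    (g : α → ι) {ψ : ι → ℂ} (hψ : ∀ i, ‖ψ i‖ ≤ 1) (hsum : ∑ i, ψ i = 0) {K : ℝ}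
    (hK : ∀ i, (Fintype.card ι : ℝ) * (s.filter fun x => g x = i).card ≤ K) :
    ‖∑ x ∈ s, ψ (g x)‖ ≤ K - s.card := by
  have hι : (0 : ℝ) < Fintype.card ι := by exact_mod_cast Fintype.card_pos
  let N : ι → ℝ := fun i => (s.filter fun x => g x = i).card
  have h1 : ∑ x ∈ s, ψ (g x) = ∑ i, (N i : ℂ) * ψ i := by
    rw [← Finset.sum_fiberwise s g]
    refine Finset.sum_congr rfl fun i _ => ?_
    rw [Finset.sum_congr rfl fun x hx => by rw [(Finset.mem_filter.1 hx).2], Finset.sum_const,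
      nsmul_eq_mul]
    simp [N]
  have h2 : ∑ x ∈ s, ψ (g x) = -∑ i, ((K / Fintype.card ι - N i : ℝ) : ℂ) * ψ i := by
    rw [h1]
    simp only [Complex.ofReal_sub, sub_mul, Finset.sum_sub_distrib, ← Finset.mul_sum, hsum]
    ring
  have h3 : ∑ i, N i = s.card := by
    simp only [N]
    rw [← Nat.cast_sum, Finset.card_eq_sum_card_fiberwise (f := g) (t := Finset.univ)
      fun x _ => Finset.mem_coe.2 (Finset.mem_univ _)]
  rw [h2, norm_neg]
  calc _ ≤ ∑ i, (K / Fintype.card ι - N i) := by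
        refine norm_sum_le_of_le _ fun i _ => ?_
        have h4 : 0 ≤ K / Fintype.card ι - N i := by
          rw [sub_nonneg, le_div_iff₀ hι, mul_comm]
          exact hK i
        rw [norm_mul, Complex.norm_real, Real.norm_of_nonneg h4]
        exact mul_le_of_le_one_right h4 (hψ i)
    _ = K - s.card := by
        rw [Finset.sum_sub_distrib, h3, Finset.sum_const, nsmul_eq_mul, Finset.card_univ,
          mul_div_cancel₀ _ hι.ne']

theorem MulChar.norm_apply_unit {B : Type*} [CommRing B] [Finite B] (χ : MulChar B ℂ) (u : Bˣ) :
    ‖χ u‖ = 1 := by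
  refine Complex.norm_eq_one_of_pow_eq_one (n := Nat.card Bˣ) ?_ Nat.card_pos.ne'
  rw [← map_pow, ← Units.val_pow_eq_pow_val, pow_card_eq_one', Units.val_one, map_one]

variable {F B : Type*} (Ω : Type*) [Field F] [Fintype F] [CommRing B] [Algebra F B] [Finite B]
  [Field Ω] [Algebra F Ω] [IsAlgClosed Ω] [Algebra.IsAlgebraic F Ω]

omit [Finite B] in
theorem primeSum_eq_sum_filter_isUnit (b₀ b₁ : B) (χ : MulChar B ℂ) {m : ℕ} (hm : m ≠ 0) :
    primeSum (χ.toMonoidHom.comp (homEval (F := F) b₀ b₁)) m =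
      ∑ x ∈ (frobFixed F Ω m).filter (fun x => IsUnit (homEval b₀ b₁ (minpoly F x))),
        χ (homEval b₀ b₁ (minpoly F x ^ (m / (minpoly F x).natDegree))) := by
  rw [primeSum_eq_sum_frobFixed (Ω := Ω) _ hm, Finset.sum_filter]
  refine Finset.sum_congr rfl fun x hx => ?_
  split_ifs with h
  · rfl
  · have h1 := (map_minpoly_pow ((mem_frobFixed hm).1 hx)).1
    have h2 : m / (minpoly F x).natDegree ≠ 0 := fun h0 => hm (by rw [← h1, h0, mul_zero])
    rw [map_pow, MonoidHom.comp_apply]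
    change χ _ ^ _ = 0
    rw [χ.map_nonunit h, zero_pow h2]

/-- The Riemann hypothesis for the `L`-function attached to a character of a pencil. -/
theorem norm_primeSum_le (b₀ b₁ : B) (χ : MulChar B ℂ) {D D' : ℕ}
    (hD : ∀ n, D ≤ n → monicSum (χ.toMonoidHom.comp (homEval (F := F) b₀ b₁)) n = 0)
    (hD' : ∀ m, ((frobFixed F Ω m).filter
      fun x => ¬ IsUnit (homEval b₀ b₁ (minpoly F x))).card ≤ D')
    {x₀ : Ω} (hx₀ : IsUnit (homEval b₀ b₁ (minpoly F x₀))) {m : ℕ} (hm : m ≠ 0) :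
    ‖primeSum (χ.toMonoidHom.comp (homEval (F := F) b₀ b₁)) m‖ ≤
      D * √(Fintype.card F) ^ m := by
  obtain ⟨s, hsD, hs⟩ := exists_primeSum_eq_neg_sum_pow _ hD
  have hq : 1 < Fintype.card F := Fintype.one_lt_card
  have hq0 : 0 < √(Fintype.card F : ℝ) := Real.sqrt_pos.2 (by exact_mod_cast Fintype.card_pos)
  suffices h : ∀ z ∈ s, ‖z‖ ≤ √(Fintype.card F) by
    rw [hs m hm, norm_neg]
    calc _ ≤ ((s.map (· ^ m)).map norm).sum := norm_multiset_sum_le _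
      _ ≤ s.card • √(Fintype.card F) ^ m := by
          rw [← s.card_map fun z => ‖z ^ m‖, Multiset.map_map]
          refine Multiset.sum_le_card_nsmul _ _ fun r hr => ?_
          obtain ⟨z, hz, rfl⟩ := Multiset.mem_map.1 hr
          change ‖z ^ m‖ ≤ _
          rw [norm_pow]
          exact pow_le_pow_left₀ (norm_nonneg _) (h z hz) _
      _ ≤ _ := by
          rw [nsmul_eq_mul]
          gcongr
  obtain ⟨H, M, K, j₀, hM, hfix, hH⟩ := exists_subgroup_homEval b₀ b₁ hx₀
  set d := (minpoly F x₀).natDegree with hd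
  have hd2 : d * (2 * M / d) = 2 * M := by
    have := hfix 1
    rw [mul_one] at this
    exact (map_minpoly_pow this).1
  set w : ℂ := χ (homEval b₀ b₁ (minpoly F x₀ ^ (2 * M / d))) with hw
  have hw1 : ‖w‖ = 1 := by
    obtain ⟨u, hu⟩ := hx₀.pow (2 * M / d)
    rw [hw, map_pow, ← hu, MulChar.norm_apply_unit]
  have hwj : ∀ j, χ (homEval b₀ b₁ (minpoly F x₀ ^ (2 * M * j / d))) = w ^ j := fun j => by
    have hd0 : 0 < d := by
      rcases Nat.eq_zero_or_pos d with h | h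
      · rw [h] at hd2; omega
      · exact h
    rw [hw, ← map_pow, ← map_pow, ← pow_mul]
    congr 3
    conv_lhs => rw [← hd2]
    rw [mul_assoc, Nat.mul_div_cancel_left _ hd0]
  set Y : ℕ → Finset Ω := fun j => (frobFixed F Ω (2 * M * j)).filter
    (fun x => IsUnit (homEval b₀ b₁ (minpoly F x))) with hY
  have hm0 : ∀ j, 1 ≤ j → 2 * M * j ≠ 0 := fun j hj => by positivity
  have hYc : ∀ j, 1 ≤ j → Fintype.card F ^ (2 * M * j) ≤ (Y j).card + D' := fun j hj => by
    rw [← card_frobFixed (Ω := Ω) (hm0 j hj),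
      ← Finset.card_filter_add_card_filter_not fun x => IsUnit (homEval b₀ b₁ (minpoly F x))]
    exact Nat.add_le_add_left (hD' _) _
  have hex : ∀ j, 1 ≤ j → j₀ ≤ j → ∀ x ∈ Y j, ∃ h : H,
      homEval b₀ b₁ (minpoly F x ^ (2 * M * j / (minpoly F x).natDegree)) =
        ((h : Bˣ) : B) * homEval b₀ b₁ (minpoly F x₀ ^ (2 * M * j / d)) := fun j hj hjj x hx => by
    rw [hY, Finset.mem_filter, mem_frobFixed (hm0 j hj)] at hx
    obtain ⟨h, hh, he⟩ := (hH j hjj).1 x hx.1 hx.2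
    exact ⟨⟨h, hh⟩, he⟩
  let g : ℕ → Ω → H := fun j x => if h : ∃ h : H,
      homEval b₀ b₁ (minpoly F x ^ (2 * M * j / (minpoly F x).natDegree)) =
        ((h : Bˣ) : B) * homEval b₀ b₁ (minpoly F x₀ ^ (2 * M * j / d)) then h.choose else 1
  have hg : ∀ j, 1 ≤ j → j₀ ≤ j → ∀ x ∈ Y j,
      homEval b₀ b₁ (minpoly F x ^ (2 * M * j / (minpoly F x).natDegree)) =
        ((g j x : Bˣ) : B) * homEval b₀ b₁ (minpoly F x₀ ^ (2 * M * j / d)) :=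
    fun j hj hjj x hx => by
    have := hex j hj hjj x hx
    simp only [g, dif_pos this]
    exact this.choose_spec
  have hsum : ∀ j, 1 ≤ j → j₀ ≤ j → (s.map (· ^ (2 * M * j))).sum =
      -(w ^ j * ∑ x ∈ Y j, χ (g j x : Bˣ)) := fun j hj hjj => by
    rw [← neg_eq_iff_eq_neg, ← hs _ (hm0 j hj), primeSum_eq_sum_filter_isUnit Ω _ _ _ (hm0 j hj),
      Finset.mul_sum]
    refine Finset.sum_congr rfl fun x hx => ?_
    rw [hg j hj hjj x hx, map_mul, hwj, mul_comm]
  have : Fintype H := Fintype.ofFinite _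
  by_cases hχ : ∀ h : H, χ (h : Bˣ) = 1
  · exfalso
    obtain ⟨j, hj, hle⟩ := exists_sum_norm_pow_le_re (s.map fun z => z ^ (2 * M) / w)
      (max j₀ (D' + 1))
    have hj1 : 1 ≤ j := by omega
    have hw0 : w ≠ 0 := fun h => by simp [h] at hw1
    have h1 : ((s.map fun z => z ^ (2 * M) / w).map fun z => z ^ j).sum = -((Y j).card : ℂ) := by
      have h2 := hsum j hj1 (by omega)
      simp only [hχ, Finset.sum_const, nsmul_eq_mul, mul_one] at h2
      rw [Multiset.map_map]
      simp only [Function.comp_def, div_eq_mul_inv, mul_pow, ← pow_mul]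
      rw [Multiset.sum_map_mul_right, h2, neg_mul, mul_right_comm, ← mul_pow, mul_inv_cancel₀ hw0,
        one_pow, one_mul]
    rw [h1, Complex.neg_re, Complex.natCast_re] at hle
    have h3 : 0 < (Y j).card := by
      have h4 := hYc j hj1
      have h5 : 2 * M * j < Fintype.card F ^ (2 * M * j) := Nat.lt_pow_self hq
      have h6 : j ≤ 2 * M * j := Nat.le_mul_of_pos_left _ (by omega)
      omega
    have h7 : (0 : ℝ) ≤ ((s.map fun z => z ^ (2 * M) / w).map fun z => ‖z‖ ^ j / 2).sum := by
      refine Multiset.sum_nonneg fun r hr => ?_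
      obtain ⟨z, -, rfl⟩ := Multiset.mem_map.1 hr
      positivity
    have h8 : (0 : ℝ) < (Y j).card := by exact_mod_cast h3
    linarith
  · intro z hz
    refine norm_le_of_norm_sum_pow_le (C := K + D') (m := 2 * M) (j₀ := max j₀ 1) hq0 (by omega)
      (fun j hj => ?_) hz
    have hj1 : 1 ≤ j := by omega
    have hjj : j₀ ≤ j := by omega
    rw [hsum j hj1 hjj, norm_neg, norm_mul, norm_pow, hw1, one_pow, one_mul]
    let f : H →* ℂ := (χ.toMonoidHom.comp (Units.coeHom B)).comp H.subtype
    have hf : f ≠ 1 := fun h => hχ fun x => DFunLike.congr_fun h x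
    have hQ : (Fintype.card F : ℝ) ^ (2 * M * j) = √(Fintype.card F) ^ (2 * M * j) *
        √(Fintype.card F) ^ (2 * M * j) := by
      rw [← mul_pow, Real.mul_self_sqrt (Nat.cast_nonneg _)]
    have hQ2 : √(Fintype.card F : ℝ) ^ (2 * M * j) = (Fintype.card F : ℝ) ^ (M * j) := by
      rw [mul_assoc, pow_mul, Real.sq_sqrt (Nat.cast_nonneg _)]
    have h1 := norm_sum_le_of_card_fiber_le (Y j) (g j) (ψ := f)
      (fun h => (χ.norm_apply_unit h).le) (sum_hom_units_eq_zero f hf)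
      (K := (Fintype.card F : ℝ) ^ (2 * M * j) + K * √(Fintype.card F) ^ (2 * M * j))
      (fun h => by
        have h2 := (hH j hjj).2 h h.2 ((Y j).filter fun x => g j x = h) (fun x hx => by
          obtain ⟨hx1, rfl⟩ := Finset.mem_filter.1 hx
          refine ⟨?_, ?_, hg j hj1 hjj x hx1⟩
          · exact (mem_frobFixed (hm0 j hj1)).1 (Finset.mem_filter.1 hx1).1
          · exact (Finset.mem_filter.1 hx1).2)
        rw [hQ, hQ2, ← sq, ← Nat.card_eq_fintype_card]
        exact_mod_cast h2)
    refine h1.trans ?_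
    have h3 : (Fintype.card F : ℝ) ^ (2 * M * j) ≤ (Y j).card + D' := by
      exact_mod_cast hYc j hj1
    have h4 : 1 ≤ √(Fintype.card F : ℝ) ^ (2 * M * j) := by
      rw [hQ2]
      exact one_le_pow₀ (by exact_mod_cast hq.le)
    have h5 : (D' : ℝ) ≤ D' * √(Fintype.card F : ℝ) ^ (2 * M * j) :=
      le_mul_of_one_le_right (Nat.cast_nonneg _) h4
    rw [add_mul]
    linarith

end RiemannHypothesis

section NewtonRecursion

/-- A sequence satisfying a Newton type recursion is bounded in terms of the total mass of its
coefficients. -/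
theorem le_exp_of_mul_le_sum {b s : ℕ → ℝ} (hs : ∀ n, 0 ≤ s n) (hb : ∀ n, 0 ≤ b n)
    (hs0 : s 0 = 0) (hb0 : b 0 ≤ 1) (h : ∀ n : ℕ, n * b n ≤
      ∑ p ∈ Finset.HasAntidiagonal.antidiagonal n, s p.1 * b p.2) {K : ℝ}
    (hK : ∀ n, ∑ m ∈ Finset.range n, s m ≤ K) (n : ℕ) : b n ≤ Real.exp K := by
  have hK0 : 0 ≤ K := by simpa using hK 0
  suffices hk : ∃ k ≤ n, ∀ i ≤ n, b i ≤ K ^ k / k.factorial by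
    obtain ⟨k, -, hk⟩ := hk
    exact (hk n le_rfl).trans (Real.pow_div_factorial_le_exp K hK0 k)
  induction n with
  | zero => exact ⟨0, le_rfl, fun i hi => by simpa [Nat.le_zero.1 hi] using hb0⟩
  | succ n ih =>
    obtain ⟨k, hkn, hk⟩ := ih
    have hP : 0 ≤ K ^ k / k.factorial := by positivity
    have h1 : (n + 1 : ℝ) * b (n + 1) ≤ K * (K ^ k / k.factorial) := by
      calc (n + 1 : ℝ) * b (n + 1) ≤
            ∑ p ∈ Finset.HasAntidiagonal.antidiagonal (n + 1), s p.1 * b p.2 := by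
            exact_mod_cast h (n + 1)
        _ ≤ ∑ p ∈ Finset.HasAntidiagonal.antidiagonal (n + 1), s p.1 * (K ^ k / k.factorial) := by
            refine Finset.sum_le_sum fun p hp => ?_
            rw [Finset.HasAntidiagonal.mem_antidiagonal] at hp
            rcases Nat.eq_zero_or_pos p.1 with h0 | h0
            · simp [h0, hs0]
            · exact mul_le_mul_of_nonneg_left (hk _ (by omega)) (hs _)
        _ ≤ _ := by
            rw [← Finset.sum_mul]
            refine mul_le_mul_of_nonneg_right ?_ hP
            rw [Finset.Nat.sum_antidiagonal_eq_sum_range_succ_mk]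
            exact hK _
    have h2 : b (n + 1) ≤ K ^ (k + 1) / (k + 1).factorial := by
      have h3 : (k + 1 : ℝ) * b (n + 1) ≤ K * (K ^ k / k.factorial) :=
        (mul_le_mul_of_nonneg_right (by exact_mod_cast Nat.succ_le_succ hkn) (hb _)).trans h1
      rw [Nat.factorial_succ, Nat.cast_mul, le_div_iff₀ (by positivity), pow_succ']
      rw [← mul_div_assoc, le_div_iff₀ (by positivity)] at h3
      push_cast
      linarith
    rcases le_total (K ^ k / k.factorial) (K ^ (k + 1) / (k + 1).factorial) with h4 | h4
    · refine ⟨k + 1, by omega, fun i hi => ?_⟩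
      rcases Nat.le_succ_iff.1 hi with h5 | rfl
      · exact (hk i h5).trans h4
      · exact h2
    · refine ⟨k, by omega, fun i hi => ?_⟩
      rcases Nat.le_succ_iff.1 hi with h5 | rfl
      · exact hk i h5
      · exact h2.trans h4

theorem exists_norm_le_of_newton {A R ρ η : ℝ} (hA : 0 ≤ A) (hR : 0 < R) (hρ : 1 < ρ)
    (hη : 0 < η) : ∃ C : ℝ, 0 < C ∧ ∀ (D : ℝ) (h S : ℕ → ℂ), 0 ≤ D → ‖h 0‖ ≤ 1 → S 0 = 0 →
      (∀ n : ℕ, n * h n = -∑ p ∈ Finset.HasAntidiagonal.antidiagonal n, S p.1 * h p.2) →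
      (∀ m, ‖S m‖ ≤ A ^ m) → (∀ m, m ≠ 0 → ‖S m‖ ≤ D * R ^ m) →
      ∀ n, ‖h n‖ ≤ C * Real.exp (η * D) * (R * ρ) ^ n := by
  have hρ0 : 0 < ρ := zero_lt_one.trans hρ
  have hρ1 : ρ⁻¹ < 1 := inv_lt_one_of_one_lt₀ hρ
  obtain ⟨M, hM⟩ := exists_pow_lt_of_lt_one (mul_pos hη (sub_pos.2 hρ1)) hρ1
  have htail : ∀ N, ∑ m ∈ Finset.Ico M N, ρ⁻¹ ^ m ≤ η := fun N =>
    (geom_sum_Ico_le_of_lt_one (inv_nonneg.2 hρ0.le) hρ1).trans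
      ((div_le_iff₀ (sub_pos.2 hρ1)).2 hM.le)
  let c := A / (R * ρ)
  have hc : 0 ≤ c := div_nonneg hA (by positivity)
  refine ⟨Real.exp (∑ m ∈ Finset.range M, c ^ m), Real.exp_pos _,
    fun D h S hD h0 hS0 hrec hSA hSR n => ?_⟩
  have hpos : ∀ m, 0 < (R * ρ) ^ m := fun m => by positivity
  rw [← div_le_iff₀ (hpos n), ← Real.exp_add]
  refine le_exp_of_mul_le_sum (b := fun n => ‖h n‖ / (R * ρ) ^ n)
    (s := fun m => ‖S m‖ / (R * ρ) ^ m) (fun m => by positivity) (fun m => by positivity)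
    (by simp [hS0]) (by simpa using h0) (fun n => ?_) (fun N => ?_) n
  · have h1 : (n : ℝ) * ‖h n‖ ≤
        ∑ p ∈ Finset.HasAntidiagonal.antidiagonal n, ‖S p.1‖ * ‖h p.2‖ := by
      have := congrArg norm (hrec n)
      rw [norm_mul, Complex.norm_natCast, norm_neg] at this
      rw [this]
      exact norm_sum_le_of_le _ fun p _ => (norm_mul _ _).le
    rw [← mul_div_assoc, div_le_iff₀ (hpos n), Finset.sum_mul]
    refine h1.trans (Finset.sum_le_sum fun p hp => le_of_eq ?_)
    rw [← Finset.HasAntidiagonal.mem_antidiagonal.1 hp, pow_add]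
    have := (hpos p.1).ne'
    have := (hpos p.2).ne'
    field_simp
  · have hle : ∀ m, ‖S m‖ / (R * ρ) ^ m ≤ c ^ m := fun m => by
      rw [div_pow]
      exact div_le_div_of_nonneg_right (hSA m) (hpos m).le
    have hsmall : ∀ N, N ≤ M → ∑ m ∈ Finset.range N, ‖S m‖ / (R * ρ) ^ m ≤
        ∑ m ∈ Finset.range M, c ^ m := fun N hN =>
      (Finset.sum_le_sum fun m _ => hle m).trans
        (Finset.sum_le_sum_of_subset_of_nonneg (Finset.range_mono hN) fun m _ _ => by positivity)
    rcases le_total N M with hN | hN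
    · exact (hsmall N hN).trans (le_add_of_nonneg_right (by positivity))
    · rw [← Finset.sum_range_add_sum_Ico _ hN]
      refine add_le_add (hsmall M le_rfl) ?_
      rw [mul_comm η]
      refine le_trans ?_ (mul_le_mul_of_nonneg_left (htail N) hD)
      rw [Finset.mul_sum]
      refine Finset.sum_le_sum fun m hm => ?_
      rcases Nat.eq_zero_or_pos m with rfl | h0
      · simpa [hS0] using hD
      · rw [div_le_iff₀ (hpos m), mul_pow, inv_pow]
        have h2 := hSR m h0.ne'
        have h3 : ρ ^ m ≠ 0 := by positivity
        calc _ ≤ D * R ^ m := h2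
          _ = _ := by field_simp

end NewtonRecursion

section MoebiusSumBound

open scoped Classical

universe u

theorem MulChar.norm_apply_le_one {B : Type*} [CommRing B] [Finite B] (χ : MulChar B ℂ) (b : B) :
    ‖χ b‖ ≤ 1 := by
  by_cases hb : IsUnit b
  · obtain ⟨u, rfl⟩ := hb
    exact (χ.norm_apply_unit u).le
  · rw [χ.map_nonunit hb, norm_zero]
    exact zero_le_one

theorem primeSum_zero {F : Type*} [Field F] [Fintype F] (φ : F[X] →* ℂ) : primeSum φ 0 = 0 := by
  simp [primeSum]

theorem moebiusSum_zero {F : Type*} [Field F] [Fintype F] (φ : F[X] →* ℂ) :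
    moebiusSum φ 0 = 1 := by
  have h := congrArg (PowerSeries.coeff 0) (mk_moebiusSum_mul_mk_monicSum φ)
  rw [PowerSeries.coeff_mul] at h
  simpa [monicSum_zero] using h

/-- Multiplying a sequence by the geometric series of ratio `a` removes `a ^ m` from the coefficients
of its Newton recursion. -/
theorem newton_geometric_mul {h S : ℕ → ℂ} (a : ℂ)
    (hrec : ∀ n : ℕ, n * h n = -∑ p ∈ Finset.HasAntidiagonal.antidiagonal n, S p.1 * h p.2) :
    ∃ k : ℕ → ℂ, k 0 = h 0 ∧ (∀ n, h (n + 1) = k (n + 1) - a * k n) ∧ ∀ n : ℕ, n * k n =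
      -∑ p ∈ Finset.HasAntidiagonal.antidiagonal n, (S p.1 - if p.1 = 0 then 0 else a ^ p.1) *
        k p.2 := by
  set L : PowerSeries ℂ := 1 - PowerSeries.C a * PowerSeries.X with hL
  set G : PowerSeries ℂ := PowerSeries.mk fun n => a ^ n with hG
  set Q : PowerSeries ℂ := PowerSeries.mk fun n => if n = 0 then 0 else a ^ n with hQ
  have hGQ : G = 1 + Q := by
    ext n
    rcases n with _ | n <;> simp [hG, hQ, PowerSeries.coeff_one]
  have hGL : G * L = 1 := by
    ext n
    rw [hL, mul_sub, mul_one, mul_left_comm, map_sub, PowerSeries.coeff_C_mul]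
    rcases n with _ | n
    · simp [hG]
    · simp [hG, PowerSeries.coeff_succ_mul_X, PowerSeries.coeff_one, pow_succ']
  have hXG : PowerSeries.X * PowerSeries.derivative ℂ G = Q * G := by
    have h1 := congrArg (PowerSeries.derivative ℂ) hGL
    rw [Derivation.leibniz, smul_eq_mul, smul_eq_mul, Derivation.map_one_eq_zero, hL, map_sub,
      Derivation.leibniz] at h1
    simp only [Derivation.map_one_eq_zero, PowerSeries.derivative_C, PowerSeries.derivative_X,
      smul_eq_mul, zero_sub, mul_zero, add_zero, mul_one] at h1
    have h2 : Q * L = PowerSeries.C a * PowerSeries.X := by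
      have : Q = G - 1 := by rw [hGQ]; ring
      rw [this, sub_mul, hGL, hL]
      ring
    have h3 : PowerSeries.derivative ℂ G = PowerSeries.C a * G * G := by
      have : L * PowerSeries.derivative ℂ G = PowerSeries.C a * G := by
        rw [hL]; linear_combination h1
      calc PowerSeries.derivative ℂ G = (G * L) * PowerSeries.derivative ℂ G := by rw [hGL, one_mul]
        _ = _ := by rw [mul_assoc, this]; ring
    have h4 : Q = PowerSeries.C a * PowerSeries.X * G := by
      rw [← h2, mul_assoc, mul_comm L, hGL, mul_one]
    rw [h3, h4]
    ring
  have hH : PowerSeries.X * PowerSeries.derivative ℂ (PowerSeries.mk h) =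
      -(PowerSeries.mk S * PowerSeries.mk h) := by
    ext n
    rw [map_neg, PowerSeries.coeff_mul n (PowerSeries.mk S)]
    simp only [PowerSeries.coeff_mk]
    rw [← hrec n]
    rcases n with _ | n
    · simp
    · rw [mul_comm PowerSeries.X, PowerSeries.coeff_succ_mul_X, PowerSeries.coeff_derivative,
        PowerSeries.coeff_mk]
      push_cast
      ring
  set k : PowerSeries ℂ := PowerSeries.mk h * G with hk
  have hkL : PowerSeries.mk h = k * L := by rw [hk, mul_assoc, hGL, mul_one]
  refine ⟨fun n => PowerSeries.coeff n k, ?_, fun n => ?_, fun n => ?_⟩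
  · dsimp only
    rw [hk, PowerSeries.coeff_mul]
    simp [hG]
  · have := congrArg (PowerSeries.coeff (n + 1)) hkL
    rw [PowerSeries.coeff_mk, hL, mul_sub, mul_one, mul_left_comm, map_sub,
      PowerSeries.coeff_C_mul, PowerSeries.coeff_succ_mul_X] at this
    exact this
  · have h1 : PowerSeries.X * PowerSeries.derivative ℂ k = -((PowerSeries.mk S - Q) * k) := by
      rw [hk, Derivation.leibniz, smul_eq_mul, smul_eq_mul]
      linear_combination G * hH + PowerSeries.mk h * hXG
    have h2 := congrArg (PowerSeries.coeff n) h1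
    rw [map_neg, PowerSeries.coeff_mul n (PowerSeries.mk S - Q)] at h2
    simp only [map_sub, hQ, PowerSeries.coeff_mk] at h2
    dsimp only
    rw [← h2]
    rcases n with _ | n
    · simp
    · rw [mul_comm PowerSeries.X, PowerSeries.coeff_succ_mul_X, PowerSeries.coeff_derivative]
      push_cast
      ring

variable (F : Type*) (Ω : Type*) [Field F] [Fintype F] [Field Ω] [Algebra F Ω] [IsAlgClosed Ω]
  [Algebra.IsAlgebraic F Ω]

theorem exists_norm_moebiusSum_le {ρ η : ℝ} (hρ : 1 < ρ) (hη : 0 < η) :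
    ∃ C : ℝ, 0 < C ∧ ∀ (B : Type u) [CommRing B] [Algebra F B] [Finite B] (b₀ b₁ : B)
      (χ : MulChar B ℂ) (D : ℕ), (∀ m, ((frobFixed F Ω m).filter
        fun x => ¬ IsUnit (homEval b₀ b₁ (minpoly F x))).card ≤ D) →
      (∃ x₀ : Ω, IsUnit (homEval b₀ b₁ (minpoly F x₀))) →
      ((∀ n, D ≤ n → monicSum (χ.toMonoidHom.comp (homEval (F := F) b₀ b₁)) n = 0) ∨
        ∀ f : F[X], f.Monic → IsUnit (homEval b₀ b₁ f) → χ (homEval b₀ b₁ f) = 1) →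
      ∀ n, ‖moebiusSum (χ.toMonoidHom.comp (homEval (F := F) b₀ b₁)) n‖ ≤
        C * Real.exp (η * D) * (√(Fintype.card F) * ρ) ^ n := by
  have hq : 1 < Fintype.card F := Fintype.one_lt_card
  have hq1 : (1 : ℝ) < Fintype.card F := by exact_mod_cast hq
  have hR : 1 ≤ √(Fintype.card F : ℝ) := Real.one_le_sqrt.2 hq1.le
  have hR0 : 0 < √(Fintype.card F : ℝ) := zero_lt_one.trans_le hR
  obtain ⟨C, hC, h⟩ := exists_norm_le_of_newton (A := Fintype.card F) (Nat.cast_nonneg _) hR0 hρ hη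
  refine ⟨C * (1 + Fintype.card F), by positivity, fun B _ _ _ b₀ b₁ χ D hbad hx hor n => ?_⟩
  set φ := χ.toMonoidHom.comp (homEval (F := F) b₀ b₁)
  have hRρ : 1 ≤ √(Fintype.card F : ℝ) * ρ := one_le_mul_of_one_le_of_one_le hR hρ.le
  rcases hor with hD | htriv
  · obtain ⟨x₀, hx₀⟩ := hx
    refine (h D (moebiusSum φ) (primeSum φ) (Nat.cast_nonneg _) ?_ (primeSum_zero φ)
      (natCast_mul_moebiusSum φ) (fun m => ?_)
      (fun m hm => norm_primeSum_le Ω b₀ b₁ χ hD hbad hx₀ hm) n).trans ?_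
    · rw [moebiusSum_zero, norm_one]
    · rcases Nat.eq_zero_or_pos m with rfl | hm
      · rw [primeSum_zero, norm_zero]; positivity
      · rw [primeSum_eq_sum_frobFixed (Ω := Ω) φ hm.ne']
        refine (norm_sum_le_of_le _ fun x _ => χ.norm_apply_le_one _).trans ?_
        rw [Finset.sum_const, nsmul_eq_mul, mul_one, card_frobFixed hm.ne']
        push_cast
        rfl
    · gcongr
      exact le_mul_of_one_le_right hC.le (by linarith)
  · obtain ⟨k, hk0, hk, hrec⟩ := newton_geometric_mul (Fintype.card F : ℂ)
      (natCast_mul_moebiusSum φ)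
    have hS : ∀ m, m ≠ 0 → primeSum φ m - (if m = 0 then 0 else (Fintype.card F : ℂ) ^ m) =
        -(((frobFixed F Ω m).filter
          fun x => ¬ IsUnit (homEval b₀ b₁ (minpoly F x))).card : ℂ) := fun m hm => by
      rw [if_neg hm, primeSum_eq_sum_filter_isUnit Ω b₀ b₁ χ hm, Finset.sum_congr rfl fun x hx => by
        rw [htriv _ ((minpoly.monic (Algebra.IsIntegral.isIntegral x)).pow _)
          (by rw [map_pow]; exact (Finset.mem_filter.1 hx).2.pow _)]]
      rw [Finset.sum_const, nsmul_eq_mul, mul_one, sub_eq_iff_eq_add, ← Nat.cast_pow,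
        ← card_frobFixed (Ω := Ω) hm,
        ← Finset.card_filter_add_card_filter_not (s := frobFixed F Ω m)
          fun x => IsUnit (homEval b₀ b₁ (minpoly F x))]
      push_cast
      ring
    have hkn := h D k (fun m => primeSum φ m - if m = 0 then 0 else
      (Fintype.card F : ℂ) ^ m) (Nat.cast_nonneg _) (by rw [hk0, moebiusSum_zero, norm_one])
      (by simp [primeSum_zero]) hrec (fun m => ?_) (fun m hm => ?_)
    · rcases n with _ | n
      · rw [← hk0]
        refine (hkn 0).trans ?_
        gcongr
        exact le_mul_of_one_le_right hC.le (by linarith)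
      · rw [hk]
        refine (norm_sub_le _ _).trans ?_
        rw [norm_mul, Complex.norm_natCast]
        have h1 := hkn (n + 1)
        have h2 : ‖k n‖ ≤ C * Real.exp (η * D) * (√(Fintype.card F) * ρ) ^ (n + 1) :=
          (hkn n).trans (by gcongr; exact Nat.le_succ n)
        have h3 := mul_le_mul_of_nonneg_left h2 (zero_lt_one.trans hq1).le
        calc _ ≤ _ := add_le_add h1 h3
          _ = _ := by ring
    · rcases Nat.eq_zero_or_pos m with rfl | hm
      · simp [primeSum_zero]
      · rw [hS m hm.ne', norm_neg, Complex.norm_natCast, ← Nat.cast_pow,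
          ← card_frobFixed (Ω := Ω) hm.ne']
        exact_mod_cast Finset.card_filter_le _ _
    · rw [hS m hm, norm_neg, Complex.norm_natCast]
      calc _ ≤ (D : ℝ) := by exact_mod_cast hbad m
        _ ≤ _ := le_mul_of_one_le_right (Nat.cast_nonneg _) (one_le_pow₀ hR)

end MoebiusSumBound

section CharacterSums

open scoped Classical

theorem AddChar.exists_mulChar_eq {B : Type*} [CommRing B] (ψ : AddChar (Additive Bˣ) ℂ) :
    ∃ χ : MulChar B ℂ, ∀ u : Bˣ, χ u = ψ (Additive.ofMul u) := by
  let f : Bˣ →* ℂ :=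
    { toFun := fun u => ψ (Additive.ofMul u)
      map_one' := ψ.map_zero_eq_one
      map_mul' := fun u v => ψ.map_add_eq_mul _ _ }
  exact ⟨MulChar.ofUnitHom f.toHomUnits, fun u => by
    rw [MulChar.ofUnitHom_coe, MonoidHom.coe_toHomUnits]; rfl⟩

theorem AddChar.sum_norm_sq_sum_mul {A : Type*} [AddCommGroup A] [Fintype A] (N : A → ℂ) :
    ∑ ψ : AddChar A ℂ, ‖∑ a, N a * ψ a‖ ^ 2 = Fintype.card A * ∑ a, ‖N a‖ ^ 2 := by
  have h : ∀ ψ : AddChar A ℂ, ((‖∑ a, N a * ψ a‖ ^ 2 : ℝ) : ℂ) =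
      ∑ a, ∑ b, N a * starRingEnd ℂ (N b) * ψ (a - b) := fun ψ => by
    rw [Complex.ofReal_pow, ← Complex.mul_conj', map_sum, Finset.sum_mul_sum]
    refine Finset.sum_congr rfl fun a _ => Finset.sum_congr rfl fun b _ => ?_
    rw [map_mul, ← AddChar.map_neg_eq_conj, sub_eq_add_neg, AddChar.map_add_eq_mul]
    ring
  have h2 : ((∑ ψ : AddChar A ℂ, ‖∑ a, N a * ψ a‖ ^ 2 : ℝ) : ℂ) =
      ((Fintype.card A * ∑ a, ‖N a‖ ^ 2 : ℝ) : ℂ) := by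
    rw [Complex.ofReal_sum, Finset.sum_congr rfl fun ψ _ => h ψ, Finset.sum_comm, Complex.ofReal_mul,
      Complex.ofReal_sum, Finset.mul_sum]
    refine Finset.sum_congr rfl fun a _ => ?_
    rw [Finset.sum_comm, Finset.sum_eq_single a]
    · rw [← Finset.mul_sum, AddChar.sum_apply_eq_ite, if_pos (sub_self a), Complex.mul_conj']
      push_cast
      ring
    · intro b _ hb
      rw [← Finset.mul_sum, AddChar.sum_apply_eq_ite, if_neg (sub_ne_zero.2 hb.symm), mul_zero]
    · simp
  exact_mod_cast h2

variable {α B : Type*} [CommRing B] [Finite B]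

/-- A weighted sum over `x` of a bounded function of the unit `E x` is controlled by the twists of
the weight by multiplicative characters. -/
theorem norm_sum_filter_isUnit_le (s : Finset α) (a : α → ℂ) (E : α → B) {Θ : B → ℂ}
    (hΘ : ∀ b, ‖Θ b‖ ≤ 1) {K : ℝ} (hK : ∀ χ : MulChar B ℂ, ‖∑ x ∈ s, a x * χ (E x)‖ ≤ K) :
    ‖∑ x ∈ s.filter (fun x => IsUnit (E x)), a x * Θ (E x)‖ ≤ √(Nat.card B) * K := by
  have : Fintype Bˣ := Fintype.ofFinite _
  have hK0 : 0 ≤ K := (norm_nonneg _).trans (hK 1)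
  let N : Bˣ → ℂ := fun u => ∑ x ∈ s.filter (fun x => E x = u), a x
  have hsum : ∀ f : B → ℂ, ∑ x ∈ s.filter (fun x => IsUnit (E x)), a x * f (E x) =
      ∑ u, N u * f u := fun f => by
    rw [← Finset.sum_fiberwise (s.filter fun x => IsUnit (E x))
      (fun x => if h : IsUnit (E x) then h.unit else 1)]
    refine Finset.sum_congr rfl fun u _ => ?_
    rw [Finset.sum_mul]
    refine Finset.sum_congr ?_ fun x hx => by rw [(Finset.mem_filter.1 hx).2]
    ext x
    simp only [Finset.mem_filter, and_assoc, and_congr_right_iff]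
    intro _
    constructor
    · rintro ⟨h, h2⟩
      rw [dif_pos h] at h2
      rw [← h2, IsUnit.unit_spec]
    · intro h
      have h2 : IsUnit (E x) := h ▸ u.isUnit
      exact ⟨h2, by rw [dif_pos h2]; ext; rw [IsUnit.unit_spec, h]⟩
  have hχ : ∀ χ : MulChar B ℂ, ∑ x ∈ s, a x * χ (E x) = ∑ u : Bˣ, N u * χ u := fun χ => by
    rw [← hsum χ, Finset.sum_filter]
    refine Finset.sum_congr rfl fun x _ => ?_
    split_ifs with h
    · rfl
    · rw [χ.map_nonunit h, mul_zero]
  have hG : (0 : ℝ) < Fintype.card Bˣ := by exact_mod_cast Fintype.card_pos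
  have hL2 : ∑ u, ‖N u‖ ^ 2 ≤ K ^ 2 := by
    have h1 := AddChar.sum_norm_sq_sum_mul (A := Additive Bˣ) fun u => N u.toMul
    have h2 : ∑ ψ : AddChar (Additive Bˣ) ℂ, ‖∑ u : Additive Bˣ, N u.toMul * ψ u‖ ^ 2 ≤
        Fintype.card (Additive Bˣ) * K ^ 2 := by
      rw [← AddChar.card_eq (α := Additive Bˣ), ← nsmul_eq_mul]
      refine Finset.sum_le_card_nsmul _ _ _ fun ψ _ => ?_
      obtain ⟨χ, h3⟩ := ψ.exists_mulChar_eq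
      have h4 : ∑ u : Additive Bˣ, N u.toMul * ψ u = ∑ u : Bˣ, N u * χ u :=
        Fintype.sum_equiv Additive.toMul _ _ fun u => by rw [h3, ofMul_toMul]
      rw [h4, ← hχ]
      exact pow_le_pow_left₀ (norm_nonneg _) (hK χ) 2
    rw [h1, Fintype.card_congr Additive.toMul,
      Fintype.sum_equiv Additive.toMul _ (fun u : Bˣ => ‖N u‖ ^ 2) fun u => rfl] at h2
    exact le_of_mul_le_mul_left h2 hG
  have h3 : (∑ u : Bˣ, ‖N u‖) ^ 2 ≤ Fintype.card Bˣ * ∑ u, ‖N u‖ ^ 2 := by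
    simpa using sq_sum_le_card_mul_sum_sq (s := Finset.univ) (f := fun u : Bˣ => ‖N u‖)
  calc _ = ‖∑ u : Bˣ, N u * Θ u‖ := by rw [← hsum Θ]; congr!
    _ ≤ ∑ u : Bˣ, ‖N u‖ := norm_sum_le_of_le _ fun u _ => by
        rw [norm_mul]; exact mul_le_of_le_one_right (norm_nonneg _) (hΘ _)
    _ ≤ √(Nat.card B * K ^ 2) := by
        refine Real.le_sqrt_of_sq_le (h3.trans (mul_le_mul ?_ hL2 (by positivity) (by positivity)))
        rw [← Nat.card_eq_fintype_card]
        exact_mod_cast Nat.card_le_card_of_injective _ Units.val_injective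
    _ = √(Nat.card B) * K := by rw [Real.sqrt_mul (Nat.cast_nonneg _), Real.sqrt_sq hK0]

/-- A character sum vanishes if the fibre sizes are invariant under a unit where the character is
nontrivial. -/
theorem sum_mulChar_eq_zero [DecidableEq B] (s : Finset α) (E : α → B) (χ : MulChar B ℂ) {u : B} (hu : IsUnit u)
    (hχ : χ u ≠ 1) (h : ∀ b, (s.filter fun x => E x = b).card ≤
      (s.filter fun x => E x = u * b).card) : ∑ x ∈ s, χ (E x) = 0 := by
  have : Fintype B := Fintype.ofFinite _
  obtain ⟨u, rfl⟩ := hu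
  let N : B → ℕ := fun b => (s.filter fun x => E x = b).card
  have hN : ∀ b, N b = N (u * b) := by
    have h1 : ∑ b, N b = ∑ b, N (u * b) := (Equiv.sum_comp u.mulLeft N).symm
    exact fun b => (Finset.sum_eq_sum_iff_of_le fun b _ => h b).1 h1 b (Finset.mem_univ b)
  have hS : ∑ x ∈ s, χ (E x) = ∑ b, (N b : ℂ) * χ b := by
    rw [← Finset.sum_fiberwise s E]
    refine Finset.sum_congr rfl fun b _ => ?_
    rw [Finset.sum_congr rfl fun x hx => by rw [(Finset.mem_filter.1 hx).2], Finset.sum_const,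
      nsmul_eq_mul]
  have h2 : ∑ b, (N b : ℂ) * χ b = χ u * ∑ b, (N b : ℂ) * χ b := by
    conv_lhs => rw [← Equiv.sum_comp u.mulLeft]
    rw [Finset.mul_sum]
    refine Finset.sum_congr rfl fun b _ => ?_
    rw [Units.mulLeft_apply, ← hN, map_mul]
    ring
  rw [hS]
  have h3 : (1 - χ u) * ∑ b, (N b : ℂ) * χ b = 0 := by rw [sub_mul, one_mul, ← h2, sub_self]
  exact (mul_eq_zero.1 h3).resolve_left (sub_ne_zero.2 hχ.symm)

end CharacterSums

section ShortInterval

universe u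

theorem map_homEval {F B B' : Type*} [Field F] [CommRing B] [Algebra F B] [CommRing B']
    [Algebra F B'] (ψ : B →ₐ[F] B') (b₀ b₁ : B) (f : F[X]) :
    ψ (homEval b₀ b₁ f) = homEval (ψ b₀) (ψ b₁) f := by
  have h : ψ.comp (MvPolynomial.aeval ![b₀, b₁]) = MvPolynomial.aeval ![ψ b₀, ψ b₁] := by
    ext i
    fin_cases i <;> simp
  rw [homEval, homEval, MonoidHom.coe_mk, OneHom.coe_mk, MonoidHom.coe_mk, OneHom.coe_mk, ← h,
    AlgHom.comp_apply]

theorem aeval_homogenize_one_eq_aeval_reflect {F B : Type*} [Field F] [CommRing B] [Algebra F B]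
    (b : B) {n : ℕ} {f : F[X]} (hf : f.natDegree ≤ n) :
    MvPolynomial.aeval ![1, b] (f.homogenize n) = aeval b (reflect n f) := by
  refine induction_with_natDegree_le
    (fun f => MvPolynomial.aeval ![1, b] (f.homogenize n) = aeval b (reflect n f)) n ?_ ?_ ?_ f hf
  · simp
  · intro m r _ hm
    rw [homogenize_C_mul, homogenize_X_pow hm, reflect_C_mul_X_pow, revAt_le hm]
    simp
  · intro p q _ _ hp hq
    rw [homogenize_add, map_add, hp, hq, reflect_add, map_add]

theorem AdjoinRoot.isUnit_mk_iff {F : Type*} [Field F] {f g : F[X]} :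
    IsUnit (AdjoinRoot.mk g f) ↔ IsCoprime f g := by
  constructor
  · intro h
    obtain ⟨y, hy⟩ := h.exists_right_inv
    obtain ⟨h, rfl⟩ := AdjoinRoot.mk_surjective y
    rw [← map_mul, ← map_one (AdjoinRoot.mk g), AdjoinRoot.mk_eq_mk] at hy
    obtain ⟨c, hc⟩ := hy
    exact ⟨h, -c, by linear_combination hc⟩
  · rintro ⟨a, b, h⟩
    refine IsUnit.of_mul_eq_one (AdjoinRoot.mk g a) ?_
    rw [← map_mul, ← map_one (AdjoinRoot.mk g), AdjoinRoot.mk_eq_mk]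
    exact ⟨-b, by linear_combination h⟩

variable {F : Type u} [Field F]

/-- The residue of a polynomial modulo `g` together with its `k` leading coefficients below the
top one. -/
noncomputable def residuePair (g : F[X]) (k : ℕ) :
    F[X] →* AdjoinRoot g × AdjoinRoot (X ^ (k + 1) : F[X]) :=
  homEval (AdjoinRoot.root g, 1) (1, AdjoinRoot.root (X ^ (k + 1) : F[X]))

theorem residuePair_apply (g : F[X]) (k : ℕ) (f : F[X]) : residuePair g k f =
    (AdjoinRoot.mk g f, AdjoinRoot.mk (X ^ (k + 1)) f.reverse) := by
  ext
  · change AlgHom.fst F _ (AdjoinRoot (X ^ (k + 1) : F[X])) (residuePair g k f) = _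
    rw [residuePair, map_homEval, homEval, MonoidHom.coe_mk, OneHom.coe_mk,
      aeval_homogenize_of_eq_one le_rfl _ (by simp)]
    simp [AdjoinRoot.aeval_eq]
  · change AlgHom.snd F (AdjoinRoot g) _ (residuePair g k f) = _
    rw [residuePair, map_homEval, homEval, MonoidHom.coe_mk, OneHom.coe_mk]
    change MvPolynomial.aeval ![1, _] _ = _
    rw [aeval_homogenize_one_eq_aeval_reflect _ le_rfl]
    simp [AdjoinRoot.aeval_eq, reverse]

theorem isUnit_residuePair_iff {g f : F[X]} {k : ℕ} (hf : f.Monic) :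
    IsUnit (residuePair g k f) ↔ IsCoprime f g := by
  rw [residuePair_apply, Prod.isUnit_iff, AdjoinRoot.isUnit_mk_iff, AdjoinRoot.isUnit_mk_iff,
    and_iff_left]
  refine (IsCoprime.pow_left ((irreducible_X.coprime_iff_not_dvd).2 ?_)).symm
  rw [X_dvd_iff, coeff_zero_reverse, hf.leadingCoeff]
  exact one_ne_zero

theorem residuePair_eq_iff {g f f' : F[X]} {k n : ℕ} (hf : f.natDegree = n)
    (hf' : f'.natDegree = n) : residuePair g k f = residuePair g k f' ↔
      g ∣ f - f' ∧ ∀ i ≤ k, (reflect n (f - f')).coeff i = 0 := by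
  rw [residuePair_apply, residuePair_apply, Prod.mk.injEq, AdjoinRoot.mk_eq_mk, AdjoinRoot.mk_eq_mk,
    X_pow_dvd_iff, reverse, reverse, hf, hf', ← reflect_sub]
  simp only [Nat.lt_succ_iff]

theorem finite_adjoinRoot_prod [Finite F] {g : F[X]} (hg : g.Monic) (k : ℕ) :
    Finite (AdjoinRoot g × AdjoinRoot (X ^ (k + 1) : F[X])) := by
  have := hg.finite_adjoinRoot
  have := (monic_X_pow (R := F) (k + 1)).finite_adjoinRoot
  have := Module.finite_of_finite F (M := AdjoinRoot g)
  have := Module.finite_of_finite F (M := AdjoinRoot (X ^ (k + 1) : F[X]))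
  infer_instance

theorem natCard_adjoinRoot_prod [Fintype F] {g : F[X]} (hg : g.Monic) (k : ℕ) :
    Nat.card (AdjoinRoot g × AdjoinRoot (X ^ (k + 1) : F[X])) =
      Fintype.card F ^ (g.natDegree + (k + 1)) := by
  have h : ∀ {p : F[X]}, p.Monic → Nat.card (AdjoinRoot p) = Fintype.card F ^ p.natDegree := by
    intro p hp
    have := hp.finite_adjoinRoot
    rw [Module.natCard_eq_pow_finrank (K := F), (AdjoinRoot.powerBasis' hp).finrank,
      AdjoinRoot.powerBasis'_dim, Nat.card_eq_fintype_card]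
  rw [Nat.card_prod, h hg, h (monic_X_pow _), natDegree_X_pow, ← pow_add]

/-- The fibre of `residuePair` over any class of a multiple of `f` is a translate of the fibre
over the class of `f` by a polynomial of small degree. -/
theorem exists_residuePair_add_eq {g : F[X]} (hg : g.Monic) {k n : ℕ} (hn : g.natDegree + k < n)
    {f f₁ : F[X]} (hf : f.Monic) (hfn : f.natDegree = n) (hf₁ : f₁.Monic) :
    ∃ δ : F[X], δ.degree < n ∧ ∀ h : F[X], h.Monic → h.natDegree = n →
      residuePair g k h = residuePair g k f →
      residuePair g k (h + δ) = residuePair g k (f₁ * f) := by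
  set r := (f₁ * f).reverse - f.reverse with hr
  set r' := r %ₘ X ^ (k + 1) with hr'
  set s := (f₁ * f - f - reflect n r') %ₘ g with hs
  have hX : (X ^ (k + 1) : F[X]).Monic := monic_X_pow _
  have hr'd : r'.degree < (k + 1 : ℕ) := (degree_modByMonic_lt r hX).trans_eq (degree_X_pow _)
  have hr0 : r'.coeff 0 = 0 := by
    have h := congrArg (coeff · 0) (modByMonic_add_div r (X ^ (k + 1)))
    have h2 : r.coeff 0 = 0 := by
      rw [hr, coeff_sub, coeff_zero_reverse, coeff_zero_reverse, (hf₁.mul hf).leadingCoeff,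
        hf.leadingCoeff, sub_self]
    simpa [mul_coeff_zero, coeff_X_pow, h2] using h
  have hsd : s.degree < g.natDegree :=
    (degree_modByMonic_lt _ hg).trans_eq (degree_eq_natDegree hg.ne_zero)
  have hδ : (reflect n r' + s).degree < n := by
    refine (degree_lt_iff_coeff_zero _ _).2 fun m hm => ?_
    rw [coeff_add, coeff_reflect, coeff_eq_zero_of_degree_lt (n := m) (hsd.trans_le (by
      exact_mod_cast (by omega : g.natDegree ≤ m))), add_zero]
    obtain rfl | hm := hm.eq_or_lt
    · rw [revAt_le le_rfl, Nat.sub_self, hr0]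
    · rw [revAt_eq_self_of_lt hm]
      exact coeff_eq_zero_of_degree_lt (hr'd.trans_le (by exact_mod_cast (by omega : k + 1 ≤ m)))
  refine ⟨reflect n r' + s, hδ, fun h hh hhn hhf => ?_⟩
  have hhd : (h + (reflect n r' + s)).natDegree = n := by
    rw [natDegree_add_eq_left_of_degree_lt (by
      rwa [degree_eq_natDegree hh.ne_zero, hhn]), hhn]
  rw [residuePair_apply, residuePair_apply, Prod.mk.injEq, AdjoinRoot.mk_eq_mk,
    AdjoinRoot.mk_eq_mk] at hhf ⊢
  obtain ⟨⟨c, hc⟩, ⟨c', hc'⟩⟩ := hhf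
  constructor
  · have h1 := modByMonic_add_div (f₁ * f - f - reflect n r') g
    rw [← hs] at h1
    exact ⟨c - (f₁ * f - f - reflect n r') /ₘ g, by linear_combination hc + h1⟩
  · have h1 := modByMonic_add_div r (X ^ (k + 1))
    rw [← hr'] at h1
    have h2 : X ^ (k + 1) ∣ reflect n s := X_pow_dvd_iff.2 fun i hi => by
      rw [coeff_reflect, revAt_le (by omega)]
      exact coeff_eq_zero_of_degree_lt (hsd.trans_le (by
        exact_mod_cast (by omega : g.natDegree ≤ n - i)))
    obtain ⟨c₂, h2⟩ := h2
    have h3 : (h + (reflect n r' + s)).reverse = h.reverse + (r' + reflect n s) := by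
      rw [reverse, reverse, hhd, hhn, reflect_add, reflect_add, reflect_reflect]
    exact ⟨c' - r /ₘ X ^ (k + 1) + c₂, by
      rw [h3]; linear_combination hc' + h1 + h2 + hr⟩

open scoped Classical

theorem monicSum_residuePair_eq_zero [Fintype F] {g : F[X]} (hg : g.Monic) {k n : ℕ}
    (hn : g.natDegree + k < n) (χ : MulChar (AdjoinRoot g × AdjoinRoot (X ^ (k + 1) : F[X])) ℂ)
    {f₁ : F[X]} (hf₁ : f₁.Monic) (hu : IsUnit (residuePair g k f₁))
    (hχ : χ (residuePair g k f₁) ≠ 1) :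
    monicSum (χ.toMonoidHom.comp (residuePair g k)) n = 0 := by
  have := finite_adjoinRoot_prod hg k
  refine sum_mulChar_eq_zero (monicPolys F n) (residuePair g k) χ hu hχ fun b => ?_
  by_cases hb : ∃ f ∈ monicPolys F n, residuePair g k f = b
  swap
  · push Not at hb
    exact (Finset.card_eq_zero.2 (Finset.filter_eq_empty_iff.2 hb)).trans_le (Nat.zero_le _)
  obtain ⟨f, hf, rfl⟩ := hb
  obtain ⟨hf, hfn⟩ := mem_monicPolys.1 hf
  obtain ⟨δ, hδ, h⟩ := exists_residuePair_add_eq hg hn hf hfn hf₁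
  refine Finset.card_le_card_of_injOn (· + δ) ?_ (add_left_injective δ).injOn
  intro p hp
  simp only [Finset.coe_filter, mem_monicPolys, Set.mem_ofPred_eq] at hp ⊢
  obtain ⟨⟨hp, hpn⟩, hpf⟩ := hp
  have hd : δ.degree < p.degree := by rwa [degree_eq_natDegree hp.ne_zero, hpn]
  exact ⟨⟨hp.add_of_left hd, by rw [natDegree_add_eq_left_of_degree_lt hd, hpn]⟩, by
    rw [h p hp hpn hpf, map_mul]⟩

theorem card_filter_not_isUnit_le {Ω : Type*} [Fintype F] [Field Ω] [Algebra F Ω]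
    [Algebra.IsAlgebraic F Ω] {g : F[X]} (hg : g.Monic) (k : ℕ) (s : Finset Ω) :
    (s.filter fun x => ¬ IsUnit (residuePair g k (minpoly F x))).card ≤ g.natDegree := by
  refine (Finset.card_le_card (t := (g.map (algebraMap F Ω)).roots.toFinset) ?_).trans
    ((Multiset.toFinset_card_le _).trans ((card_roots' _).trans natDegree_map_le))
  intro x hx
  have hi : IsIntegral F x := Algebra.IsIntegral.isIntegral x
  rw [Finset.mem_filter, isUnit_residuePair_iff (minpoly.monic hi),
    (minpoly.irreducible hi).coprime_iff_not_dvd, not_not] at hx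
  rw [Multiset.mem_toFinset, mem_roots (hg.map _).ne_zero, IsRoot.def, eval_map_algebraMap]
  exact aeval_eq_zero_of_dvd_aeval_eq_zero hx.2 (minpoly.aeval F x)

/-- Square-root cancellation for twists of the Möbius function by characters of residue pairs. -/
theorem exists_norm_moebiusSum_residuePair_le (F : Type u) [Field F] [Fintype F] {ρ η : ℝ}
    (hρ : 1 < ρ) (hη : 0 < η) :
    ∃ C : ℝ, 0 < C ∧ ∀ (g : F[X]) (k : ℕ)
      (χ : MulChar (AdjoinRoot g × AdjoinRoot (X ^ (k + 1) : F[X])) ℂ), g.Monic → ∀ n,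
      ‖moebiusSum (χ.toMonoidHom.comp (residuePair g k)) n‖ ≤
        C * Real.exp (η * ↑(g.natDegree + (k + 1))) * (√(Fintype.card F) * ρ) ^ n := by
  obtain ⟨C, hC, h⟩ := exists_norm_moebiusSum_le.{u} F (AlgebraicClosure F) hρ hη
  refine ⟨C, hC, fun g k χ hg n => ?_⟩
  have := finite_adjoinRoot_prod hg k
  refine h _ (AdjoinRoot.root g, 1) (1, AdjoinRoot.root (X ^ (k + 1) : F[X])) χ _ ?_ ?_ ?_ n
  · exact fun m => (card_filter_not_isUnit_le hg k _).trans (Nat.le_add_right _ _)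
  · obtain ⟨s, hs⟩ := Infinite.exists_subset_card_eq (AlgebraicClosure F) (g.natDegree + 1)
    by_contra! hx
    change ∀ x, ¬ IsUnit (residuePair g k (minpoly F x)) at hx
    have h2 := card_filter_not_isUnit_le hg k s
    rw [Finset.filter_true_of_mem fun x _ => hx x, hs] at h2
    omega
  · by_cases h2 : ∃ f : F[X], f.Monic ∧ IsUnit (residuePair g k f) ∧ χ (residuePair g k f) ≠ 1
    · obtain ⟨f, hf, hu, hf1⟩ := h2
      exact Or.inl fun m hm => monicSum_residuePair_eq_zero hg (by omega) χ hf hu hf1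
    · push Not at h2
      exact Or.inr h2

end ShortInterval

section SquarefreeDivisors

open scoped Classical

open UniqueFactorizationMonoid

variable {F : Type*} [Field F]

theorem polyMu_mul_of_isCoprime {e f : F[X]} (he : e ≠ 0) (hf : f ≠ 0) (h : IsCoprime e f) :
    polyMu (e * f) = polyMu e * polyMu f := by
  have hsq : Squarefree (e * f) ↔ Squarefree e ∧ Squarefree f := by
    rw [squarefree_mul_iff, and_iff_right h.isRelPrime]
  unfold polyMu
  rw [hsq, normalizedFactors_mul he hf, Multiset.card_add, pow_add]
  split_ifs <;> simp_all

theorem abs_polyMu_le_one (f : F[X]) : |polyMu f| ≤ 1 := by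
  unfold polyMu
  split_ifs <;> simp

variable [Fintype F]

/-- The monic squarefree divisors of `g`. -/
noncomputable def squarefreeDivisors (g : F[X]) : Finset F[X] :=
  ((Finset.range (g.natDegree + 1)).biUnion (monicPolys F)).filter fun e => e ∣ g ∧ Squarefree e

theorem mem_squarefreeDivisors {g e : F[X]} (hg : g ≠ 0) :
    e ∈ squarefreeDivisors g ↔ e.Monic ∧ e ∣ g ∧ Squarefree e := by
  simp only [squarefreeDivisors, Finset.mem_filter, Finset.mem_biUnion, Finset.mem_range,
    mem_monicPolys]
  constructor
  · rintro ⟨⟨_, _, h, _⟩, h2⟩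
    exact ⟨h, h2⟩
  · rintro ⟨h, h2⟩
    exact ⟨⟨_, Nat.lt_succ_of_le (natDegree_le_of_dvd h2.1 hg), h, rfl⟩, h2⟩

/-- Sorting the monic polynomials by their greatest common divisor with `g`. -/
theorem sum_polyMu_eq_sum_squarefreeDivisors {g : F[X]} (hg : g ≠ 0) (m : ℕ) (G : F[X] → ℂ) :
    ∑ f ∈ monicPolys F m, (polyMu f : ℂ) * G f =
      ∑ e ∈ (squarefreeDivisors g).filter (·.natDegree ≤ m), (polyMu e : ℂ) *
        ∑ f ∈ (monicPolys F (m - e.natDegree)).filter (IsCoprime · g),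
          (polyMu f : ℂ) * G (e * f) := by
  have h0 : ∀ f : F[X], ¬ Squarefree f → polyMu f = 0 := fun f hf => if_neg hf
  have hl : ∑ f ∈ monicPolys F m, (polyMu f : ℂ) * G f =
      ∑ f ∈ (monicPolys F m).filter Squarefree, (polyMu f : ℂ) * G f := by
    refine (Finset.sum_filter_of_ne fun f _ hf => ?_).symm
    by_contra h
    exact hf (by rw [h0 f h, Int.cast_zero, zero_mul])
  have hr : ∀ e : F[X], ∑ f ∈ (monicPolys F (m - e.natDegree)).filter (IsCoprime · g),
      (polyMu f : ℂ) * G (e * f) = ∑ f ∈ ((monicPolys F (m - e.natDegree)).filter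
        (IsCoprime · g)).filter Squarefree, (polyMu f : ℂ) * G (e * f) := fun e => by
    refine (Finset.sum_filter_of_ne fun f _ hf => ?_).symm
    by_contra h
    exact hf (by rw [h0 f h, Int.cast_zero, zero_mul])
  rw [hl]
  simp_rw [hr, Finset.mul_sum, Finset.sum_sigma']
  symm
  refine Finset.sum_bij (fun a _ => a.1 * a.2) ?_ ?_ ?_ ?_
  · rintro ⟨e, f⟩ h
    simp only [Finset.mem_sigma, Finset.mem_filter, mem_squarefreeDivisors hg, mem_monicPolys] at h ⊢
    obtain ⟨⟨⟨hem, heg, hes⟩, hd⟩, ⟨⟨hfm, hfd⟩, hfg⟩, hfs⟩ := h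
    refine ⟨⟨hem.mul hfm, by rw [hem.natDegree_mul hfm, hfd]; omega⟩, squarefree_mul_iff.2
      ⟨((hfg.of_isCoprime_of_dvd_right heg).symm).isRelPrime, hes, hfs⟩⟩
  · rintro ⟨e, f⟩ h ⟨e', f'⟩ h' heq
    simp only [Finset.mem_sigma, Finset.mem_filter, mem_squarefreeDivisors hg, mem_monicPolys]
      at h h'
    obtain ⟨⟨⟨hem, heg, hes⟩, hd⟩, ⟨⟨hfm, hfd⟩, hfg⟩, hfs⟩ := h
    obtain ⟨⟨⟨hem', heg', hes'⟩, hd'⟩, ⟨⟨hfm', hfd'⟩, hfg'⟩, hfs'⟩ := h'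
    change e * f = e' * f' at heq
    have h1 : e ∣ e' := (hfg'.of_isCoprime_of_dvd_right heg).symm.dvd_of_dvd_mul_right
      (heq ▸ dvd_mul_right e f)
    have h2 : e' ∣ e := (hfg.of_isCoprime_of_dvd_right heg').symm.dvd_of_dvd_mul_right
      (heq ▸ dvd_mul_right e' f')
    obtain rfl := eq_of_monic_of_associated hem hem' (associated_of_dvd_dvd h1 h2)
    obtain rfl := mul_left_cancel₀ hem.ne_zero heq
    rfl
  · intro f hf
    simp only [Finset.mem_filter, mem_monicPolys] at hf
    obtain ⟨⟨hfm, hfd⟩, hfs⟩ := hf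
    have hd0 : EuclideanDomain.gcd f g ≠ 0 := fun h => hg (EuclideanDomain.gcd_eq_zero_iff.1 h).2
    have ha := associated_normalize (EuclideanDomain.gcd f g)
    set e := normalize (EuclideanDomain.gcd f g) with he
    have hem : e.Monic := monic_normalize hd0
    obtain ⟨f', hf'⟩ : e ∣ f := ha.symm.dvd.trans (EuclideanDomain.gcd_dvd_left f g)
    have heg : e ∣ g := ha.symm.dvd.trans (EuclideanDomain.gcd_dvd_right f g)
    have hf'm : f'.Monic := hem.of_mul_monic_left (hf' ▸ hfm)
    have hdeg : e.natDegree + f'.natDegree = m := by rw [← hfd, hf', hem.natDegree_mul hf'm]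
    have hsq := hfs
    rw [hf', squarefree_mul_iff] at hsq
    refine ⟨⟨e, f'⟩, ?_, hf'.symm⟩
    simp only [Finset.mem_sigma, Finset.mem_filter, mem_squarefreeDivisors hg, mem_monicPolys]
    refine ⟨⟨⟨hem, heg, hsq.2.1⟩, by omega⟩, ⟨⟨hf'm, by omega⟩, ?_⟩, hsq.2.2⟩
    refine isCoprime_of_irreducible_dvd (fun h => hg h.2) fun P hP hPf hPg => ?_
    refine hP.not_isUnit (hfs P ?_)
    rw [hf']
    exact mul_dvd_mul ((EuclideanDomain.dvd_gcd (hf' ▸ hPf.mul_left e) hPg).trans ha.dvd) hPf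
  · rintro ⟨e, f⟩ h
    simp only [Finset.mem_sigma, Finset.mem_filter, mem_squarefreeDivisors hg, mem_monicPolys] at h ⊢
    obtain ⟨⟨⟨hem, heg, hes⟩, hd⟩, ⟨⟨hfm, hfd⟩, hfg⟩, hfs⟩ := h
    rw [polyMu_mul_of_isCoprime hem.ne_zero hfm.ne_zero
      (hfg.of_isCoprime_of_dvd_right heg).symm]
    push_cast
    ring

theorem card_squarefreeDivisors_le {g : F[X]} (hg : g ≠ 0) :
    (squarefreeDivisors g).card ≤ 2 ^ (normalizedFactors g).toFinset.card := by
  rw [← Finset.card_powerset]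
  refine Finset.card_le_card_of_injOn (fun e => (normalizedFactors e).toFinset) ?_ ?_
  · intro e he
    rw [Finset.mem_coe, mem_squarefreeDivisors hg] at he
    rw [Finset.mem_coe, Finset.mem_powerset]
    exact Multiset.toFinset_subset.2 (Multiset.subset_of_le
      ((dvd_iff_normalizedFactors_le_normalizedFactors he.1.ne_zero hg).1 he.2.1))
  · intro e he e' he' h
    rw [Finset.mem_coe, mem_squarefreeDivisors hg] at he he'
    have h1 := (squarefree_iff_nodup_normalizedFactors he.1.ne_zero).1 he.2.2
    have h2 := (squarefree_iff_nodup_normalizedFactors he'.1.ne_zero).1 he'.2.2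
    have h3 := congrArg Finset.val h
    rw [Multiset.toFinset_val, Multiset.toFinset_val, h1.dedup, h2.dedup] at h3
    rw [← he.1.normalize_eq_self, ← he'.1.normalize_eq_self, ← prod_normalizedFactors_eq he.1.ne_zero,
      h3, prod_normalizedFactors_eq he'.1.ne_zero]

theorem mul_card_toFinset_normalizedFactors_le {g : F[X]} (hg : g.Monic) (M : ℕ) :
    M * (normalizedFactors g).toFinset.card ≤
      M * ((Finset.range M).biUnion (monicPolys F)).card + g.natDegree := by
  set W := (normalizedFactors g).toFinset with hW
  have h1 : (W.filter (·.natDegree < M)).card ≤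
      ((Finset.range M).biUnion (monicPolys F)).card := by
    refine Finset.card_le_card fun P hP => ?_
    rw [Finset.mem_filter, hW, Multiset.mem_toFinset] at hP
    rw [Finset.mem_biUnion]
    exact ⟨_, Finset.mem_range.2 hP.2, mem_monicPolys.2 ⟨monic_of_mem_normalizedFactors hP.1, rfl⟩⟩
  have h2 : (W.filter (¬ ·.natDegree < M)).card * M ≤ g.natDegree := by
    rw [natDegree_eq_sum_count hg, ← smul_eq_mul]
    refine (Finset.card_nsmul_le_sum _ (fun P : F[X] => P.natDegree) M fun P hP =>
      not_lt.1 (Finset.mem_filter.1 hP).2).trans ((Finset.sum_le_sum_of_subset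
        (Finset.filter_subset _ _)).trans (Finset.sum_le_sum fun P hP => ?_))
    rw [Finset.sum_const, Nat.card_Icc, Nat.add_sub_cancel, smul_eq_mul]
    exact Nat.le_mul_of_pos_left _ (Multiset.count_pos.2 (Multiset.mem_toFinset.1 hP))
  rw [← Finset.card_filter_add_card_filter_not (s := W) (·.natDegree < M)]
  nlinarith

variable (F) in
theorem exists_card_squarefreeDivisors_le {η : ℝ} (hη : 0 < η) :
    ∃ C : ℝ, 0 < C ∧ ∀ g : F[X], g.Monic →
      ((squarefreeDivisors g).card : ℝ) ≤ C * Real.exp (η * g.natDegree) := by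
  obtain ⟨M, hM⟩ := exists_nat_gt (Real.log 2 / η)
  have hl := Real.log_pos one_lt_two
  have hM0 : (0 : ℝ) < M := (div_pos hl hη).trans hM
  set N := ((Finset.range M).biUnion (monicPolys F)).card
  refine ⟨2 ^ N, by positivity, fun g hg => ?_⟩
  have h1 : (M * (normalizedFactors g).toFinset.card : ℝ) ≤ M * N + g.natDegree := by
    exact_mod_cast mul_card_toFinset_normalizedFactors_le hg M
  have h2 : ((squarefreeDivisors g).card : ℝ) ≤ 2 ^ (normalizedFactors g).toFinset.card := by
    exact_mod_cast card_squarefreeDivisors_le hg.ne_zero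
  have h3 : ∀ n : ℕ, (2 : ℝ) ^ n = Real.exp (n * Real.log 2) := fun n => by
    rw [Real.exp_nat_mul, Real.exp_log two_pos]
  refine h2.trans ?_
  rw [h3, h3, ← Real.exp_add, Real.exp_le_exp]
  have h4 : Real.log 2 ≤ η * M := by rw [div_lt_iff₀ hη] at hM; linarith
  have h5 : ((normalizedFactors g).toFinset.card - N : ℝ) * M ≤ g.natDegree := by linarith
  have h6 : ((normalizedFactors g).toFinset.card - N : ℝ) * Real.log 2 ≤ η * g.natDegree := by
    by_cases h7 : 0 ≤ ((normalizedFactors g).toFinset.card - N : ℝ)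
    · nlinarith
    · nlinarith [mul_nonneg hη.le (Nat.cast_nonneg (α := ℝ) g.natDegree)]
  linarith

end SquarefreeDivisors

section LinearPhase

open scoped Classical

open UniqueFactorizationMonoid

variable {F : Type*} [Field F]

theorem exists_monic_forall_apply_mul_eq_zero (lam : F[X] →ₗ[F] F) (D : ℕ) :
    ∃ g : F[X], g.Monic ∧ g.natDegree ≤ D ∧ ∀ h : F[X], h.degree < D → lam (g * h) = 0 := by
  let T : (Fin (D + 1) → F) →ₗ[F] (Fin D → F) :=
    LinearMap.pi fun i => lam ∘ₗ (LinearMap.mulRight F (X ^ (i : ℕ) : F[X])) ∘ₗ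
      (degreeLT F (D + 1)).subtype ∘ₗ (degreeLTEquiv F (D + 1)).symm.toLinearMap
  have hT : LinearMap.ker T ≠ ⊥ := LinearMap.ker_ne_bot_of_finrank_lt (by simp)
  obtain ⟨x, hx, hx0⟩ := (Submodule.ne_bot_iff _).1 hT
  obtain ⟨p, hp, rfl⟩ : ∃ (p : F[X]) (hp : p ∈ degreeLT F (D + 1)),
      degreeLTEquiv F (D + 1) ⟨p, hp⟩ = x :=
    ⟨_, ((degreeLTEquiv F (D + 1)).symm x).2, (degreeLTEquiv F (D + 1)).apply_symm_apply x⟩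
  have hp0 : p ≠ 0 := fun h => hx0 (by rwa [degreeLTEquiv_eq_zero_iff_eq_zero])
  have hpX : ∀ i < D, lam (p * X ^ i) = 0 := fun i hi => by
    have h := congrFun (LinearMap.mem_ker.1 hx) ⟨i, hi⟩
    simpa [T] using h
  refine ⟨p * C p.leadingCoeff⁻¹, monic_mul_leadingCoeff_inv hp0, ?_, fun h hh => ?_⟩
  · rw [natDegree_mul_leadingCoeff_inv _ hp0]
    exact Nat.lt_succ_iff.1 ((natDegree_lt_iff_degree_lt hp0).2 (mem_degreeLT.1 hp))
  · by_cases h0 : h = 0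
    · rw [h0, mul_zero, map_zero]
    rw [as_sum_range' h D ((natDegree_lt_iff_degree_lt h0).2 hh), Finset.mul_sum, map_sum]
    refine Finset.sum_eq_zero fun i hi => ?_
    have h1 : p * C p.leadingCoeff⁻¹ * monomial i (h.coeff i) =
        (p.leadingCoeff⁻¹ * h.coeff i) • (p * X ^ i) := by
      rw [← C_mul_X_pow_eq_monomial, smul_eq_C_mul, C_mul]
      ring
    rw [h1, map_smul, hpX i (Finset.mem_range.1 hi), smul_zero]

/-- A linear functional restricted to monic polynomials of degree `m` factors, on multiples of any
divisor, through residue pairs of complexity about `m / 2`. -/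
theorem exists_apply_eq_of_residuePair_eq (lam : F[X] →ₗ[F] F) (m : ℕ) :
    ∃ (g : F[X]) (k : ℕ), g.Monic ∧ 2 * (g.natDegree + (k + 1)) ≤ m + 3 ∧
      ∀ f f' : F[X], f.natDegree = m → f'.natDegree = m →
        residuePair g k f = residuePair g k f' → lam f = lam f' := by
  obtain ⟨g, hg, hgd, h⟩ := exists_monic_forall_apply_mul_eq_zero lam ((m + 1) / 2)
  refine ⟨g, m - g.natDegree - (m + 1) / 2, hg, by omega, fun f f' hf hf' hff => ?_⟩
  obtain ⟨⟨c, hc⟩, hi⟩ := (residuePair_eq_iff hf hf').1 hff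
  rw [← sub_eq_zero, ← map_sub, hc]
  refine h c ?_
  by_cases hc0 : c = 0
  · rw [hc0, degree_zero]; exact WithBot.bot_lt_coe _
  rw [← natDegree_lt_iff_degree_lt hc0]
  have hd : (f - f').natDegree = g.natDegree + c.natDegree := by
    rw [hc, hg.natDegree_mul' hc0]
  have hne : f - f' ≠ 0 := by rw [hc]; exact mul_ne_zero hg.ne_zero hc0
  have hle : (f - f').natDegree ≤ m := (natDegree_sub_le _ _).trans (by rw [hf, hf', max_self])
  have hlt : m - g.natDegree - (m + 1) / 2 < m - (f - f').natDegree := by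
    by_contra! hle2
    have h2 := hi _ hle2
    rw [coeff_reflect, revAt_le (Nat.sub_le _ _), Nat.sub_sub_self hle, coeff_natDegree,
      leadingCoeff_eq_zero] at h2
    exact hne h2
  omega

theorem polyMu_C_mul {c : F} (hc : c ≠ 0) (f : F[X]) : polyMu (C c * f) = polyMu f := by
  have hu : IsUnit (C c) := isUnit_C.2 hc.isUnit
  have ha : Associated (C c * f) f := associated_unit_mul_left f _ hu
  by_cases hf : f = 0
  · rw [hf, mul_zero]
  unfold polyMu
  rw [squarefree_mul_iff, and_iff_right hu.isRelPrime_left, and_iff_right hu.squarefree,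
    (associated_iff_normalizedFactors_eq_normalizedFactors (mul_ne_zero hu.ne_zero hf) hf).1 ha]

variable [Fintype F]

theorem sum_lowPoly_eq (H : F[X] → ℂ) (n : ℕ) : ∑ x : Fin n → F, H (lowPoly F n x) =
    H 0 + ∑ m ∈ Finset.range n, ∑ c ∈ Finset.univ.filter fun c : F => c ≠ 0,
      ∑ f ∈ monicPolys F m, H (C c * f) := by
  induction n with
  | zero => simp [lowPoly]
  | succ n ih =>
    have h1 : ∀ (c : F) (x : Fin n → F), lowPoly F (n + 1) (Fin.snocEquiv (fun _ => F) (c, x)) =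
        lowPoly F n x + C c * X ^ n := fun c x => by
      simp [lowPoly, Fin.sum_univ_castSucc]
    rw [← Equiv.sum_comp (Fin.snocEquiv fun _ => F), Fintype.sum_prod_type,
      ← Finset.add_sum_erase _ _ (Finset.mem_univ 0), Finset.sum_range_succ, ← add_assoc, ← ih]
    congr 1
    · exact Finset.sum_congr rfl fun x _ => by rw [h1]; simp
    · refine Finset.sum_congr (by ext; simp) fun c hc => ?_
      have hc0 : c ≠ 0 := (Finset.mem_filter.1 hc).2
      rw [monicPolys, Finset.sum_map, ← Equiv.sum_comp (MulAction.toPerm (Units.mk0 c hc0))]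
      refine Finset.sum_congr rfl fun x _ => ?_
      rw [h1]
      congr 1
      change lowPoly F n (c • x) + C c * X ^ n = C c * (X ^ n + lowPoly F n x)
      simp only [lowPoly, mul_add, Finset.mul_sum, Pi.smul_apply, smul_eq_mul, C_mul, mul_assoc]
      rw [add_comm]

end LinearPhase

section MoebiusBound

open scoped Classical

variable {F : Type*} [Field F] [Fintype F]

theorem norm_sum_mul_apply_le {g : F[X]} (hg : g.Monic) {k m : ℕ} {lam : F[X] →ₗ[F] F}
    (hlam : ∀ f f' : F[X], f.natDegree = m → f'.natDegree = m →
      residuePair g k f = residuePair g k f' → lam f = lam f') {θ : F → ℂ} (hθ : ∀ x, ‖θ x‖ ≤ 1)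
    {K : ℝ} (hK : ∀ j ≤ m, ∀ χ : MulChar (AdjoinRoot g × AdjoinRoot (X ^ (k + 1) : F[X])) ℂ,
      ‖moebiusSum (χ.toMonoidHom.comp (residuePair g k)) j‖ ≤ K) :
    ‖∑ f ∈ monicPolys F m, (polyMu f : ℂ) * θ (lam f)‖ ≤
      (squarefreeDivisors g).card *
        (√((Fintype.card F : ℝ) ^ (g.natDegree + (k + 1))) * K) := by
  have := finite_adjoinRoot_prod hg k
  have hK0 : 0 ≤ K := (norm_nonneg _).trans (hK 0 (Nat.zero_le _) 1)
  rw [sum_polyMu_eq_sum_squarefreeDivisors hg.ne_zero m fun f => θ (lam f)]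
  refine (norm_sum_le_of_le (f := fun e => _) (n := fun _ =>
    √((Fintype.card F : ℝ) ^ (g.natDegree + (k + 1))) * K) _ fun e he => ?_).trans ?_
  · obtain ⟨he, hem⟩ := Finset.mem_filter.1 he
    obtain ⟨hemon, -, -⟩ := (mem_squarefreeDivisors hg.ne_zero).1 he
    set s := monicPolys F (m - e.natDegree)
    let Θ : AdjoinRoot g × AdjoinRoot (X ^ (k + 1) : F[X]) → ℂ := fun b =>
      if h : ∃ f ∈ s, residuePair g k f = b then θ (lam (e * h.choose)) else 0
    have hΘ : ∀ b, ‖Θ b‖ ≤ 1 := fun b => by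
      by_cases h : ∃ f ∈ s, residuePair g k f = b
      · simp only [Θ, dif_pos h, hθ]
      · simp only [Θ, dif_neg h, norm_zero, zero_le_one]
    have hs : ∀ f ∈ s, (e * f).natDegree = m := fun f hf => by
      obtain ⟨hf, hfn⟩ := mem_monicPolys.1 hf
      rw [hemon.natDegree_mul hf, hfn]
      omega
    have hΘs : ∀ f ∈ s, Θ (residuePair g k f) = θ (lam (e * f)) := fun f hf => by
      have h : ∃ f' ∈ s, residuePair g k f' = residuePair g k f := ⟨f, hf, rfl⟩
      simp only [Θ, dif_pos h]
      rw [hlam _ _ (hs _ h.choose_spec.1) (hs f hf) (by rw [map_mul, map_mul, h.choose_spec.2])]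
    have h1 := norm_sum_filter_isUnit_le s (fun f => (polyMu f : ℂ)) (residuePair g k) hΘ
      (hK _ (Nat.sub_le _ _))
    rw [natCard_adjoinRoot_prod hg, Nat.cast_pow] at h1
    have h2 : ∑ f ∈ s.filter (fun f => IsUnit (residuePair g k f)),
        (polyMu f : ℂ) * Θ (residuePair g k f) =
        ∑ f ∈ s.filter (IsCoprime · g), (polyMu f : ℂ) * θ (lam (e * f)) := by
      rw [Finset.filter_congr fun f hf => isUnit_residuePair_iff (mem_monicPolys.1 hf).1]
      exact Finset.sum_congr rfl fun f hf => by rw [hΘs f (Finset.mem_filter.1 hf).1]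
    rw [h2] at h1
    refine le_trans ?_ h1
    rw [norm_mul]
    refine mul_le_of_le_one_left (norm_nonneg _) ?_
    rw [Complex.norm_intCast]
    exact_mod_cast abs_polyMu_le_one e
  · rw [Finset.sum_const, nsmul_eq_mul]
    exact mul_le_mul_of_nonneg_right (by exact_mod_cast Finset.card_filter_le _ _) (by positivity)

variable (F) in
theorem exists_norm_sum_monicPolys_le {ε : ℝ} (hε : 0 < ε) :
    ∃ C : ℝ, 0 < C ∧ ∀ (m : ℕ) (lam : F[X] →ₗ[F] F) (θ : F → ℂ), (∀ x, ‖θ x‖ ≤ 1) →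
      ‖∑ f ∈ monicPolys F m, (polyMu f : ℂ) * θ (lam f)‖ ≤
        C * ((Fintype.card F : ℝ) ^ (3 / 4 + ε)) ^ m := by
  set L := Real.log (Fintype.card F) with hL
  have hq1 : (1 : ℝ) < Fintype.card F := by exact_mod_cast Fintype.one_lt_card
  have hq : (Fintype.card F : ℝ) = Real.exp L := (Real.exp_log (zero_lt_one.trans hq1)).symm
  have hL0 : 0 < L := Real.log_pos hq1
  set η := ε * L / 2 with hη
  have hη0 : 0 < η := by positivity
  obtain ⟨C₁, hC₁, h1⟩ := exists_norm_moebiusSum_residuePair_le F (Real.one_lt_exp_iff.2 hη0) hη0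
  obtain ⟨C₂, hC₂, h2⟩ := exists_card_squarefreeDivisors_le F hη0
  have hsqrt : ∀ x : ℝ, √(Real.exp x) = Real.exp (x / 2) := fun x => (Real.exp_half x).symm
  refine ⟨C₂ * C₁ * Real.exp (3 * η + 3 * L / 4), by positivity, fun m lam θ hθ => ?_⟩
  obtain ⟨g, k, hg, hD, hlam⟩ := exists_apply_eq_of_residuePair_eq lam m
  set D := g.natDegree + (k + 1) with hDdef
  have hD' : 2 * (D : ℝ) ≤ m + 3 := by exact_mod_cast hD
  have hgD : (g.natDegree : ℝ) ≤ D := by exact_mod_cast Nat.le_add_right _ _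
  have hbase : 1 ≤ √(Fintype.card F) * Real.exp η :=
    one_le_mul_of_one_le_of_one_le (Real.one_le_sqrt.2 hq1.le) (Real.one_le_exp hη0.le)
  have h3 := norm_sum_mul_apply_le hg hlam hθ (K := C₁ * Real.exp (η * D) *
    (√(Fintype.card F) * Real.exp η) ^ m) fun j hj χ => (h1 g k χ hg j).trans
      (mul_le_mul_of_nonneg_left (pow_le_pow_right₀ hbase hj) (by positivity))
  refine h3.trans ((mul_le_mul_of_nonneg_right (h2 g hg) (by positivity)).trans ?_)
  rw [hq, ← Real.exp_nat_mul, hsqrt, hsqrt, ← Real.exp_add, ← Real.exp_nat_mul, ← Real.exp_mul,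
    ← Real.exp_nat_mul]
  calc C₂ * Real.exp (η * g.natDegree) * (Real.exp (D * L / 2) *
        (C₁ * Real.exp (η * D) * Real.exp (m * (L / 2 + η))))
      = C₂ * C₁ * Real.exp (η * g.natDegree + D * L / 2 + η * D + m * (L / 2 + η)) := by
        simp only [Real.exp_add]; ring
    _ ≤ C₂ * C₁ * Real.exp (3 * η + 3 * L / 4 + m * (L * (3 / 4 + ε))) := by
        refine mul_le_mul_of_nonneg_left (Real.exp_le_exp.2 ?_) (by positivity)
        have h4 := mul_le_mul_of_nonneg_left hgD hη0.le
        have h5 := mul_le_mul_of_nonneg_left hD' hη0.le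
        have h6 := mul_le_mul_of_nonneg_left hD' hL0.le
        have h7 : (m : ℝ) * (L * ε) = 2 * (m * η) := by rw [hη]; ring
        nlinarith
    _ = _ := by rw [Real.exp_add]; ring

end MoebiusBound

/-- For every `ε > 0` there is a constant `C = C(ε, q)` such that for every `n ≥ 1`,
every `F_q`-linear form `ℓ` on `F_q^n` and every additive character `χ` of `F_q`,
`|∑_{deg f < n} μ(f) χ(ℓ(f))| ≤ C q^((3/4+ε)n)`. -/
theorem moebius_linear_phase_bound {F : Type*} [Field F] [Fintype F] (q : ℕ)
    (hq : Fintype.card F = q) (ε : ℝ) (hε : 0 < ε) :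
    ∃ C : ℝ, ∀ n : ℕ, 1 ≤ n → ∀ ℓ : (Fin n → F) →ₗ[F] F, ∀ χ : AddChar F Circle,
      ‖∑ x : Fin n → F, (polyMu (lowPoly F n x) : ℂ) * (χ (ℓ x) : ℂ)‖ ≤
        C * (q : ℝ) ^ ((3 / 4 + ε) * n) := by
  classical
  obtain ⟨C, hC, h⟩ := exists_norm_sum_monicPolys_le F hε
  rw [hq] at h
  set r := (q : ℝ) ^ (3 / 4 + ε) with hr
  have hq1 : (1 : ℝ) < q := by rw [← hq]; exact_mod_cast Fintype.one_lt_card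
  have hr1 : 1 < r := Real.one_lt_rpow hq1 (by positivity)
  refine ⟨q * C / (r - 1), fun n _ ℓ χ => ?_⟩
  let lam : F[X] →ₗ[F] F := ℓ ∘ₗ LinearMap.pi fun i : Fin n => lcoeff F i
  have hlam : ∀ x, ℓ x = lam (lowPoly F n x) := fun x =>
    congrArg ℓ (funext fun i => (coeff_lowPoly x i).symm)
  have hmu0 : polyMu (0 : F[X]) = 0 := if_neg not_squarefree_zero
  simp_rw [hlam]
  rw [sum_lowPoly_eq (fun f => (polyMu f : ℂ) * (χ (lam f) : ℂ)), hmu0, Int.cast_zero, zero_mul,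
    zero_add]
  calc _ ≤ ∑ m ∈ Finset.range n, q * (C * r ^ m) := norm_sum_le_of_le _ fun m _ => by
        refine (norm_sum_le_of_le (f := fun c => _) (n := fun _ => C * r ^ m) _
          fun c hc => ?_).trans ?_
        · simp_rw [polyMu_C_mul (Finset.mem_filter.1 hc).2, ← smul_eq_C_mul, map_smul, smul_eq_mul]
          exact h m lam (fun x => χ (c * x)) fun x => (Circle.norm_coe _).le
        · rw [Finset.sum_const, nsmul_eq_mul]
          refine mul_le_mul_of_nonneg_right ?_ (by positivity)
          rw [← hq]
          exact_mod_cast Finset.card_filter_le _ _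
    _ = q * C * ((r ^ n - 1) / (r - 1)) := by
        rw [← geom_sum_eq hr1.ne', Finset.mul_sum]
        exact Finset.sum_congr rfl fun m _ => (mul_assoc _ _ _).symm
    _ ≤ q * C * (r ^ n / (r - 1)) := by
        refine mul_le_mul_of_nonneg_left (div_le_div_of_nonneg_right (by linarith) ?_)
          (by positivity)
        linarith
    _ = _ := by
        rw [Real.rpow_mul (by positivity), ← hr, Real.rpow_natCast]
        ring
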